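/- arXiv:2406.07273 — 4 statements merged into one kernel-verified Lean document; each statement's English description precedes it below -/
import Mathlib

section
/- There exists an infinite-dimensional real Banach space X such that for every two-dimensional linear subspace Z of the dual space X*, the intersection of Z with NA(X,ℝ) is contained in the union of two one-dimensional linear subspaces of X*; that is, there exist f, g ∈ X* such that Z ∩ NA(X,ℝ) ⊆ span{f} ∪ span{g}. -/
noncomputable section

open Filter Topology
open scoped ZeroAtInfty

namespace AlgebraicallyTrivialNA

/-- A convex `C¹` function vanishing exactly on `[-1, 1]`. -/
def flatBump (t : ℝ) : ℝ := max (t - 1) 0 ^ 2 + max (-t - 1) 0 ^ 2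

/-- The derivative of `flatBump`. -/
def flatBumpDeriv (t : ℝ) : ℝ := 2 * max (t - 1) 0 - 2 * max (-t - 1) 0

lemma flatBump_nonneg (t : ℝ) : 0 ≤ flatBump t := by unfold flatBump; positivity

lemma flatBump_neg (t : ℝ) : flatBump (-t) = flatBump t := by
  simp only [flatBump, neg_neg]; ring

lemma flatBump_eq_zero {t : ℝ} (ht : |t| ≤ 1) : flatBump t = 0 := by
  obtain ⟨h1, h2⟩ := abs_le.mp ht
  simp [flatBump, max_eq_right (show t - 1 ≤ 0 by linarith),
    max_eq_right (show -t - 1 ≤ 0 by linarith)]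

lemma flatBumpDeriv_eq_zero {t : ℝ} (ht : |t| ≤ 1) : flatBumpDeriv t = 0 := by
  obtain ⟨h1, h2⟩ := abs_le.mp ht
  simp [flatBumpDeriv, max_eq_right (show t - 1 ≤ 0 by linarith),
    max_eq_right (show -t - 1 ≤ 0 by linarith)]

lemma flatBumpDeriv_neg (t : ℝ) : flatBumpDeriv (-t) = -flatBumpDeriv t := by
  simp only [flatBumpDeriv, neg_neg]; ring

lemma flatBumpDeriv_mul_self_nonneg (t : ℝ) : 0 ≤ flatBumpDeriv t * t := by
  unfold flatBumpDeriv
  rcases max_cases (t - 1) 0 with ⟨h, h'⟩ | ⟨h, h'⟩ <;>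
  rcases max_cases (-t - 1) 0 with ⟨k, k'⟩ | ⟨k, k'⟩ <;> rw [h, k] <;> nlinarith

lemma abs_le_two_of_flatBump_le_one {t : ℝ} (ht : flatBump t ≤ 1) : |t| ≤ 2 := by
  unfold flatBump at ht
  have h1 := le_max_left (t - 1) 0
  have h2 := le_max_left (-t - 1) 0
  have h3 := le_max_right (t - 1) 0
  have h4 := le_max_right (-t - 1) 0
  rw [abs_le]
  constructor <;> nlinarith

lemma convexOn_flatBump : ConvexOn ℝ Set.univ flatBump := by
  have h1 : ConvexOn ℝ Set.univ (fun t : ℝ => max (t - 1) 0) :=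
    (((convexOn_id convex_univ).add_const (-1)).sup (convexOn_const 0 convex_univ)).congr
      fun t _ => by simp [sub_eq_add_neg]
  have h2 : ConvexOn ℝ Set.univ (fun t : ℝ => max (-t - 1) 0) :=
    ((((concaveOn_id convex_univ).neg).add_const (-1)).sup (convexOn_const 0 convex_univ)).congr
      fun t _ => by simp [sub_eq_add_neg]
  exact (h1.pow (fun _ _ => le_max_right _ _) 2).add (h2.pow (fun _ _ => le_max_right _ _) 2)

lemma hasDerivAt_max_zero_sq (s : ℝ) :
    HasDerivAt (fun t : ℝ => max t 0 ^ 2) (2 * max s 0) s := by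
  rcases lt_trichotomy s 0 with h | rfl | h
  · rw [max_eq_right h.le, mul_zero]
    refine (hasDerivAt_const s (0 : ℝ)).congr_of_eventuallyEq ?_
    filter_upwards [Iio_mem_nhds h] with t ht
    simp [max_eq_right (le_of_lt (Set.mem_Iio.mp ht))]
  · rw [max_self, mul_zero, hasDerivAt_iff_isLittleO]
    have h1 : (fun t : ℝ => t ^ 2) =o[𝓝 0] fun t => t := by
      simpa using Asymptotics.isLittleO_pow_pow (𝕜 := ℝ) (m := 1) (n := 2) (by norm_num)
    refine Asymptotics.IsBigO.trans_isLittleO (Asymptotics.isBigO_of_le _ fun t => ?_)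
      (h1.congr_right fun t => (sub_zero t).symm)
    simp only [max_self, smul_zero, sub_zero, norm_pow, Real.norm_eq_abs]
    norm_num
    rcases max_cases t 0 with ⟨h, h'⟩ | ⟨h, h'⟩ <;> rw [h]
    simpa using sq_nonneg t
  · rw [max_eq_left h.le]
    refine HasDerivAt.congr_of_eventuallyEq (f := fun t => t ^ 2) (by simpa using hasDerivAt_pow 2 s) ?_
    filter_upwards [Ioi_mem_nhds h] with t ht
    simp [max_eq_left (le_of_lt (Set.mem_Ioi.mp ht))]

lemma hasDerivAt_flatBump (s : ℝ) : HasDerivAt flatBump (flatBumpDeriv s) s := by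
  have h1 := (hasDerivAt_max_zero_sq (s - 1)).comp s ((hasDerivAt_id s).sub_const 1)
  have h2 := (hasDerivAt_max_zero_sq (-s - 1)).comp s ((hasDerivAt_id s).neg.sub_const 1)
  refine (h1.add h2).congr_deriv ?_
  simp only [flatBumpDeriv]; ring

lemma hasDerivAt_flatBump_line (a b : ℝ) :
    HasDerivAt (fun t : ℝ => flatBump (a + t * b)) (flatBumpDeriv a * b) 0 := by
  have h : HasDerivAt (fun t : ℝ => a + t * b) b 0 := by
    simpa using ((hasDerivAt_id (0 : ℝ)).mul_const b).const_add a
  have h0 : HasDerivAt flatBump (flatBumpDeriv a) (a + 0 * b) := by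
    simpa using hasDerivAt_flatBump a
  exact h0.comp (0 : ℝ) h

lemma summable_geometric_mul {c : ℕ → ℝ} {C : ℝ} (hc : ∀ m, |c m| ≤ C) :
    Summable fun m => (1 / 4 : ℝ) ^ m * c m := by
  refine Summable.of_norm_bounded
    ((summable_geometric_of_lt_one (r := (1 / 4 : ℝ)) (by norm_num) (by norm_num)).mul_right C)
    fun m => ?_
  rw [norm_mul, Real.norm_of_nonneg (by positivity)]
  exact mul_le_mul_of_nonneg_left (hc m) (by positivity)

lemma abs_pow_mul_pow_le {x y A B : ℝ} (hx : |x| ≤ A) (hy : |y| ≤ B) (i j : ℕ) :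
    |x ^ i * y ^ j| ≤ A ^ i * B ^ j := by
  rw [abs_mul, abs_pow, abs_pow]
  have := (abs_nonneg x).trans hx
  gcongr

lemma hasDerivAt_quartic_line {a b : ℕ → ℝ} {A B : ℝ} (ha : ∀ m, |a m| ≤ A)
    (hb : ∀ m, |b m| ≤ B) :
    HasDerivAt (fun t : ℝ => ∑' m, (1 / 4 : ℝ) ^ m * (a m + t * b m) ^ 4)
      (∑' m, (1 / 4 : ℝ) ^ m * (4 * a m ^ 3 * b m)) 0 := by
  have hs (i j : ℕ) : Summable fun m => (1 / 4 : ℝ) ^ m * (a m ^ i * b m ^ j) :=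
    summable_geometric_mul fun m => abs_pow_mul_pow_le (ha m) (hb m) i j
  set S : ℕ → ℕ → ℝ := fun i j => ∑' m, (1 / 4 : ℝ) ^ m * (a m ^ i * b m ^ j) with hS
  have key (t : ℝ) : ∑' m, (1 / 4 : ℝ) ^ m * (a m + t * b m) ^ 4 =
      S 4 0 + t * (4 * S 3 1) + t ^ 2 * (6 * S 2 2) + t ^ 3 * (4 * S 1 3) + t ^ 4 * S 0 4 := by
    refine HasSum.tsum_eq ?_
    convert ((((hs 4 0).hasSum.add (((hs 3 1).hasSum.mul_left 4).mul_left t)).add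
      (((hs 2 2).hasSum.mul_left 6).mul_left (t ^ 2))).add
      (((hs 1 3).hasSum.mul_left 4).mul_left (t ^ 3))).add ((hs 0 4).hasSum.mul_left (t ^ 4))
      using 2 with m
    ring
  have hval : ∑' m, (1 / 4 : ℝ) ^ m * (4 * a m ^ 3 * b m) = 4 * S 3 1 := by
    rw [hS, ← tsum_mul_left]
    exact tsum_congr fun m => by ring
  simp_rw [key]
  rw [hval]
  have h (n : ℕ) (c : ℝ) := (hasDerivAt_pow n (0 : ℝ)).mul_const c
  have h1 := (hasDerivAt_id (0 : ℝ)).mul_const (4 * S 3 1)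
  refine (((((hasDerivAt_const (0 : ℝ) (S 4 0)).add h1).add (h 2 (6 * S 2 2))).add
    (h 3 (4 * S 1 3))).add (h 4 (S 0 4))).congr_deriv ?_
  norm_num

lemma abs_apply_le (x : C₀(ℕ, ℝ)) (n : ℕ) : |x n| ≤ ‖x‖ := x.toBCF.norm_coe_le_norm n

lemma finite_lt_abs_apply (x : C₀(ℕ, ℝ)) {r : ℝ} (hr : 0 < r) : {n | r < |x n|}.Finite := by
  have h : Tendsto x (cocompact ℕ) (𝓝 0) := x.zero_at_infty'
  rw [cocompact_eq_cofinite] at h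
  have h2 := (tendsto_zero_iff_abs_tendsto_zero _).mp h
  have h3 := h2.eventually (gt_mem_nhds hr)
  refine (eventually_cofinite.mp h3).subset fun n hn => ?_
  simp only [Set.mem_ofPred_eq, Function.comp_apply, not_lt] at hn ⊢
  exact hn.le

/-- The canonical unit vectors of `c₀`. -/
def unitVec (n : ℕ) : C₀(ℕ, ℝ) where
  toFun := Pi.single n 1
  continuous_toFun := continuous_of_discreteTopology
  zero_at_infty' := by
    rw [cocompact_eq_cofinite, Nat.cofinite_eq_atTop]
    refine tendsto_const_nhds.congr' ?_
    filter_upwards [eventually_gt_atTop n] with k hk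
    simp [Pi.single_eq_of_ne hk.ne']

lemma unitVec_apply (n k : ℕ) : unitVec n k = if k = n then 1 else 0 := by
  change (Pi.single n 1 : ℕ → ℝ) k = _
  rw [Pi.single_apply]

/-- The flat part of the modulus. -/
def flatPart (x : C₀(ℕ, ℝ)) : ℝ := ∑' n, flatBump (x n)

lemma summable_flatBump (x : C₀(ℕ, ℝ)) : Summable fun n => flatBump (x n) :=
  summable_of_hasFiniteSupport <| (finite_lt_abs_apply x one_pos).subset fun n hn => by
    by_contra h
    exact hn (flatBump_eq_zero (not_lt.mp h))

lemma summable_flatBumpDeriv (x v : C₀(ℕ, ℝ)) : Summable fun n => flatBumpDeriv (x n) * v n :=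
  summable_of_hasFiniteSupport <| (finite_lt_abs_apply x one_pos).subset fun n hn => by
    by_contra h
    exact hn (by simp [flatBumpDeriv_eq_zero (not_lt.mp h)])

lemma hasDerivAt_flatPart_line (x v : C₀(ℕ, ℝ)) :
    HasDerivAt (fun t : ℝ => flatPart (x + t • v)) (∑' n, flatBumpDeriv (x n) * v n) 0 := by
  have hfin := (finite_lt_abs_apply x (r := 1 / 2) (by norm_num)).union
    (finite_lt_abs_apply v (r := 1 / 2) (by norm_num))
  have hout : ∀ n ∉ hfin.toFinset, |x n| ≤ 1 / 2 ∧ |v n| ≤ 1 / 2 := fun n hn => by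
    simpa [not_or] using hn
  rw [tsum_eq_sum (s := hfin.toFinset) fun n hn => by
    simp [flatBumpDeriv_eq_zero ((hout n hn).1.trans (by norm_num))]]
  refine (HasDerivAt.fun_sum fun n _ => hasDerivAt_flatBump_line (x n) (v n)).congr_of_eventuallyEq ?_
  filter_upwards [Metric.ball_mem_nhds (0 : ℝ) one_pos] with t ht
  have ht' : |t| < 1 := by simpa using ht
  refine tsum_eq_sum fun n hn => flatBump_eq_zero ?_
  have h := hout n hn
  calc |x n + t * v n| ≤ |x n| + |t| * |v n| := (abs_add_le _ _).trans_eq (by rw [abs_mul])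
    _ ≤ 1 / 2 + 1 * (1 / 2) := by gcongr <;> simp_all
    _ = 1 := by norm_num

lemma summable_tail (x : C₀(ℕ, ℝ)) (m : ℕ) :
    Summable fun n => (if (Nat.unpair n).1 = m then (1 / 2 : ℝ) ^ n else 0) * x n := by
  refine Summable.of_norm_bounded (summable_geometric_two.mul_right ‖x‖) fun n => ?_
  rw [norm_mul]
  refine mul_le_mul ?_ (abs_apply_le x n) (norm_nonneg _) (by positivity)
  split_ifs <;> simp

/-- The functional with coefficients `2⁻ⁿ` on the `m`-th row of the pairing `ℕ × ℕ ≃ ℕ`. -/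
def tail (m : ℕ) : C₀(ℕ, ℝ) →ₗ[ℝ] ℝ where
  toFun x := ∑' n, (if (Nat.unpair n).1 = m then (1 / 2 : ℝ) ^ n else 0) * x n
  map_add' x y := by
    rw [← (summable_tail x m).tsum_add (summable_tail y m)]
    exact tsum_congr fun n => by simp [mul_add]
  map_smul' c x := by
    rw [RingHom.id_apply, smul_eq_mul, ← tsum_mul_left]
    exact tsum_congr fun n => by
        rw [ZeroAtInftyContinuousMap.smul_apply, smul_eq_mul]; ring

lemma abs_tail_le (m : ℕ) (x : C₀(ℕ, ℝ)) : |tail m x| ≤ 2 * ‖x‖ := by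
  rw [← tsum_geometric_two, ← tsum_mul_right, ← Real.norm_eq_abs]
  refine tsum_of_norm_bounded
    (f := fun n => (if (Nat.unpair n).1 = m then (1 / 2 : ℝ) ^ n else 0) * x n)
    (summable_geometric_two.mul_right ‖x‖).hasSum fun n => ?_
  rw [norm_mul]
  refine mul_le_mul ?_ (abs_apply_le x n) (norm_nonneg _) (by positivity)
  split_ifs <;> simp

lemma tendsto_tail (x : C₀(ℕ, ℝ)) : Tendsto (fun m => tail m x) atTop (𝓝 0) := by
  rw [← tsum_zero (β := ℕ) (α := ℝ)]
  refine tendsto_tsum_of_dominated_convergence (summable_geometric_two.mul_right ‖x‖)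
    (fun n => ?_) (Eventually.of_forall fun m n => ?_)
  · refine tendsto_const_nhds.congr' ?_
    filter_upwards [eventually_gt_atTop (Nat.unpair n).1] with m hm
    simp [hm.ne]
  · rw [norm_mul]
    refine mul_le_mul ?_ (abs_apply_le x n) (norm_nonneg _) (by positivity)
    split_ifs <;> simp

lemma tail_unitVec (m n : ℕ) :
    tail m (unitVec n) = if (Nat.unpair n).1 = m then (1 / 2 : ℝ) ^ n else 0 := by
  change ∑' k, (if (Nat.unpair k).1 = m then (1 / 2 : ℝ) ^ k else 0) * unitVec n k = _
  rw [tsum_eq_single n fun k hk => by simp [unitVec_apply, hk]]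
  simp [unitVec_apply]

/-- The functional `x ↦ x p + s x q` with `s ∈ {0, 1, 2, 3}`, where `m` encodes `p`, `q`, `s` and
one further number. -/
def head (m : ℕ) : C₀(ℕ, ℝ) →ₗ[ℝ] ℝ where
  toFun x := x m.unpair.1.unpair.1 +
    ((m.unpair.1.unpair.2.unpair.2 % 4 : ℕ) : ℝ) * x m.unpair.1.unpair.2.unpair.1
  map_add' x y := by simp; ring
  map_smul' c x := by simp; ring

lemma head_apply (m : ℕ) (x : C₀(ℕ, ℝ)) : head m x = x m.unpair.1.unpair.1 +
    ((m.unpair.1.unpair.2.unpair.2 % 4 : ℕ) : ℝ) * x m.unpair.1.unpair.2.unpair.1 := rfl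

lemma head_pair (p q l : ℕ) (s : ℕ) (hs : s < 4) (x : C₀(ℕ, ℝ)) :
    head (Nat.pair (Nat.pair p (Nat.pair q s)) l) x = x p + s * x q := by
  simp [head_apply, Nat.mod_eq_of_lt hs]

lemma abs_head_le (m : ℕ) (x : C₀(ℕ, ℝ)) : |head m x| ≤ 4 * ‖x‖ := by
  rw [head_apply]
  set s := m.unpair.1.unpair.2.unpair.2 % 4 with hs
  have h4 : (s : ℝ) ≤ 3 := by
    have : s ≤ 3 := by omega
    exact_mod_cast this
  have h1 := abs_apply_le x m.unpair.1.unpair.1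
  have h2 := abs_apply_le x m.unpair.1.unpair.2.unpair.1
  refine (abs_add_le _ _).trans ?_
  rw [abs_mul (s : ℝ), abs_of_nonneg (Nat.cast_nonneg s : (0 : ℝ) ≤ s)]
  nlinarith [mul_le_mul h4 h2 (abs_nonneg _) (by norm_num)]

lemma head_unitVec_eq_zero {m n : ℕ} (h : m < n) : head m (unitVec n) = 0 := by
  have h0 := Nat.unpair_left_le m
  have h1 := Nat.unpair_left_le m.unpair.1
  have h2 := Nat.unpair_right_le m.unpair.1
  have h3 := Nat.unpair_left_le m.unpair.1.unpair.2
  rw [head_apply, unitVec_apply, unitVec_apply, if_neg (by omega), if_neg (by omega)]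
  simp

lemma norm_unitVec_le (n : ℕ) : ‖unitVec n‖ ≤ 1 := by
  refine (BoundedContinuousFunction.norm_le (f := (unitVec n).toBCF) zero_le_one).mpr fun k => ?_
  change ‖unitVec n k‖ ≤ 1
  rw [unitVec_apply]
  split_ifs <;> simp

/-- The functionals along which the quartic part of the modulus is taken. -/
def probe (m : ℕ) : C₀(ℕ, ℝ) →ₗ[ℝ] ℝ := head m + tail m

lemma abs_probe_le (m : ℕ) (x : C₀(ℕ, ℝ)) : |probe m x| ≤ 6 * ‖x‖ := by
  have h1 := abs_head_le m x
  have h2 := abs_tail_le m x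
  calc |head m x + tail m x| ≤ |head m x| + |tail m x| := abs_add_le _ _
    _ ≤ 6 * ‖x‖ := by linarith

lemma tendsto_probe (p q : ℕ) {s : ℕ} (hs : s < 4) (x : C₀(ℕ, ℝ)) :
    Tendsto (fun l => probe (Nat.pair (Nat.pair p (Nat.pair q s)) l) x) atTop
      (𝓝 (x p + s * x q)) := by
  have h : Tendsto (fun l => Nat.pair (Nat.pair p (Nat.pair q s)) l) atTop atTop :=
    tendsto_atTop_mono (fun l => Nat.right_le_pair _ l) tendsto_id
  simpa [probe, head_pair p q _ s hs x] using
    ((tendsto_tail x).comp h).const_add (x p + s * x q)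

lemma exists_probe_ne_zero {x : C₀(ℕ, ℝ)} (hx : x ≠ 0) : ∃ m, probe m x ≠ 0 := by
  by_contra! h
  refine hx (ZeroAtInftyContinuousMap.ext fun p => ?_)
  have := tendsto_probe p 0 (s := 0) (by norm_num) x
  simp only [h] at this
  simpa using (tendsto_nhds_unique this tendsto_const_nhds)

/-- The quartic part of the modulus. -/
def quarticPart (x : C₀(ℕ, ℝ)) : ℝ := ∑' m, (1 / 4 : ℝ) ^ m * probe m x ^ 4

lemma summable_quartic (x : C₀(ℕ, ℝ)) : Summable fun m => (1 / 4 : ℝ) ^ m * probe m x ^ 4 :=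
  summable_geometric_mul fun m => by
    simpa using abs_pow_mul_pow_le (abs_probe_le m x) (le_refl |(0 : ℝ)|) 4 0

lemma summable_quarticDeriv (x v : C₀(ℕ, ℝ)) :
    Summable fun m => (1 / 4 : ℝ) ^ m * (4 * probe m x ^ 3 * probe m v) := by
  refine ((summable_geometric_mul fun m =>
    abs_pow_mul_pow_le (abs_probe_le m x) (abs_probe_le m v) 3 1).mul_left 4).congr fun m => ?_
  ring

/-- An even convex function on `c₀` whose unit sublevel set is the ball of the new norm. -/
def modulus (x : C₀(ℕ, ℝ)) : ℝ := flatPart x + quarticPart x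

/-- The Gateaux derivative of `modulus`. -/
def modulusDeriv (x : C₀(ℕ, ℝ)) : C₀(ℕ, ℝ) →ₗ[ℝ] ℝ where
  toFun v := ∑' n, flatBumpDeriv (x n) * v n +
    ∑' m, (1 / 4 : ℝ) ^ m * (4 * probe m x ^ 3 * probe m v)
  map_add' v w := by
    rw [add_add_add_comm, ← (summable_flatBumpDeriv x v).tsum_add (summable_flatBumpDeriv x w),
      ← (summable_quarticDeriv x v).tsum_add (summable_quarticDeriv x w)]
    congr 1
    · exact tsum_congr fun n => by simp [mul_add]
    · exact tsum_congr fun n => by rw [map_add]; ring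
  map_smul' c v := by
    rw [RingHom.id_apply, smul_eq_mul, mul_add, ← tsum_mul_left, ← tsum_mul_left]
    congr 1
    · exact tsum_congr fun n => by
        rw [ZeroAtInftyContinuousMap.smul_apply, smul_eq_mul]; ring
    · exact tsum_congr fun n => by rw [map_smul, smul_eq_mul]; ring

lemma modulusDeriv_apply (x v : C₀(ℕ, ℝ)) : modulusDeriv x v = ∑' n, flatBumpDeriv (x n) * v n +
    ∑' m, (1 / 4 : ℝ) ^ m * (4 * probe m x ^ 3 * probe m v) := rfl

lemma modulusDeriv_neg (x : C₀(ℕ, ℝ)) : modulusDeriv (-x) = -modulusDeriv x := by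
  ext v
  rw [LinearMap.neg_apply, modulusDeriv_apply, modulusDeriv_apply, neg_add, ← tsum_neg, ← tsum_neg]
  congr 1
  · exact tsum_congr fun n => by simp [flatBumpDeriv_neg]
  · exact tsum_congr fun n => by rw [map_neg]; ring

lemma hasDerivAt_modulus_line (x v : C₀(ℕ, ℝ)) :
    HasDerivAt (fun t : ℝ => modulus (x + t • v)) (modulusDeriv x v) 0 := by
  refine (hasDerivAt_flatPart_line x v).add ?_
  simpa [quarticPart] using
    hasDerivAt_quartic_line (fun m => abs_probe_le m x) (fun m => abs_probe_le m v)

lemma modulusDeriv_self_pos {x : C₀(ℕ, ℝ)} (hx : x ≠ 0) : 0 < modulusDeriv x x := by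
  obtain ⟨m, hm⟩ := exists_probe_ne_zero hx
  refine add_pos_of_nonneg_of_pos (tsum_nonneg fun n => flatBumpDeriv_mul_self_nonneg _) ?_
  have h (m : ℕ) : 4 * probe m x ^ 3 * probe m x = 4 * probe m x ^ 4 := by ring
  refine (summable_quarticDeriv x x).tsum_pos (fun k => ?_) m ?_
  · rw [h]; positivity
  · rw [h]; positivity

lemma modulus_neg (x : C₀(ℕ, ℝ)) : modulus (-x) = modulus x := by
  unfold modulus flatPart quarticPart
  congr 1
  · exact tsum_congr fun n => by simp [flatBump_neg]
  · exact tsum_congr fun n => by rw [map_neg]; ring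

lemma modulus_le_one_of_norm_le {x : C₀(ℕ, ℝ)} (hx : ‖x‖ ≤ 1 / 10) : modulus x ≤ 1 := by
  have h1 : flatPart x = 0 := by
    refine (tsum_congr fun n => flatBump_eq_zero ?_).trans tsum_zero
    exact (abs_apply_le x n).trans (hx.trans (by norm_num))
  have h2 : quarticPart x ≤ (1 - 1 / 4 : ℝ)⁻¹ * (6 / 10) ^ 4 := by
    rw [← tsum_geometric_of_lt_one (by norm_num) (by norm_num), ← tsum_mul_right]
    refine (summable_quartic x).tsum_le_tsum (fun m => ?_)
      ((summable_geometric_of_lt_one (by norm_num) (by norm_num)).mul_right _)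
    gcongr ?_ * ?_
    rw [← (show Even 4 by decide).pow_abs]
    have := abs_probe_le m x
    gcongr
    linarith
  rw [modulus, h1, zero_add]
  exact h2.trans (by norm_num)

lemma norm_le_two_of_modulus_le_one {x : C₀(ℕ, ℝ)} (hx : modulus x ≤ 1) : ‖x‖ ≤ 2 := by
  refine (BoundedContinuousFunction.norm_le (f := x.toBCF) zero_le_two).mpr fun n => ?_
  refine abs_le_two_of_flatBump_le_one (t := x n) (le_trans ?_ hx)
  have h1 : flatBump (x n) ≤ flatPart x :=
    (summable_flatBump x).le_tsum n fun k _ => flatBump_nonneg _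
  have h2 : 0 ≤ quarticPart x := tsum_nonneg fun m => by positivity
  exact h1.trans (le_add_of_nonneg_right h2)

lemma convexOn_modulus : ConvexOn ℝ Set.univ modulus := by
  refine ⟨convex_univ, fun x _ y _ a b ha hb hab => ?_⟩
  simp only [modulus, flatPart, quarticPart, smul_eq_mul, mul_add, ← tsum_mul_left]
  rw [add_add_add_comm,
    ← ((summable_flatBump x).mul_left a).tsum_add ((summable_flatBump y).mul_left b),
    ← ((summable_quartic x).mul_left a).tsum_add ((summable_quartic y).mul_left b)]
  refine add_le_add
    ((summable_flatBump _).tsum_le_tsum (fun n => ?_)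
      (((summable_flatBump x).mul_left a).add ((summable_flatBump y).mul_left b)))
    ((summable_quartic _).tsum_le_tsum (fun m => ?_)
      (((summable_quartic x).mul_left a).add ((summable_quartic y).mul_left b)))
  · exact convexOn_flatBump.2 (Set.mem_univ (x n)) (Set.mem_univ (y n)) ha hb hab
  · have h := (Even.convexOn_pow (𝕜 := ℝ) (n := 4) (by decide)).2 (Set.mem_univ (probe m x))
      (Set.mem_univ (probe m y)) ha hb hab
    simp only [smul_eq_mul] at h
    rw [map_add, map_smul, map_smul, smul_eq_mul, smul_eq_mul]
    calc _ ≤ (1 / 4 : ℝ) ^ m * (a * probe m x ^ 4 + b * probe m y ^ 4) := by gcongr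
      _ = _ := by ring

/-- The values of the derivative of the modulus on unit vectors along a row recover the value of
the corresponding functional. -/
lemma tendsto_modulusDeriv_unitVec (x : C₀(ℕ, ℝ)) (m : ℕ) :
    Tendsto (fun k => 2 ^ Nat.pair m k * modulusDeriv x (unitVec (Nat.pair m k))) atTop
      (𝓝 ((1 / 4 : ℝ) ^ m * 4 * probe m x ^ 3)) := by
  have hpair : Tendsto (fun k => Nat.pair m k) atTop atTop :=
    tendsto_atTop_mono (fun k => Nat.right_le_pair m k) tendsto_id
  have hhead : Tendsto (fun n => ∑' j, 2 ^ n * ((1 / 4 : ℝ) ^ j *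
      (4 * probe j x ^ 3 * head j (unitVec n)))) atTop (𝓝 0) := by
    rw [← tsum_zero (β := ℕ) (α := ℝ)]
    refine tendsto_tsum_of_dominated_convergence
      (summable_geometric_two.mul_right (4 * (6 * ‖x‖) ^ 3 * 4)) (fun j => ?_)
      (Eventually.of_forall fun n j => ?_)
    · refine tendsto_const_nhds.congr' ?_
      filter_upwards [eventually_gt_atTop j] with n hn
      simp [head_unitVec_eq_zero hn]
    · by_cases hjn : j < n
      · rw [head_unitVec_eq_zero hjn]
        simp only [mul_zero, norm_zero]
        positivity
      · have h1 : (2 : ℝ) ^ n * (1 / 4) ^ j ≤ (1 / 2) ^ j := by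
          calc (2 : ℝ) ^ n * (1 / 4) ^ j ≤ 2 ^ j * (1 / 4) ^ j := by
                gcongr
                · norm_num
                · exact not_lt.mp hjn
            _ = (1 / 2) ^ j := by rw [← mul_pow]; norm_num
        have h2 : |4 * probe j x ^ 3 * head j (unitVec n)| ≤ 4 * (6 * ‖x‖) ^ 3 * 4 := by
          rw [abs_mul, abs_mul, abs_pow, abs_of_pos (by norm_num : (0 : ℝ) < 4)]
          gcongr
          · exact abs_probe_le j x
          · exact (abs_head_le j _).trans (by linarith [norm_unitVec_le n])
        rw [← mul_assoc, norm_mul, Real.norm_of_nonneg (by positivity)]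
        exact mul_le_mul h1 h2 (abs_nonneg _) (by positivity)
  have hflat : ∀ᶠ n in atTop, ∑' i, flatBumpDeriv (x i) * unitVec n i = 0 := by
    have h := (finite_lt_abs_apply x one_pos).eventually_cofinite_notMem
    rw [Nat.cofinite_eq_atTop] at h
    filter_upwards [h] with n hn
    rw [tsum_eq_single n fun i hi => by simp [unitVec_apply, hi],
      flatBumpDeriv_eq_zero (not_lt.mp hn), zero_mul]
  have hmain := (hhead.comp hpair).add_const ((1 / 4 : ℝ) ^ m * 4 * probe m x ^ 3)
  rw [zero_add] at hmain
  refine hmain.congr' ?_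
  filter_upwards [hpair.eventually hflat] with k hk
  set n := Nat.pair m k with hn
  have hnm : (Nat.unpair n).1 = m := by simp [hn]
  have hsumhead : Summable fun j => (1 / 4 : ℝ) ^ j * (4 * probe j x ^ 3 * head j (unitVec n)) := by
    refine ((summable_geometric_mul fun j => abs_pow_mul_pow_le (abs_probe_le j x)
      (abs_head_le j (unitVec n)) 3 1).mul_left 4).congr fun j => ?_
    ring
  have htail : HasSum (fun j => (1 / 4 : ℝ) ^ j * (4 * probe j x ^ 3 * tail j (unitVec n)))
      ((1 / 4 : ℝ) ^ m * (4 * probe m x ^ 3 * (1 / 2) ^ n)) := by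
    convert hasSum_single m fun j hj => ?_ using 1
    · rw [tail_unitVec, if_pos hnm]
    · rw [tail_unitVec, if_neg (by rw [hnm]; exact hj.symm)]
      ring
  have hsplit : ∑' j, (1 / 4 : ℝ) ^ j * (4 * probe j x ^ 3 * probe j (unitVec n)) =
      ∑' j, (1 / 4 : ℝ) ^ j * (4 * probe j x ^ 3 * head j (unitVec n)) +
        (1 / 4 : ℝ) ^ m * (4 * probe m x ^ 3 * (1 / 2) ^ n) := by
    rw [← htail.tsum_eq, ← hsumhead.tsum_add htail.summable]
    exact tsum_congr fun j => by simp only [probe, LinearMap.add_apply]; ring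
  have h2 : (2 : ℝ) ^ n * (1 / 2) ^ n = 1 := by rw [← mul_pow]; norm_num
  rw [Function.comp_apply, modulusDeriv_apply, hk, hsplit, zero_add, mul_add, tsum_mul_left]
  linear_combination -((1 / 4 : ℝ) ^ m * 4 * probe m x ^ 3) * h2

/-- The unit ball of the new norm. -/
def modulusBall : Set C₀(ℕ, ℝ) := {x | modulus x ≤ 1}

lemma mem_modulusBall {x : C₀(ℕ, ℝ)} : x ∈ modulusBall ↔ modulus x ≤ 1 := Iff.rfl

lemma convex_modulusBall : Convex ℝ modulusBall := by
  simpa [modulusBall] using convexOn_modulus.convex_le 1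

lemma neg_mem_modulusBall {x : C₀(ℕ, ℝ)} (hx : x ∈ modulusBall) : -x ∈ modulusBall := by
  rwa [mem_modulusBall, modulus_neg]

lemma balanced_modulusBall : Balanced ℝ modulusBall := by
  rintro a ha _ ⟨x, hx, rfl⟩
  obtain ⟨h1, h2⟩ := abs_le.mp (Real.norm_eq_abs a ▸ ha)
  have h := convex_modulusBall hx (neg_mem_modulusBall hx) (a := (1 + a) / 2) (b := (1 - a) / 2)
    (by linarith) (by linarith) (by ring)
  convert h using 1
  module

lemma ball_subset_modulusBall : Metric.ball (0 : C₀(ℕ, ℝ)) (1 / 10) ⊆ modulusBall := fun _ hx =>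
  modulus_le_one_of_norm_le (mem_ball_zero_iff.mp hx).le

lemma modulusBall_subset_closedBall : modulusBall ⊆ Metric.closedBall (0 : C₀(ℕ, ℝ)) 2 :=
  fun _ hx => mem_closedBall_zero_iff.mpr (norm_le_two_of_modulus_le_one hx)

lemma modulusBall_mem_nhds : modulusBall ∈ 𝓝 (0 : C₀(ℕ, ℝ)) :=
  mem_of_superset (Metric.ball_mem_nhds 0 (show (0 : ℝ) < 1 / 10 by norm_num))
    ball_subset_modulusBall

lemma absorbent_modulusBall : Absorbent ℝ modulusBall := by
  have := absorbent_nhds_zero (𝕜 := ℝ) modulusBall_mem_nhds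
  exact this

lemma zero_mem_modulusBall : (0 : C₀(ℕ, ℝ)) ∈ modulusBall :=
  ball_subset_modulusBall (Metric.mem_ball_self (by norm_num))

lemma gauge_modulusBall_le (x : C₀(ℕ, ℝ)) : gauge modulusBall x ≤ 10 * ‖x‖ := by
  have := mul_gauge_le_norm (x := x) ball_subset_modulusBall
  linarith

lemma norm_le_gauge_modulusBall (x : C₀(ℕ, ℝ)) : ‖x‖ ≤ 2 * gauge modulusBall x := by
  have := le_gauge_of_subset_closedBall (x := x) absorbent_modulusBall zero_le_two
    modulusBall_subset_closedBall
  linarith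

lemma gauge_modulusBall_smul (c : ℝ) (x : C₀(ℕ, ℝ)) :
    gauge modulusBall (c • x) = ‖c‖ * gauge modulusBall x :=
  gauge_smul balanced_modulusBall c x

lemma modulus_le_one_of_gauge_eq_one {x : C₀(ℕ, ℝ)} (hx : gauge modulusBall x = 1) :
    modulus x ≤ 1 := by
  have hcont : Tendsto (fun t : ℝ => modulus (x + t • x)) (𝓝[<] 0) (𝓝 (modulus x)) := by
    have := (hasDerivAt_modulus_line x x).continuousAt.tendsto
    simp only [zero_smul, add_zero] at this
    exact this.mono_left nhdsWithin_le_nhds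
  refine le_of_tendsto hcont ?_
  filter_upwards [Ioo_mem_nhdsLT (show (-1 : ℝ) < 0 by norm_num)] with t ht
  refine setOfPred_gauge_lt_one_subset_self convex_modulusBall zero_mem_modulusBall
    absorbent_modulusBall (show gauge modulusBall (x + t • x) < 1 from ?_)
  rw [show x + t • x = (1 + t) • x by module,
    gauge_modulusBall_smul, hx, Real.norm_of_nonneg (by linarith [ht.1])]
  linarith [ht.2]

/-- A functional attaining its maximum over the ball at a boundary point is a multiple of the
derivative of the modulus there. -/
lemma exists_eq_smul_modulusDeriv {f : C₀(ℕ, ℝ) →ₗ[ℝ] ℝ} {x : C₀(ℕ, ℝ)}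
    (hx : gauge modulusBall x = 1) (hf : ∀ y ∈ modulusBall, f y ≤ f x) :
    ∃ c : ℝ, f = c • modulusDeriv x := by
  have hx0 : x ≠ 0 := by
    rintro rfl
    simp at hx
  have hneg (v : C₀(ℕ, ℝ)) (hv : modulusDeriv x v < 0) : f v ≤ 0 := by
    have h := (hasDerivAt_iff_tendsto_slope.mp (hasDerivAt_modulus_line x v)).mono_left
      (nhdsWithin_mono (0 : ℝ) fun t (ht : t ∈ Set.Ioi 0) => (Set.mem_Ioi.mp ht).ne')
    obtain ⟨t, ht, ht0⟩ := ((h.eventually_lt_const hv).and self_mem_nhdsWithin).exists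
    have ht0 : 0 < t := ht0
    simp only [slope_def_field, zero_smul, add_zero, sub_zero] at ht
    rw [div_neg_iff] at ht
    have hmem : x + t • v ∈ modulusBall := by
      have := modulus_le_one_of_gauge_eq_one hx
      rw [mem_modulusBall]
      rcases ht with ht | ht <;> linarith
    have := hf _ hmem
    rw [map_add, map_smul, smul_eq_mul] at this
    nlinarith
  have hD := modulusDeriv_self_pos hx0
  have hker (v : C₀(ℕ, ℝ)) (hv : modulusDeriv x v = 0) : f v ≤ 0 := by
    have hlim : Tendsto (fun t : ℝ => f v - t * f x) (𝓝[>] 0) (𝓝 (f v)) := by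
      have : Continuous fun t : ℝ => f v - t * f x := by fun_prop
      simpa using (this.tendsto 0).mono_left nhdsWithin_le_nhds
    refine le_of_tendsto hlim ?_
    filter_upwards [self_mem_nhdsWithin] with t ht
    have := hneg (v - t • x) (by
      rw [map_sub, map_smul, hv, smul_eq_mul]
      have := mul_pos ht hD
      linarith)
    simpa using this
  refine ⟨f x / modulusDeriv x x, LinearMap.ext fun v => ?_⟩
  set w := v - (modulusDeriv x v / modulusDeriv x x) • x with hw
  have hw0 : modulusDeriv x w = 0 := by
    rw [hw, map_sub, map_smul, smul_eq_mul, div_mul_cancel₀ _ hD.ne', sub_self]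
  have h1 := hker w hw0
  have h2 := hker (-w) (by rw [map_neg, hw0, neg_zero])
  rw [map_neg] at h2
  have h3 : f w = 0 := by linarith
  rw [hw, map_sub, map_smul, smul_eq_mul] at h3
  rw [LinearMap.smul_apply, smul_eq_mul]
  linear_combination h3

/-- The space `c₀` with the norm whose unit ball is `modulusBall`. -/
def RenormedC0 : Type := C₀(ℕ, ℝ)

namespace RenormedC0

instance : AddCommGroup RenormedC0 := inferInstanceAs (AddCommGroup C₀(ℕ, ℝ))

instance : Module ℝ RenormedC0 := inferInstanceAs (Module ℝ C₀(ℕ, ℝ))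

/-- The identity, as a linear equivalence with `c₀`. -/
def equiv : RenormedC0 ≃ₗ[ℝ] C₀(ℕ, ℝ) := LinearEquiv.refl ℝ C₀(ℕ, ℝ)

instance : Norm RenormedC0 := ⟨fun x => gauge modulusBall (equiv x)⟩

lemma norm_def (x : RenormedC0) : ‖x‖ = gauge modulusBall (equiv x) := rfl

lemma core : NormedSpace.Core ℝ RenormedC0 where
  norm_nonneg x := gauge_nonneg _
  norm_smul c x := gauge_modulusBall_smul c (equiv x)
  norm_triangle x y := by
    rw [norm_def, map_add]
    exact gauge_add_le convex_modulusBall absorbent_modulusBall _ _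
  norm_eq_zero_iff x := by
    refine ⟨fun h => ?_, fun h => by rw [norm_def, h, map_zero, gauge_zero]⟩
    have h2 := norm_le_gauge_modulusBall (equiv x)
    rw [← norm_def, h, mul_zero] at h2
    simpa using h2

instance : NormedAddCommGroup RenormedC0 := NormedAddCommGroup.ofCore core

instance : NormedSpace ℝ RenormedC0 := NormedSpace.ofCore core

/-- The identity is an isomorphism onto `c₀` with its usual norm. -/
def equivL : RenormedC0 ≃L[ℝ] C₀(ℕ, ℝ) :=
  equiv.toContinuousLinearEquivOfBounds 2 10 (fun x => norm_le_gauge_modulusBall (equiv x))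
    fun x => by simpa [norm_def] using gauge_modulusBall_le x

instance : CompleteSpace RenormedC0 :=
  (completeSpace_congr (e := equivL.toEquiv) equivL.isUniformEmbedding).mpr inferInstance

lemma not_finiteDimensional : ¬ FiniteDimensional ℝ RenormedC0 := fun _ => by
  have : FiniteDimensional ℝ C₀(ℕ, ℝ) := equiv.finiteDimensional
  let ev (n : ℕ) : Module.Dual ℝ C₀(ℕ, ℝ) :=
    { toFun := fun x => x n
      map_add' := fun _ _ => rfl
      map_smul' := fun _ _ => rfl }
  have h : LinearIndependent ℝ unitVec := LinearIndependent.of_pairwise_dual_eq_zero_one unitVec ev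
    (fun i j hij => by
      change unitVec j i = 0
      rw [unitVec_apply, if_neg hij])
    fun i => by
      change unitVec i i = 1
      rw [unitVec_apply, if_pos rfl]
  exact not_finite_iff_infinite.mpr inferInstance h.finite

lemma exists_eq_modulusDeriv_of_attains {f : RenormedC0 →L[ℝ] ℝ} {x : RenormedC0}
    (hx : ‖x‖ = 1) (hf : |f x| = ‖f‖) :
    ∃ (z : C₀(ℕ, ℝ)) (c : ℝ), gauge modulusBall z = 1 ∧
      ∀ v, f (equiv.symm v) = c * modulusDeriv z v := by
  wlog hpos : 0 ≤ f x generalizing x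
  · exact this (x := -x) (by rwa [norm_neg]) (by rwa [map_neg, abs_neg])
      (by rw [map_neg]; linarith)
  rw [abs_of_nonneg hpos] at hf
  obtain ⟨c, hc⟩ := exists_eq_smul_modulusDeriv (f := f.toLinearMap ∘ₗ equiv.symm.toLinearMap)
    (x := equiv x) hx fun y hy => by
      have hy1 : ‖equiv.symm y‖ ≤ 1 := by
        rw [norm_def, LinearEquiv.apply_symm_apply]
        exact gauge_le_one_of_mem hy
      have := (le_abs_self _).trans (f.le_of_opNorm_le_of_le le_rfl hy1)
      simpa [hf] using this
  exact ⟨equiv x, c, hx, fun v => LinearMap.congr_fun hc v⟩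

end RenormedC0

/-- Cubes of two non-proportional linear forms and of a third one are linearly independent as soon
as the first two are involved. -/
lemma false_of_cubes {a₁ b₁ a₂ b₂ a₃ b₃ c₁ c₂ c₃ : ℝ} (h₁ : c₁ ≠ 0) (h₂ : c₂ ≠ 0)
    (hd : a₁ * b₂ - a₂ * b₁ ≠ 0)
    (h : ∀ s : ℕ, s < 4 →
      c₁ * (a₁ + s * b₁) ^ 3 + c₂ * (a₂ + s * b₂) ^ 3 + c₃ * (a₃ + s * b₃) ^ 3 = 0) : False := by
  have e0 := h 0 (by norm_num)
  have e1 := h 1 (by norm_num)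
  have e2 := h 2 (by norm_num)
  have e3 := h 3 (by norm_num)
  push_cast at e0 e1 e2 e3
  have k0 : c₁ * a₁ ^ 3 + c₂ * a₂ ^ 3 + c₃ * a₃ ^ 3 = 0 := by linear_combination e0
  have k3 : c₁ * b₁ ^ 3 + c₂ * b₂ ^ 3 + c₃ * b₃ ^ 3 = 0 := by
    linear_combination (e3 - 3 * e2 + 3 * e1 - e0) / 6
  have k2 : c₁ * a₁ * b₁ ^ 2 + c₂ * a₂ * b₂ ^ 2 + c₃ * a₃ * b₃ ^ 2 = 0 := by
    linear_combination (e2 - 2 * e1 + e0) / 6 - k3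
  have k1 : c₁ * a₁ ^ 2 * b₁ + c₂ * a₂ ^ 2 * b₂ + c₃ * a₃ ^ 2 * b₃ = 0 := by
    linear_combination (e1 - e0) / 3 - k2 - k3 / 3
  have key (p q r s t u : ℝ) :
      c₁ * ((p * a₁ + q * b₁) * (r * a₁ + s * b₁) * (t * a₁ + u * b₁)) +
      c₂ * ((p * a₂ + q * b₂) * (r * a₂ + s * b₂) * (t * a₂ + u * b₂)) +
      c₃ * ((p * a₃ + q * b₃) * (r * a₃ + s * b₃) * (t * a₃ + u * b₃)) = 0 := by
    linear_combination p * r * t * k0 + (p * r * u + p * s * t + q * r * t) * k1 +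
      (p * s * u + q * r * u + q * s * t) * k2 + q * s * u * k3
  have h13 : a₁ * b₃ - a₃ * b₁ = 0 := by
    have hA := key b₂ (-a₂) b₃ (-a₃) b₃ (-a₃)
    have hA' : c₁ * (a₁ * b₂ - a₂ * b₁) * (a₁ * b₃ - a₃ * b₁) ^ 2 = 0 := by
      linear_combination hA
    simpa [h₁, hd] using hA'
  have h23 : a₂ * b₃ - a₃ * b₂ = 0 := by
    have hA := key b₁ (-a₁) b₃ (-a₃) b₃ (-a₃)
    have hA' : c₂ * (a₁ * b₂ - a₂ * b₁) * (a₂ * b₃ - a₃ * b₂) ^ 2 = 0 := by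
      linear_combination -hA
    simpa [h₂, hd] using hA'
  have ha3 : a₃ = 0 := (mul_eq_zero.mp (show (a₁ * b₂ - a₂ * b₁) * a₃ = 0 by
    linear_combination a₂ * h13 - a₁ * h23)).resolve_left hd
  have hb3 : b₃ = 0 := (mul_eq_zero.mp (show (a₁ * b₂ - a₂ * b₁) * b₃ = 0 by
    linear_combination b₂ * h13 - b₁ * h23)).resolve_left hd
  subst ha3 hb3
  have hA := key b₂ (-a₂) b₂ (-a₂) b₂ (-a₂)
  have hA' : c₁ * (a₁ * b₂ - a₂ * b₁) ^ 3 = 0 := by linear_combination hA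
  simp [h₁, hd] at hA'

/-- A linear relation between multiples of derivatives of the modulus forces a relation between
cubes of coordinates. -/
lemma cubes_of_modulusDeriv {x₁ x₂ x₃ : C₀(ℕ, ℝ)} {c₁ c₂ c₃ : ℝ}
    (h : ∀ v, c₁ * modulusDeriv x₁ v + c₂ * modulusDeriv x₂ v + c₃ * modulusDeriv x₃ v = 0)
    (p q : ℕ) {s : ℕ} (hs : s < 4) :
    c₁ * (x₁ p + s * x₁ q) ^ 3 + c₂ * (x₂ p + s * x₂ q) ^ 3 + c₃ * (x₃ p + s * x₃ q) ^ 3 = 0 := by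
  have hprobe (m : ℕ) : c₁ * probe m x₁ ^ 3 + c₂ * probe m x₂ ^ 3 + c₃ * probe m x₃ ^ 3 = 0 := by
    have hlim := (((tendsto_modulusDeriv_unitVec x₁ m).const_mul c₁).add
      ((tendsto_modulusDeriv_unitVec x₂ m).const_mul c₂)).add
      ((tendsto_modulusDeriv_unitVec x₃ m).const_mul c₃)
    have h0 := tendsto_nhds_unique hlim ((tendsto_const_nhds (x := (0 : ℝ))).congr fun k => by
      linear_combination -(2 : ℝ) ^ Nat.pair m k * h (unitVec (Nat.pair m k)))
    have hpos : (1 / 4 : ℝ) ^ m * 4 ≠ 0 := by positivity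
    refine (mul_eq_zero.mp ?_).resolve_left hpos
    linear_combination h0
  have hlim := (((((tendsto_probe p q hs x₁).pow 3).const_mul c₁).add
    (((tendsto_probe p q hs x₂).pow 3).const_mul c₂)).add
    (((tendsto_probe p q hs x₃).pow 3).const_mul c₃))
  exact tendsto_nhds_unique hlim (tendsto_const_nhds.congr fun l => (hprobe _).symm)

lemma eq_or_eq_neg_of_minors_eq_zero {x y : C₀(ℕ, ℝ)} (hx : gauge modulusBall x = 1)
    (hy : gauge modulusBall y = 1) (h : ∀ p q, x p * y q - y p * x q = 0) : y = x ∨ y = -x := by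
  have hx0 : x ≠ 0 := by
    rintro rfl
    simp at hx
  obtain ⟨p, hp⟩ : ∃ p, x p ≠ 0 := by
    by_contra! h0
    exact hx0 (ZeroAtInftyContinuousMap.ext h0)
  have hyx : y = (y p / x p) • x := ZeroAtInftyContinuousMap.ext fun q => by
    rw [ZeroAtInftyContinuousMap.smul_apply, smul_eq_mul]
    field_simp
    linear_combination h p q
  rw [hyx, gauge_modulusBall_smul, hx, mul_one, Real.norm_eq_abs] at hy
  rcases eq_or_eq_neg_of_abs_eq hy with h1 | h1
  · left; rw [hyx, h1, one_smul]
  · right; rw [hyx, h1]; exact neg_one_smul ℝ x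

/-- The norm-attaining functionals. -/
def normAttaining : Set (RenormedC0 →L[ℝ] ℝ) := {h | ∃ x : RenormedC0, ‖x‖ = 1 ∧ |h x| = ‖h‖}

open RenormedC0 in
lemma eq_zero_or_eq_zero_of_mem_normAttaining {f g : RenormedC0 →L[ℝ] ℝ} {a b : ℝ}
    (hf : f ∈ normAttaining) (hg : g ∈ normAttaining) (hf0 : f ≠ 0)
    (hgf : g ∉ Submodule.span ℝ {f}) (hab : a • f + b • g ∈ normAttaining) : a = 0 ∨ b = 0 := by
  by_contra! hne
  obtain ⟨x, hx, hfx⟩ := hf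
  obtain ⟨y, hy, hgy⟩ := hg
  obtain ⟨z, hz, hhz⟩ := hab
  obtain ⟨x, c₁, hx, hf⟩ := exists_eq_modulusDeriv_of_attains hx hfx
  obtain ⟨y, c₂, hy, hg⟩ := exists_eq_modulusDeriv_of_attains hy hgy
  obtain ⟨z, c₃, hz, hh⟩ := exists_eq_modulusDeriv_of_attains hz hhz
  have hc₁ : c₁ ≠ 0 := by
    rintro rfl
    exact hf0 (ContinuousLinearMap.ext fun v => by simpa using hf (equiv v))
  have hc₂ : c₂ ≠ 0 := by
    rintro rfl
    refine hgf ?_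
    rw [show g = 0 from ContinuousLinearMap.ext fun v => by simpa using hg (equiv v)]
    exact zero_mem _
  by_cases hminor : ∀ p q, x p * y q - y p * x q = 0
  · have hD : ∃ s : ℝ, modulusDeriv y = s • modulusDeriv x := by
      rcases eq_or_eq_neg_of_minors_eq_zero hx hy hminor with rfl | rfl
      · exact ⟨1, (one_smul _ _).symm⟩
      · exact ⟨-1, by rw [modulusDeriv_neg]; exact (neg_one_smul ℝ _).symm⟩
    obtain ⟨s, hs⟩ := hD
    refine hgf (Submodule.mem_span_singleton.mpr ⟨c₂ * s / c₁, ContinuousLinearMap.ext fun v => ?_⟩)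
    have h1 := hf (equiv v)
    have h2 := hg (equiv v)
    rw [LinearEquiv.symm_apply_apply] at h1 h2
    rw [smul_apply, h1, h2, hs, LinearMap.smul_apply, smul_eq_mul, smul_eq_mul]
    field_simp
  · push Not at hminor
    obtain ⟨p, q, hpq⟩ := hminor
    refine false_of_cubes (mul_ne_zero hne.1 hc₁) (mul_ne_zero hne.2 hc₂) hpq
      fun s hs => cubes_of_modulusDeriv (x₃ := z) (c₃ := -c₃) (fun v => ?_) p q hs
    have h3 := hh v
    rw [add_apply, smul_apply,
      smul_apply, hf, hg, smul_eq_mul, smul_eq_mul] at h3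
    linear_combination h3

lemma exists_subset_union_span (Z : Submodule ℝ (RenormedC0 →L[ℝ] ℝ))
    (hZ : Module.finrank ℝ Z = 2) :
    ∃ f g : RenormedC0 →L[ℝ] ℝ, (Z : Set (RenormedC0 →L[ℝ] ℝ)) ∩ normAttaining ⊆
      (Submodule.span ℝ {f} : Submodule ℝ (RenormedC0 →L[ℝ] ℝ)) ∪
        (Submodule.span ℝ {g} : Submodule ℝ (RenormedC0 →L[ℝ] ℝ)) := by
  by_cases h1 : ∃ f ∈ (Z : Set (RenormedC0 →L[ℝ] ℝ)) ∩ normAttaining, f ≠ 0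
  swap
  · push Not at h1
    exact ⟨0, 0, fun f hf => Or.inl (by rw [h1 f hf]; exact zero_mem _)⟩
  obtain ⟨f, ⟨hfZ, hfN⟩, hf0⟩ := h1
  by_cases h2 : ∃ g ∈ (Z : Set (RenormedC0 →L[ℝ] ℝ)) ∩ normAttaining, g ∉ Submodule.span ℝ {f}
  swap
  · push Not at h2
    exact ⟨f, f, fun g hg => Or.inl (h2 g hg)⟩
  obtain ⟨g, ⟨hgZ, hgN⟩, hgf⟩ := h2
  have hli : LinearIndependent ℝ ![f, g] := by
    refine (LinearIndependent.pair_iff' hf0).mpr fun a ha => hgf ?_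
    exact Submodule.mem_span_singleton.mpr ⟨a, ha⟩
  have hspan : Submodule.span ℝ {f, g} = Z := by
    have : FiniteDimensional ℝ Z := .of_finrank_pos (by omega)
    refine Submodule.eq_of_le_of_finrank_eq (Submodule.span_le.mpr ?_) ?_
    · rintro _ (rfl | rfl) <;> assumption
    · rw [hZ, ← Matrix.range_cons_cons_empty f g ![]]
      simpa using finrank_span_eq_card hli
  refine ⟨f, g, ?_⟩
  rintro h ⟨hhZ, hhN⟩
  rw [SetLike.mem_coe, ← hspan] at hhZ
  obtain ⟨a, b, rfl⟩ := Submodule.mem_span_pair.mp hhZ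
  rcases eq_zero_or_eq_zero_of_mem_normAttaining hfN hgN hf0 hgf hhN with rfl | rfl
  · right
    exact Submodule.mem_span_singleton.mpr ⟨b, by simp⟩
  · left
    exact Submodule.mem_span_singleton.mpr ⟨a, by simp⟩

end AlgebraicallyTrivialNA

end

/-- There exists an infinite-dimensional real Banach space `X` such that for every
two-dimensional subspace `Z` of the dual `X*`, the intersection of `Z` with the set
`NA(X, ℝ)` of norm-attaining functionals is contained in the union of two
one-dimensional subspaces, i.e. spans of two single functionals. -/
theorem statement0 :
    ∃ (X : Type) (_ : NormedAddCommGroup X) (_ : NormedSpace ℝ X) (_ : CompleteSpace X),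
      ¬ FiniteDimensional ℝ X ∧
      ∀ Z : Submodule ℝ (X →L[ℝ] ℝ), Module.finrank ℝ Z = 2 →
        ∃ f g : X →L[ℝ] ℝ,
          (Z : Set (X →L[ℝ] ℝ)) ∩ {h : X →L[ℝ] ℝ | ∃ x : X, ‖x‖ = 1 ∧ |h x| = ‖h‖} ⊆
            (Submodule.span ℝ {f} : Submodule ℝ (X →L[ℝ] ℝ)) ∪
              (Submodule.span ℝ {g} : Submodule ℝ (X →L[ℝ] ℝ)) := by
  exact ⟨AlgebraicallyTrivialNA.RenormedC0, inferInstance, inferInstance, inferInstance,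
    AlgebraicallyTrivialNA.RenormedC0.not_finiteDimensional,
    AlgebraicallyTrivialNA.exists_subset_union_span⟩
end

section
/- There exists an infinite-dimensional real Banach space X such that whenever f, g ∈ NA(X,ℝ) are linearly independent and 0 < t < 1, the functional t·f + (1−t)·g is not norm-attaining. -/
open Filter Topology Set

/-- `D x` is at every `x` both a subgradient of `Φ` and a one-sided quadratic upper model of `Φ`
along every ray. -/
structure IsSmoothConvex {E : Type*} [AddCommGroup E] [Module ℝ E] (Φ : E → ℝ)
    (D : E → E →ₗ[ℝ] ℝ) : Prop where
  subgradient : ∀ x y, Φ x + D x (y - x) ≤ Φ y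
  upper : ∀ x v, ∃ K : ℝ, ∀ t : ℝ, 0 ≤ t → t ≤ 1 → Φ (x + t • v) ≤ Φ x + t * D x v + t ^ 2 * K

namespace IsSmoothConvex

section
variable {E : Type*} [AddCommGroup E] [Module ℝ E] {Φ Ψ : E → ℝ} {D D' : E → E →ₗ[ℝ] ℝ}

theorem add (h : IsSmoothConvex Φ D) (h' : IsSmoothConvex Ψ D') :
    IsSmoothConvex (fun x => Φ x + Ψ x) (fun x => D x + D' x) where
  subgradient x y := by
    have h1 := h.subgradient x y
    have h2 := h'.subgradient x y
    simp only [LinearMap.add_apply]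
    linarith
  upper x v := by
    obtain ⟨K, hK⟩ := h.upper x v
    obtain ⟨K', hK'⟩ := h'.upper x v
    refine ⟨K + K', fun t h0 h1 => ?_⟩
    have h1 := hK t h0 h1
    have h2 := hK' t h0 ‹_›
    simp only [LinearMap.add_apply]
    linarith

theorem convexOn (h : IsSmoothConvex Φ D) : ConvexOn ℝ univ Φ := by
  refine ⟨convex_univ, fun x _ y _ a b ha hb hab => ?_⟩
  set z := a • x + b • y with hz
  have h1 := mul_le_mul_of_nonneg_left (h.subgradient z x) ha
  have h2 := mul_le_mul_of_nonneg_left (h.subgradient z y) hb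
  have h3 : a * D z (x - z) + b * D z (y - z) = 0 := by
    have : a • (x - z) + b • (y - z) = 0 := by
      have : a • (x - z) + b • (y - z) = (a • x + b • y) - (a + b) • z := by module
      rw [this, hab, one_smul, ← hz, sub_self]
    simpa using congrArg (D z) this
  have h4 : (a + b) * Φ z = Φ z := by rw [hab, one_mul]
  simp only [smul_eq_mul]
  linarith

theorem exists_le_of_neg (h : IsSmoothConvex Φ D) {x v : E} (hv : D x v < 0) :
    ∃ t : ℝ, 0 < t ∧ Φ (x + t • v) ≤ Φ x := by
  obtain ⟨K, hK⟩ := h.upper x v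
  have hpos : 0 < |K| + 1 := by positivity
  set t := min 1 (-(D x v) / (|K| + 1)) with ht
  have ht0 : 0 < t := lt_min one_pos (div_pos (by linarith) hpos)
  refine ⟨t, ht0, (hK t ht0.le (min_le_left _ _)).trans ?_⟩
  have h1 : t * (|K| + 1) ≤ -(D x v) := by
    rw [← le_div_iff₀ hpos]; exact min_le_right _ _
  have h2 : t * K ≤ t * (|K| + 1) := by
    apply mul_le_mul_of_nonneg_left _ ht0.le
    linarith [le_abs_self K]
  nlinarith

theorem tsum {ι : Type*} (L : ι → E →ₗ[ℝ] ℝ) (q q' : ι → ℝ → ℝ)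
    (hD : ∀ x v, D x v = ∑' i, q' i (L i x) * L i v)
    (hq : ∀ i a b, q i a + q' i a * (b - a) ≤ q i b)
    (hs : ∀ x, Summable fun i => q i (L i x))
    (hs' : ∀ x v, Summable fun i => q' i (L i x) * L i v)
    (hQ : ∀ x v, ∃ Q : ι → ℝ, Summable Q ∧ ∀ i t, 0 ≤ t → t ≤ 1 →
      q i (L i x + t * L i v) ≤ q i (L i x) + t * (q' i (L i x) * L i v) + t ^ 2 * Q i) :
    IsSmoothConvex (fun x => ∑' i, q i (L i x)) D where
  subgradient x y := by
    rw [hD, ← (hs x).tsum_add (hs' x _)]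
    refine Summable.tsum_le_tsum (fun i => ?_) ((hs x).add (hs' x _)) (hs y)
    rw [map_sub]
    exact hq i _ _
  upper x v := by
    obtain ⟨Q, hQs, hQ⟩ := hQ x v
    refine ⟨∑' i, Q i, fun t h0 h1 => ?_⟩
    have hst := (hs' x v).mul_left t
    have hsQ := hQs.mul_left (t ^ 2)
    rw [hD, ← tsum_mul_left, ← tsum_mul_left, ← (hs x).tsum_add hst,
      ← ((hs x).add hst).tsum_add hsQ]
    refine Summable.tsum_le_tsum (fun i => ?_) (hs _) (((hs x).add hst).add hsQ)
    rw [map_add, map_smul, smul_eq_mul]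
    exact hQ i t h0 h1

end

/-- A functional attaining its norm at `x` is a positive multiple of the gradient at `x`. -/
theorem exists_eq_mul {E X : Type*} [AddCommGroup E] [Module ℝ E] {Φ : E → ℝ}
    {D : E → E →ₗ[ℝ] ℝ} (h : IsSmoothConvex Φ D) (h0 : Φ 0 < 1)
    [NormedAddCommGroup X] [NormedSpace ℝ X] (e : X ≃ₗ[ℝ] E)
    (he : ∀ x, Φ (e x) ≤ 1 → ‖x‖ ≤ 1) {x : X} (hx : Φ (e x) = 1) {f : X →L[ℝ] ℝ} (hf : f ≠ 0)
    (hfx : f x = ‖f‖) : ∃ c : ℝ, 0 < c ∧ ∀ v, f v = c * D (e x) (e v) := by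
  have hfpos : 0 < f x := hfx ▸ norm_pos_iff.2 hf
  have hneg : ∀ v, D (e x) (e v) < 0 → f v ≤ 0 := by
    intro v hv
    obtain ⟨t, ht, hle⟩ := h.exists_le_of_neg hv
    have h1 : ‖x + t • v‖ ≤ 1 := he _ (by rw [map_add, map_smul]; exact hle.trans hx.le)
    have h2 : f (x + t • v) ≤ ‖f‖ := (le_abs_self _).trans (f.unit_le_opNorm _ h1)
    rw [map_add, map_smul, smul_eq_mul, hfx] at h2
    by_contra hc
    push Not at hc
    nlinarith
  have hDx : 0 < D (e x) (e x) := by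
    have := h.subgradient (e x) 0
    rw [zero_sub, map_neg] at this
    linarith
  have hzero : ∀ v, D (e x) (e v) = 0 → f v ≤ 0 := by
    intro v hv
    refine le_of_forall_pos_le_add fun ε hε => ?_
    have h1 := hneg (v - (ε / f x) • x) (by
      rw [map_sub, map_sub, hv, map_smul, map_smul, smul_eq_mul]
      have : 0 < ε / f x * D (e x) (e x) := by positivity
      linarith)
    rw [map_sub, map_smul, smul_eq_mul, div_mul_cancel₀ _ hfpos.ne'] at h1
    linarith
  refine ⟨f x / D (e x) (e x), by positivity, fun v => ?_⟩
  set w := v - (D (e x) (e v) / D (e x) (e x)) • x with hw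
  have hDw : D (e x) (e w) = 0 := by
    rw [hw, map_sub, map_sub, map_smul, map_smul, smul_eq_mul, div_mul_cancel₀ _ hDx.ne', sub_self]
  have h1 := hzero w hDw
  have h2 := hzero (-w) (by rw [map_neg, map_neg, hDw, neg_zero])
  rw [map_neg] at h2
  have h3 : f w = 0 := by linarith
  rw [hw, map_sub, map_smul, smul_eq_mul, sub_eq_zero] at h3
  rw [h3]
  ring

end IsSmoothConvex

/-- A norm equivalent to a complete norm is complete. -/
theorem exists_complete_normedSpace {X E : Type} [AddCommGroup X] [iM : Module ℝ X]
    [NormedAddCommGroup E] [NormedSpace ℝ E] [CompleteSpace E] (e : X ≃ₗ[ℝ] E) (N : AddGroupNorm X)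
    (hN : ∀ (a : ℝ) x, N (a • x) ≤ |a| * N x) {C C' : ℝ} (hC : ∀ x, ‖e x‖ ≤ C * N x)
    (hC' : ∀ x, N x ≤ C' * ‖e x‖) :
    ∃ (Y : Type) (_ : NormedAddCommGroup Y) (_ : NormedSpace ℝ Y) (_ : CompleteSpace Y)
      (e' : Y ≃ₗ[ℝ] E), ∀ y, ‖y‖ = N (e.symm (e' y)) := by
  let iG : NormedAddCommGroup X := N.toNormedAddCommGroup
  let iN : NormedSpace ℝ X := { iM with norm_smul_le := fun a x => hN a x }
  let e' : X ≃L[ℝ] E := e.toContinuousLinearEquivOfBounds C C' hC fun x => by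
    have := hC' (e.symm x)
    rwa [e.apply_symm_apply] at this
  have hcs : CompleteSpace X := (completeSpace_congr (e := e'.toEquiv) e'.isUniformEmbedding).2 ‹_›
  exact ⟨X, iG, iN, hcs, e, fun y => by rw [e.symm_apply_apply]; rfl⟩

/-- The sublevel set `{Φ ≤ 1}` of a continuous even convex function is, if bounded, the unit ball
of an equivalent norm. -/
theorem exists_complete_renorming {E : Type} [NormedAddCommGroup E] [NormedSpace ℝ E]
    [CompleteSpace E] {Φ : E → ℝ} (hconv : ConvexOn ℝ univ Φ) (hcont : Continuous Φ)
    (heven : ∀ x, Φ (-x) = Φ x) (h0 : Φ 0 < 1) {R : ℝ} (hR : 0 < R)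
    (hb : ∀ x, Φ x ≤ 1 → ‖x‖ ≤ R) :
    ∃ (X : Type) (_ : NormedAddCommGroup X) (_ : NormedSpace ℝ X) (_ : CompleteSpace X)
      (e : X ≃ₗ[ℝ] E), (∀ x, Φ (e x) ≤ 1 → ‖x‖ ≤ 1) ∧ ∀ x, ‖x‖ = 1 → Φ (e x) = 1 := by
  set s : Set E := {x | Φ x ≤ 1} with hs
  have hsc : Convex ℝ s := by simpa [hs] using hconv.convex_le 1
  have hsn : s ∈ 𝓝 (0 : E) :=
    mem_of_superset ((isOpen_lt hcont continuous_const).mem_nhds h0) fun x hx =>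
      (show Φ x < 1 from hx).le
  have hsa : Absorbent ℝ s := absorbent_nhds_zero hsn
  have hsneg : ∀ x ∈ s, -x ∈ s := fun x hx => by simpa [hs, heven] using hx
  have hscl : IsClosed s := isClosed_le hcont continuous_const
  obtain ⟨r, hr, hrs⟩ := Metric.mem_nhds_iff.1 hsn
  have hlow : ∀ x, ‖x‖ / R ≤ gauge s x := fun x =>
    le_gauge_of_subset_closedBall hsa hR.le fun y hy => by simpa using hb y hy
  have hup : ∀ x, r * gauge s x ≤ ‖x‖ := fun x => mul_gauge_le_norm hrs
  let N : AddGroupNorm E :=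
    { toFun := gauge s
      map_zero' := gauge_zero
      add_le' := gauge_add_le hsc hsa
      neg' := gauge_neg hsneg
      eq_zero_of_map_eq_zero' := fun x hx => by
        have h1 := hlow x
        have h2 : gauge s x = 0 := hx
        rw [h2, div_le_iff₀ hR, zero_mul] at h1
        exact norm_le_zero_iff.1 h1 }
  have hN : ∀ (a : ℝ) x, N (a • x) ≤ |a| * N x := fun a x => by
    change gauge s (a • x) ≤ |a| * gauge s x
    refine le_of_eq ?_
    rcases le_total 0 a with ha | ha
    · rw [abs_of_nonneg ha, gauge_smul_of_nonneg ha, smul_eq_mul]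
    · rw [abs_of_nonpos ha, ← gauge_neg hsneg, ← neg_smul,
        gauge_smul_of_nonneg (neg_nonneg.2 ha), smul_eq_mul]
  obtain ⟨X, iG, iN, hcs, e, he⟩ := exists_complete_normedSpace (LinearEquiv.refl ℝ E) N hN
    (C := R) (C' := r⁻¹)
    (fun x => by
      have := hlow x
      rw [div_le_iff₀ hR, mul_comm] at this
      exact this)
    (fun x => by
      have := hup x
      rw [inv_mul_eq_div, le_div_iff₀ hr, mul_comm]
      exact this)
  refine ⟨X, iG, iN, hcs, e, fun x hx => ?_, fun x hx => ?_⟩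
  · rw [he]
    exact gauge_le_one_of_mem hx
  · rw [he] at hx
    have h1 := (gauge_eq_one_iff_mem_frontier hsc hsn).1 hx
    exact frontier_le_subset_eq hcont continuous_const h1

open scoped ZeroAtInfty

noncomputable section

/-- The linear functional `v ↦ ∑ cᵢ Lᵢ(v)`. -/
def tsumFunctional {E ι : Type*} [AddCommGroup E] [Module ℝ E] (L : ι → E →ₗ[ℝ] ℝ) (c : ι → ℝ)
    (h : ∀ v, Summable fun i => c i * L i v) : E →ₗ[ℝ] ℝ where
  toFun v := ∑' i, c i * L i v
  map_add' v w := by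
    rw [← (h v).tsum_add (h w)]
    simp only [map_add, mul_add]
  map_smul' a v := by
    simp only [map_smul, smul_eq_mul, RingHom.id_apply]
    rw [← tsum_mul_left]
    exact tsum_congr fun i => by ring

/-- The difference between `a` and its nearest point in `[-1, 1]`. -/
def excess (a : ℝ) : ℝ := a - max (-1) (min a 1)

theorem excess_cases (a : ℝ) : (a ≤ -1 ∧ excess a = a + 1) ∨ (-1 ≤ a ∧ a ≤ 1 ∧ excess a = 0) ∨
    (1 ≤ a ∧ excess a = a - 1) := by
  unfold excess
  rcases le_total a (-1) with h | h
  · exact Or.inl ⟨h, by rw [min_eq_left (by linarith), max_eq_left h]; ring⟩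
  · rcases le_total a 1 with h' | h'
    · exact Or.inr (Or.inl ⟨h, h', by rw [min_eq_left h', max_eq_right h]; ring⟩)
    · exact Or.inr (Or.inr ⟨h', by rw [min_eq_right h', max_eq_right (by norm_num)]⟩)

theorem excess_eq_zero {a : ℝ} (h : |a| ≤ 1) : excess a = 0 := by
  have := abs_le.1 h
  rcases excess_cases a with h | h | h <;> linarith [h.2]

theorem excess_neg (a : ℝ) : excess (-a) = -excess a := by
  rcases excess_cases a with h | h | h <;> rcases excess_cases (-a) with h' | h' | h' <;>
    linarith [h.2, h'.2]

theorem excess_sq_subgradient (a b : ℝ) :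
    excess a ^ 2 + 2 * excess a * (b - a) ≤ excess b ^ 2 := by
  rcases excess_cases a with ⟨h1, h⟩ | ⟨h1, h2, h⟩ | ⟨h1, h⟩ <;>
    rcases excess_cases b with ⟨h3, h'⟩ | ⟨h3, h4, h'⟩ | ⟨h3, h'⟩ <;>
    rw [h, h'] <;> nlinarith [sq_nonneg (a - b)]

theorem excess_sq_upper (a h : ℝ) :
    excess (a + h) ^ 2 ≤ excess a ^ 2 + 2 * excess a * h + h ^ 2 := by
  rcases excess_cases a with ⟨h1, e⟩ | ⟨h1, h2, e⟩ | ⟨h1, e⟩ <;>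
    rcases excess_cases (a + h) with ⟨h3, e'⟩ | ⟨h3, h4, e'⟩ | ⟨h3, e'⟩ <;>
    rw [e, e'] <;> nlinarith [sq_nonneg (a + h)]

/-- A weighted square for even `n`, a weighted fourth power for odd `n`. -/
def wpow (n : ℕ) (z : ℝ) : ℝ := (1 / 2) ^ n * if Even n then z ^ 2 else z ^ 4

/-- The derivative of `wpow n`. -/
def wpowDeriv (n : ℕ) (z : ℝ) : ℝ := (1 / 2) ^ n * if Even n then 2 * z else 4 * z ^ 3

theorem wpow_nonneg (n : ℕ) (z : ℝ) : 0 ≤ wpow n z := by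
  unfold wpow
  split_ifs <;> positivity

theorem wpow_neg (n : ℕ) (z : ℝ) : wpow n (-z) = wpow n z := by
  unfold wpow
  split_ifs <;> ring

theorem wpowDeriv_neg (n : ℕ) (z : ℝ) : wpowDeriv n (-z) = -wpowDeriv n z := by
  unfold wpowDeriv
  split_ifs <;> ring

theorem abs_wpow_le {M z : ℝ} (n : ℕ) (h : |z| ≤ M) :
    |wpow n z| ≤ (1 / 2) ^ n * (M ^ 2 + M ^ 4) := by
  have h0 : 0 ≤ M := (abs_nonneg z).trans h
  unfold wpow
  rw [abs_mul, abs_of_nonneg (show (0 : ℝ) ≤ (1 / 2) ^ n by positivity)]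
  refine mul_le_mul_of_nonneg_left ?_ (by positivity)
  have h2 : |z| ^ 2 ≤ M ^ 2 := by gcongr
  have h4 : |z| ^ 4 ≤ M ^ 4 := by gcongr
  split_ifs
  · rw [abs_pow]; nlinarith [pow_nonneg h0 4]
  · rw [abs_pow]; nlinarith [pow_nonneg h0 2]

theorem abs_wpowDeriv_le {M z : ℝ} (n : ℕ) (h : |z| ≤ M) :
    |wpowDeriv n z| ≤ (1 / 2) ^ n * (2 * M + 4 * M ^ 3) := by
  have h0 : 0 ≤ M := (abs_nonneg z).trans h
  unfold wpowDeriv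
  rw [abs_mul, abs_of_nonneg (show (0 : ℝ) ≤ (1 / 2) ^ n by positivity)]
  refine mul_le_mul_of_nonneg_left ?_ (by positivity)
  have h3 : |z| ^ 3 ≤ M ^ 3 := by gcongr
  split_ifs
  · rw [abs_mul, abs_two]; nlinarith [pow_nonneg h0 3]
  · rw [abs_mul, abs_pow, abs_of_pos (show (0 : ℝ) < 4 by norm_num)]; linarith

theorem wpow_subgradient (n : ℕ) (a b : ℝ) :
    wpow n a + wpowDeriv n a * (b - a) ≤ wpow n b := by
  unfold wpow wpowDeriv
  rw [mul_assoc, ← mul_add]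
  refine mul_le_mul_of_nonneg_left ?_ (by positivity)
  split_ifs
  · nlinarith [sq_nonneg (a - b)]
  · nlinarith [sq_nonneg (a ^ 2 - b ^ 2), mul_nonneg (sq_nonneg a) (sq_nonneg (a - b))]

theorem wpow_upper {M a h t : ℝ} (n : ℕ) (ha : |a| ≤ M) (hh : |h| ≤ M) (h0 : 0 ≤ t) (h1 : t ≤ 1) :
    wpow n (a + t * h) ≤ wpow n a + t * (wpowDeriv n a * h) +
      t ^ 2 * ((1 / 2) ^ n * (M ^ 2 + 11 * M ^ 4)) := by
  have hM : 0 ≤ M := (abs_nonneg a).trans ha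
  have ha2 : a ^ 2 ≤ M ^ 2 := sq_le_sq' (by linarith [(abs_le.1 ha).1]) (abs_le.1 ha).2
  have hh2 : h ^ 2 ≤ M ^ 2 := sq_le_sq' (by linarith [(abs_le.1 hh).1]) (abs_le.1 hh).2
  have hah : a ^ 2 * h ^ 2 ≤ M ^ 4 := by
    calc a ^ 2 * h ^ 2 ≤ M ^ 2 * M ^ 2 := by gcongr
      _ = M ^ 4 := by ring
  have hh4 : h ^ 4 ≤ M ^ 4 := by
    calc h ^ 4 = h ^ 2 * h ^ 2 := by ring
      _ ≤ M ^ 2 * M ^ 2 := by gcongr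
      _ = M ^ 4 := by ring
  have key : (if Even n then (a + t * h) ^ 2 else (a + t * h) ^ 4) ≤
      (if Even n then a ^ 2 else a ^ 4) + t * ((if Even n then 2 * a else 4 * a ^ 3) * h) +
        t ^ 2 * (M ^ 2 + 11 * M ^ 4) := by
    split_ifs
    · have : t ^ 2 * h ^ 2 ≤ t ^ 2 * (M ^ 2 + 11 * M ^ 4) := by
        refine mul_le_mul_of_nonneg_left ?_ (by positivity)
        nlinarith [pow_nonneg hM 4]
      linarith [show (a + t * h) ^ 2 = a ^ 2 + t * (2 * a * h) + t ^ 2 * h ^ 2 by ring]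
    · have h2 : 6 * (a ^ 2 * h ^ 2) + 4 * t * (a * h ^ 3) + t ^ 2 * h ^ 4 ≤
          M ^ 2 + 11 * M ^ 4 := by
        have e1 : t * (2 * (a * h ^ 3)) ≤ 1 * (a ^ 2 * h ^ 2 + h ^ 4) := by
          have : 2 * (a * h ^ 3) ≤ a ^ 2 * h ^ 2 + h ^ 4 := by
            nlinarith [sq_nonneg (a * h - h ^ 2)]
          have : 0 ≤ a ^ 2 * h ^ 2 + h ^ 4 := by positivity
          calc t * (2 * (a * h ^ 3)) ≤ t * (a ^ 2 * h ^ 2 + h ^ 4) := by gcongr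
            _ ≤ 1 * (a ^ 2 * h ^ 2 + h ^ 4) := by gcongr
        have e2 : t ^ 2 * h ^ 4 ≤ 1 * h ^ 4 := by
          gcongr
          exact pow_le_one₀ h0 h1
        nlinarith [pow_nonneg hM 2]
      have := mul_le_mul_of_nonneg_left h2 (sq_nonneg t)
      linarith [show (a + t * h) ^ 4 = a ^ 4 + t * (4 * a ^ 3 * h) +
        t ^ 2 * (6 * (a ^ 2 * h ^ 2) + 4 * t * (a * h ^ 3) + t ^ 2 * h ^ 4) by ring]
  have := mul_le_mul_of_nonneg_left key (show (0 : ℝ) ≤ (1 / 2) ^ n by positivity)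
  unfold wpow wpowDeriv
  linarith

namespace ZeroAtInftyContinuousMap

theorem abs_apply_le (x : C₀(ℕ, ℝ)) (n : ℕ) : |x n| ≤ ‖x‖ :=
  x.toBCF.norm_coe_le_norm n

/-- The `n`-th coordinate functional. -/
def coord (n : ℕ) : C₀(ℕ, ℝ) →ₗ[ℝ] ℝ where
  toFun x := x n
  map_add' _ _ := rfl
  map_smul' _ _ := rfl

theorem coord_apply (n : ℕ) (x : C₀(ℕ, ℝ)) : coord n x = x n := rfl

/-- The `j`-th unit vector of `c₀`. -/
def unitVec (j : ℕ) : C₀(ℕ, ℝ) where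
  toFun := Pi.single j 1
  continuous_toFun := continuous_of_discreteTopology
  zero_at_infty' := by
    rw [cocompact_eq_cofinite, Nat.cofinite_eq_atTop]
    refine tendsto_const_nhds.congr' ?_
    filter_upwards [eventually_gt_atTop j] with n hn
    rw [Pi.single_eq_of_ne hn.ne']

theorem unitVec_apply (j n : ℕ) : unitVec j n = (Pi.single j 1 : ℕ → ℝ) n := rfl

theorem eventually_abs_le_one (x : C₀(ℕ, ℝ)) : ∀ᶠ n in atTop, |x n| + |x n| ≤ 1 := by
  have h := x.zero_at_infty'
  rw [cocompact_eq_cofinite, Nat.cofinite_eq_atTop] at h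
  have h2 := (h.abs.add h.abs)
  simp only [abs_zero, add_zero] at h2
  exact (h2.eventually (gt_mem_nhds one_pos)).mono fun n hn => le_of_lt hn

theorem summable_mul_pow (x : C₀(ℕ, ℝ)) (n : ℕ) :
    Summable fun j => x j * ((1 / 2 : ℝ) ^ (n + 1)) ^ j := by
  refine Summable.of_norm_bounded (summable_geometric_two.mul_left ‖x‖) fun j => ?_
  rw [norm_mul, norm_pow, norm_pow, Real.norm_of_nonneg (by norm_num : (0 : ℝ) ≤ 1 / 2)]
  gcongr
  · exact abs_apply_le x j
  · exact pow_le_of_le_one (by norm_num) (by norm_num) (by simp)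

/-- Evaluation at `2⁻⁽ⁿ⁺¹⁾` of the power series with coefficient sequence `x`. -/
def seriesEval (n : ℕ) : C₀(ℕ, ℝ) →ₗ[ℝ] ℝ where
  toFun x := ∑' j, x j * ((1 / 2 : ℝ) ^ (n + 1)) ^ j
  map_add' x y := by
    rw [← (summable_mul_pow x n).tsum_add (summable_mul_pow y n)]
    simp only [add_apply, add_mul]
  map_smul' a x := by
    simp only [smul_apply, smul_eq_mul, RingHom.id_apply]
    rw [← tsum_mul_left]
    exact tsum_congr fun i => by ring

theorem seriesEval_apply (n : ℕ) (x : C₀(ℕ, ℝ)) :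
    seriesEval n x = ∑' j, x j * ((1 / 2 : ℝ) ^ (n + 1)) ^ j := rfl

theorem abs_seriesEval_le (n : ℕ) (x : C₀(ℕ, ℝ)) : |seriesEval n x| ≤ 2 * ‖x‖ := by
  rw [seriesEval_apply, ← Real.norm_eq_abs]
  refine tsum_of_norm_bounded (a := 2 * ‖x‖) (g := fun j => (1 / 2 : ℝ) ^ j * ‖x‖)
    (hasSum_geometric_two.mul_right _) fun j => ?_
  rw [norm_mul, norm_pow, norm_pow, Real.norm_of_nonneg (by norm_num : (0 : ℝ) ≤ 1 / 2), mul_comm]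
  gcongr
  · exact pow_le_of_le_one (by norm_num) (by norm_num) (by simp)
  · exact abs_apply_le x j

theorem seriesEval_unitVec (n j : ℕ) : seriesEval n (unitVec j) = ((1 / 2 : ℝ) ^ (n + 1)) ^ j := by
  rw [seriesEval_apply, tsum_eq_single j]
  · simp [unitVec_apply]
  · intro i hi
    simp [unitVec_apply, hi]

/-- A power series vanishing at infinitely many of the points `2⁻⁽ⁿ⁺¹⁾` vanishes. -/
theorem eq_zero_of_frequently_seriesEval {x : C₀(ℕ, ℝ)}
    (h : ∃ᶠ n in atTop, seriesEval n x = 0) : x = 0 := by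
  ext j
  induction j using Nat.strong_induction_on with
  | _ j ih =>
  have ih' : ∀ i < j, x i = 0 := ih
  set g : ℕ → ℕ → ℝ := fun n i => if i < j then 0 else x i * ((1 / 2 : ℝ) ^ (n + 1)) ^ (i - j)
    with hg
  have hfac : ∀ n, seriesEval n x = ((1 / 2 : ℝ) ^ (n + 1)) ^ j * ∑' i, g n i := by
    intro n
    rw [seriesEval_apply, ← tsum_mul_left]
    refine tsum_congr fun i => ?_
    simp only [hg]
    split_ifs with hi
    · rw [ih' i hi]; ring
    · obtain ⟨k, rfl⟩ := Nat.exists_eq_add_of_le (not_lt.1 hi)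
      rw [Nat.add_sub_cancel_left, pow_add]; ring
  have hpt : ∀ i, Tendsto (fun n => g n i) atTop (𝓝 (if i = j then x j else 0)) := by
    intro i
    simp only [hg]
    rcases lt_trichotomy i j with hi | hi | hi
    · simp [hi, hi.ne]
    · simp [hi]
    · simp only [hi.not_gt, hi.ne', if_false]
      have h0 : Tendsto (fun n : ℕ => (1 / 2 : ℝ) ^ (n + 1)) atTop (𝓝 0) :=
        (tendsto_pow_atTop_nhds_zero_of_lt_one (by norm_num) (by norm_num)).comp
          (tendsto_add_atTop_nat 1)
      have := (h0.pow (i - j)).const_mul (x i)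
      rwa [zero_pow (Nat.sub_ne_zero_of_lt hi), mul_zero] at this
  have hlim : Tendsto (fun n => ∑' i, g n i) atTop (𝓝 (∑' i, if i = j then x j else 0)) := by
    refine tendsto_tsum_of_dominated_convergence
      (bound := fun i => ‖x‖ * 2 ^ j * (1 / 2 : ℝ) ^ i)
      (summable_geometric_two.mul_left _) hpt (Eventually.of_forall fun n i => ?_)
    simp only [hg]
    split_ifs with hi
    · simp only [norm_zero]; positivity
    · rw [norm_mul, norm_pow, norm_pow, Real.norm_of_nonneg (by norm_num : (0 : ℝ) ≤ 1 / 2),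
        mul_assoc]
      gcongr
      · exact abs_apply_le x i
      · obtain ⟨k, rfl⟩ := Nat.exists_eq_add_of_le (not_lt.1 hi)
        have h2 : (2 : ℝ) ^ j * (1 / 2) ^ (j + k) = (1 / 2) ^ k := by
          rw [pow_add, ← mul_assoc, ← mul_pow]
          norm_num
        rw [Nat.add_sub_cancel_left, h2]
        refine pow_le_pow_left₀ (by positivity) ?_ k
        exact pow_le_of_le_one (by norm_num) (by norm_num) (by simp)
  rw [tsum_ite_eq] at hlim
  have hfz : ∃ᶠ n in atTop, (∑' i, g n i) ∈ ({0} : Set ℝ) := h.mono fun n hn => by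
    rw [hfac, mul_eq_zero] at hn
    exact hn.resolve_left (by positivity)
  simpa using isClosed_singleton.mem_of_frequently_of_tendsto hfz hlim

end ZeroAtInftyContinuousMap

/-- A summable sequence `d` for which all but finitely many of the moments
`∑ dₙ (2⁻⁽ⁿ⁺¹⁾)ʲ` vanish is zero. -/
theorem eq_zero_of_eventually_moments {d : ℕ → ℝ} (hd : Summable fun n => |d n|)
    (h : ∀ᶠ j in atTop, ∑' n, d n * ((1 / 2 : ℝ) ^ (n + 1)) ^ j = 0) (n : ℕ) : d n = 0 := by
  induction n using Nat.strong_induction_on with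
  | _ n ih =>
  set g : ℕ → ℕ → ℝ := fun j m => if m < n then 0 else d m * ((1 / 2 : ℝ) ^ (m - n)) ^ j with hg
  have hfac : ∀ j, ∑' m, d m * ((1 / 2 : ℝ) ^ (m + 1)) ^ j =
      ((1 / 2 : ℝ) ^ (n + 1)) ^ j * ∑' m, g j m := by
    intro j
    rw [← tsum_mul_left]
    refine tsum_congr fun m => ?_
    simp only [hg]
    split_ifs with hm
    · rw [ih m hm]; ring
    · obtain ⟨k, rfl⟩ := Nat.exists_eq_add_of_le (not_lt.1 hm)
      rw [Nat.add_sub_cancel_left, add_right_comm, pow_add (1 / 2 : ℝ) (n + 1), mul_pow]; ring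
  have hpt : ∀ m, Tendsto (fun j => g j m) atTop (𝓝 (if m = n then d n else 0)) := by
    intro m
    simp only [hg]
    rcases lt_trichotomy m n with hm | hm | hm
    · simp [hm, hm.ne]
    · simp [hm]
    · simp only [hm.not_gt, hm.ne', if_false]
      have h0 := tendsto_pow_atTop_nhds_zero_of_lt_one (r := (1 / 2 : ℝ) ^ (m - n))
        (by positivity) (pow_lt_one₀ (by norm_num) (by norm_num) (Nat.sub_ne_zero_of_lt hm))
      simpa only [mul_zero] using h0.const_mul (d m)
  have hlim : Tendsto (fun j => ∑' m, g j m) atTop (𝓝 (∑' m, if m = n then d n else 0)) := by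
    refine tendsto_tsum_of_dominated_convergence hd hpt (Eventually.of_forall fun j m => ?_)
    simp only [hg]
    split_ifs with hm
    · simp only [norm_zero]; positivity
    · rw [norm_mul, norm_pow, norm_pow, Real.norm_of_nonneg (by norm_num : (0 : ℝ) ≤ 1 / 2),
        Real.norm_eq_abs]
      refine mul_le_of_le_one_right (abs_nonneg _) ?_
      exact pow_le_one₀ (by positivity) (pow_le_one₀ (by norm_num) (by norm_num))
  rw [tsum_ite_eq] at hlim
  refine tendsto_nhds_unique hlim ((tendsto_const_nhds (x := (0 : ℝ))).congr' ?_)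
  filter_upwards [h] with j hj
  rw [hfac, mul_eq_zero] at hj
  exact (hj.resolve_left (by positivity)).symm

namespace ZeroAtInftyContinuousMap

theorem eventually_excess_eq_zero (x : C₀(ℕ, ℝ)) : ∀ᶠ n in atTop, excess (x n) = 0 :=
  (eventually_abs_le_one x).mono fun n hn => excess_eq_zero (by linarith [abs_nonneg (x n)])

theorem summable_of_eventually_eq_zero {c : ℕ → ℝ} (h : ∀ᶠ n in atTop, c n = 0) : Summable c :=
  summable_of_hasFiniteSupport (by rwa [← Nat.cofinite_eq_atTop] at h)

theorem summable_excess_sq (x : C₀(ℕ, ℝ)) : Summable fun n => excess (coord n x) ^ 2 :=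
  summable_of_eventually_eq_zero <| (eventually_excess_eq_zero x).mono fun n hn => by
    rw [coord_apply, hn, zero_pow two_ne_zero]

theorem summable_excess_mul (x v : C₀(ℕ, ℝ)) :
    Summable fun n => 2 * excess (coord n x) * coord n v :=
  summable_of_eventually_eq_zero <| (eventually_excess_eq_zero x).mono fun n hn => by
    rw [coord_apply, hn, mul_zero, zero_mul]

theorem summable_wpow (x : C₀(ℕ, ℝ)) : Summable fun n => wpow n (seriesEval n x) :=
  Summable.of_norm_bounded (summable_geometric_two.mul_right _) fun n =>
    abs_wpow_le n (abs_seriesEval_le n x)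

theorem summable_abs_wpowDeriv (x : C₀(ℕ, ℝ)) :
    Summable fun n => |wpowDeriv n (seriesEval n x)| :=
  Summable.of_norm_bounded (summable_geometric_two.mul_right _) fun n => by
    rw [norm_abs_eq_norm]
    exact abs_wpowDeriv_le n (abs_seriesEval_le n x)

theorem summable_wpowDeriv_mul (x v : C₀(ℕ, ℝ)) :
    Summable fun n => wpowDeriv n (seriesEval n x) * seriesEval n v :=
  Summable.of_norm_bounded ((summable_abs_wpowDeriv x).mul_right (2 * ‖v‖)) fun n => by
    rw [norm_mul, Real.norm_eq_abs, Real.norm_eq_abs]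
    exact mul_le_mul_of_nonneg_left (abs_seriesEval_le n v) (abs_nonneg _)

/-- The convex function on `c₀` whose sublevel set `{Φ ≤ 1}` is the new unit ball. -/
def energy (x : C₀(ℕ, ℝ)) : ℝ :=
  (∑' n, excess (coord n x) ^ 2) + ∑' n, wpow n (seriesEval n x)

/-- The gradient of `energy`. -/
def energyGrad (x : C₀(ℕ, ℝ)) : C₀(ℕ, ℝ) →ₗ[ℝ] ℝ :=
  tsumFunctional coord _ (summable_excess_mul x) +
    tsumFunctional seriesEval _ (summable_wpowDeriv_mul x)

theorem energyGrad_apply (x v : C₀(ℕ, ℝ)) :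
    energyGrad x v = (∑' n, 2 * excess (coord n x) * coord n v) +
      ∑' n, wpowDeriv n (seriesEval n x) * seriesEval n v := rfl

theorem isSmoothConvex_energy : IsSmoothConvex energy energyGrad := by
  refine IsSmoothConvex.add (D := fun x => tsumFunctional coord _ (summable_excess_mul x))
    (D' := fun x => tsumFunctional seriesEval _ (summable_wpowDeriv_mul x)) ?_ ?_
  · refine IsSmoothConvex.tsum coord (fun _ a => excess a ^ 2) (fun _ a => 2 * excess a)
      (fun _ _ => rfl) (fun _ => excess_sq_subgradient) summable_excess_sq summable_excess_mul ?_
    intro x v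
    refine ⟨fun n => if |x n| + |v n| ≤ 1 then 0 else v n ^ 2, ?_, fun n t h0 h1 => ?_⟩
    · refine summable_of_eventually_eq_zero ?_
      filter_upwards [eventually_abs_le_one x, eventually_abs_le_one v] with n hx hv
      rw [if_pos (by linarith)]
    · simp only [coord_apply]
      split_ifs with h
      · have h2 : |x n + t * v n| ≤ 1 := by
          refine (abs_add_le _ _).trans (le_trans ?_ h)
          rw [abs_mul, abs_of_nonneg h0]
          have := mul_le_of_le_one_left (abs_nonneg (v n)) h1
          linarith
        rw [excess_eq_zero h2, excess_eq_zero (by linarith [abs_nonneg (v n)])]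
        simp
      · linarith [excess_sq_upper (x n) (t * v n)]
  · refine IsSmoothConvex.tsum seriesEval wpow wpowDeriv
      (fun _ _ => rfl) wpow_subgradient summable_wpow summable_wpowDeriv_mul ?_
    intro x v
    set M := 2 * (‖x‖ + ‖v‖) with hM
    refine ⟨fun n => (1 / 2) ^ n * (M ^ 2 + 11 * M ^ 4), summable_geometric_two.mul_right _,
      fun n t h0 h1 => wpow_upper n ?_ ?_ h0 h1⟩
    · exact (abs_seriesEval_le n x).trans (by linarith [norm_nonneg v])
    · exact (abs_seriesEval_le n v).trans (by linarith [norm_nonneg x])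

theorem energy_zero : energy 0 = 0 := by
  simp [energy, excess_eq_zero, wpow]

theorem energy_neg (x : C₀(ℕ, ℝ)) : energy (-x) = energy x := by
  simp only [energy, map_neg, excess_neg, wpow_neg, neg_sq]

theorem energyGrad_neg (x v : C₀(ℕ, ℝ)) : energyGrad (-x) v = -energyGrad x v := by
  simp only [energyGrad_apply, map_neg, excess_neg, wpowDeriv_neg, neg_mul, mul_neg, tsum_neg]
  ring

theorem energy_le {x : C₀(ℕ, ℝ)} (hx : ‖x‖ ≤ 1) : energy x ≤ 40 := by
  have h1 : ∑' n, excess (coord n x) ^ 2 = 0 := by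
    refine (tsum_congr fun n => ?_).trans tsum_zero
    rw [coord_apply, excess_eq_zero ((abs_apply_le x n).trans hx), zero_pow two_ne_zero]
  have h2 : ∑' n, wpow n (seriesEval n x) ≤ 2 * (2 ^ 2 + 2 ^ 4) := by
    refine (Summable.tsum_le_tsum (fun n => ?_) (summable_wpow x)
      (summable_geometric_two.mul_right _)).trans_eq
        (by rw [tsum_mul_right, tsum_geometric_two])
    exact (le_abs_self _).trans (abs_wpow_le n ((abs_seriesEval_le n x).trans (by linarith)))
  unfold energy
  linarith

theorem continuous_energy : Continuous energy := by
  rw [← continuousOn_univ]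
  have h : ContinuousOn energy univ ↔ ∃ x ∈ univ, (𝓝 x).IsBoundedUnder (· ≤ ·) energy :=
    (isSmoothConvex_energy.convexOn.continuousOn_tfae isOpen_univ univ_nonempty).out 1 3
  refine h.2 ⟨0, mem_univ _, 40, ?_⟩
  rw [eventually_map]
  filter_upwards [Metric.closedBall_mem_nhds 0 one_pos] with x hx
  exact energy_le (by simpa using hx)

theorem norm_le_of_energy_le_one {x : C₀(ℕ, ℝ)} (hx : energy x ≤ 1) : ‖x‖ ≤ 2 := by
  rw [← norm_toBCF_eq_norm, BoundedContinuousFunction.norm_le two_pos.le]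
  intro n
  have h1 : excess (coord n x) ^ 2 ≤ ∑' n, excess (coord n x) ^ 2 :=
    (summable_excess_sq x).le_tsum n fun _ _ => sq_nonneg _
  have h2 : 0 ≤ ∑' n, wpow n (seriesEval n x) := tsum_nonneg fun n => wpow_nonneg n _
  have h3 : excess (x n) ^ 2 ≤ 1 := by
    have := hx
    unfold energy at this
    rw [coord_apply] at h1
    linarith
  have h4 := abs_le.1 ((sq_le_one_iff_abs_le_one _).1 h3)
  rw [Real.norm_eq_abs, abs_le]
  change -2 ≤ x n ∧ x n ≤ 2
  rcases excess_cases (x n) with h | h | h <;> constructor <;> linarith [h.1, h.2, h4.1, h4.2]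

theorem energyGrad_unitVec (x : C₀(ℕ, ℝ)) (j : ℕ) :
    energyGrad x (unitVec j) = 2 * excess (x j) +
      ∑' n, wpowDeriv n (seriesEval n x) * ((1 / 2 : ℝ) ^ (n + 1)) ^ j := by
  rw [energyGrad_apply, tsum_eq_single j]
  · simp [coord_apply, unitVec_apply, seriesEval_unitVec]
  · intro i hi
    simp [coord_apply, unitVec_apply, hi]

/-- A linear relation between gradients of `energy` forces the same relation coordinatewise. -/
theorem wpowDeriv_relation {x y z : C₀(ℕ, ℝ)} {A B C : ℝ}
    (h : ∀ v, C * energyGrad z v = A * energyGrad x v + B * energyGrad y v) (n : ℕ) :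
    C * wpowDeriv n (seriesEval n z) =
      A * wpowDeriv n (seriesEval n x) + B * wpowDeriv n (seriesEval n y) := by
  have hsum : ∀ (w : C₀(ℕ, ℝ)) j, Summable fun n =>
      wpowDeriv n (seriesEval n w) * ((1 / 2 : ℝ) ^ (n + 1)) ^ j := fun w j => by
    simpa only [seriesEval_unitVec] using summable_wpowDeriv_mul w (unitVec j)
  have key := eq_zero_of_eventually_moments
    (d := fun n => A * wpowDeriv n (seriesEval n x) + B * wpowDeriv n (seriesEval n y) -
      C * wpowDeriv n (seriesEval n z)) ?_ ?_ n
  · linarith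
  · exact ((((summable_abs_wpowDeriv x).of_abs.mul_left A).add
      ((summable_abs_wpowDeriv y).of_abs.mul_left B)).sub
      ((summable_abs_wpowDeriv z).of_abs.mul_left C)).abs
  · filter_upwards [eventually_excess_eq_zero x, eventually_excess_eq_zero y,
      eventually_excess_eq_zero z] with j hx hy hz
    have hj := h (unitVec j)
    rw [energyGrad_unitVec, energyGrad_unitVec, energyGrad_unitVec, hx, hy, hz, mul_zero, zero_add,
      zero_add, zero_add, ← tsum_mul_left, ← tsum_mul_left, ← tsum_mul_left,
      ← ((hsum x j).mul_left A).tsum_add ((hsum y j).mul_left B)] at hj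
    have := sub_eq_zero.2 hj.symm
    rw [← Summable.tsum_sub (((hsum x j).mul_left A).add ((hsum y j).mul_left B))
      ((hsum z j).mul_left C)] at this
    rw [← this]
    exact tsum_congr fun n => by ring

/-- If the gradient at `z` lies in the open cone generated by the gradients at `x` and `y`, then
`x` and `y` are parallel. -/
theorem exists_eq_smul_of_energyGrad {x y z : C₀(ℕ, ℝ)} (hy : y ≠ 0) {A B C : ℝ} (hA : 0 < A)
    (hB : 0 < B)
    (h : ∀ v, C * energyGrad z v = A * energyGrad x v + B * energyGrad y v) :
    ∃ r : ℝ, x = r • y := by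
  have hrel := wpowDeriv_relation h
  have hpos : ∀ n : ℕ, ((1 / 2 : ℝ) ^ n) ≠ 0 := fun n => by positivity
  have hlin : C • z - A • x - B • y = 0 := by
    refine eq_zero_of_frequently_seriesEval (Nat.frequently_even.mono fun n hn => ?_)
    have h1 := hrel n
    simp only [wpowDeriv, if_pos hn] at h1
    simp only [map_sub, map_smul, smul_eq_mul]
    refine mul_left_cancel₀ (hpos n) ?_
    linarith
  have hlin' : ∀ n, C * seriesEval n z = A * seriesEval n x + B * seriesEval n y := fun n => by
    have := congrArg (seriesEval n) hlin
    simp only [map_sub, map_smul, smul_eq_mul, map_zero] at this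
    linarith
  have hcub : ∀ n, Odd n → C ^ 2 * (A * seriesEval n x ^ 3 + B * seriesEval n y ^ 3) =
      (A * seriesEval n x + B * seriesEval n y) ^ 3 := fun n hn => by
    have h1 := hrel n
    simp only [wpowDeriv, if_neg (Nat.not_even_iff_odd.2 hn)] at h1
    rw [← hlin' n]
    have h2 : C * seriesEval n z ^ 3 = A * seriesEval n x ^ 3 + B * seriesEval n y ^ 3 := by
      refine mul_left_cancel₀ (hpos n) ?_
      linarith
    rw [← h2]; ring
  let P : Polynomial ℝ := (Polynomial.C A * Polynomial.X + Polynomial.C B) ^ 3 -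
    Polynomial.C (C ^ 2) * (Polynomial.C A * Polynomial.X ^ 3 + Polynomial.C B)
  have heval : ∀ r, P.eval r = (A * r + B) ^ 3 - C ^ 2 * (A * r ^ 3 + B) := fun r => by simp [P]
  have hP : P ≠ 0 := fun h0 => by
    have e := fun r => heval r
    simp only [h0, Polynomial.eval_zero] at e
    have e1 := e 1
    have e2 := e (-1)
    have e3 := e 0
    have : 0 < A ^ 2 * B := by positivity
    nlinarith
  by_contra hcon
  push Not at hcon
  have hy' : ∀ᶠ n in atTop, seriesEval n y ≠ 0 := by
    by_contra hc
    exact hy (eq_zero_of_frequently_seriesEval hc)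
  have hroots : ∀ᶠ n in atTop, ∀ r ∈ P.roots.toFinset, seriesEval n (x - r • y) ≠ 0 := by
    rw [Filter.eventually_all_finset]
    intro r _
    by_contra hc
    exact hcon r (sub_eq_zero.1 (eq_zero_of_frequently_seriesEval hc))
  obtain ⟨n, hn, hny, hnr⟩ := (Nat.frequently_odd.and_eventually (hy'.and hroots)).exists
  refine hnr (seriesEval n x / seriesEval n y) ?_ ?_
  · rw [Multiset.mem_toFinset, Polynomial.mem_roots hP, Polynomial.IsRoot.def, heval]
    field_simp
    linarith [hcub n hn]
  · rw [map_sub, map_smul, smul_eq_mul, div_mul_cancel₀ _ hny, sub_self]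

theorem not_finiteDimensional : ¬ FiniteDimensional ℝ C₀(ℕ, ℝ) := by
  intro hfin
  have hli : LinearIndependent ℝ unitVec :=
    LinearIndependent.of_comp (LinearMap.pi coord) (Pi.linearIndependent_single_one ℕ ℝ)
  exact Infinite.not_finite hli.finite

end ZeroAtInftyContinuousMap

end

open ZeroAtInftyContinuousMap in
/-- There exists an infinite-dimensional real Banach space `X` such that whenever
`f, g ∈ NA(X, ℝ)` are linearly independent and `0 < t < 1`, the functional
`t • f + (1 - t) • g` is not norm-attaining. -/
theorem statement1 :
    ∃ (X : Type) (_ : NormedAddCommGroup X) (_ : NormedSpace ℝ X) (_ : CompleteSpace X),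
      ¬ FiniteDimensional ℝ X ∧
      ∀ f g : X →L[ℝ] ℝ,
        (∃ x : X, ‖x‖ = 1 ∧ |f x| = ‖f‖) →
        (∃ x : X, ‖x‖ = 1 ∧ |g x| = ‖g‖) →
        LinearIndependent ℝ ![f, g] →
        ∀ t : ℝ, 0 < t → t < 1 →
          ¬ ∃ x : X, ‖x‖ = 1 ∧ |(t • f + (1 - t) • g) x| = ‖t • f + (1 - t) • g‖ := by
  have h0 : energy 0 < 1 := by rw [energy_zero]; exact one_pos
  obtain ⟨X, iG, iN, iC, e, hball, hsphere⟩ := exists_complete_renorming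
    isSmoothConvex_energy.convexOn continuous_energy energy_neg h0 two_pos
    fun x => norm_le_of_energy_le_one
  refine ⟨X, iG, iN, iC, fun hfin => not_finiteDimensional e.finiteDimensional, ?_⟩
  have hgrad : ∀ f : X →L[ℝ] ℝ, f ≠ 0 → (∃ x : X, ‖x‖ = 1 ∧ |f x| = ‖f‖) →
      ∃ x : X, ‖x‖ = 1 ∧ ∃ c : ℝ, 0 < c ∧ ∀ v, f v = c * energyGrad (e x) (e v) := by
    rintro f hf ⟨x, hx, hfx⟩
    obtain ⟨y, hy, hfy⟩ : ∃ y : X, ‖y‖ = 1 ∧ f y = ‖f‖ := by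
      rcases abs_choice (f x) with h | h
      · exact ⟨x, hx, h ▸ hfx⟩
      · exact ⟨-x, by rwa [norm_neg], by rw [map_neg, ← h, hfx]⟩
    exact ⟨y, hy, isSmoothConvex_energy.exists_eq_mul h0 e hball (hsphere y hy) hf hfy⟩
  intro f g hf hg hli t ht0 ht1 hh
  rw [LinearIndependent.pair_iff] at hli
  obtain ⟨x, hx, a, ha, hfx⟩ := hgrad f (fun h => one_ne_zero (hli 1 0 (by simp [h])).1) hf
  obtain ⟨y, hy, b, hb, hgy⟩ := hgrad g (fun h => one_ne_zero (hli 0 1 (by simp [h])).2) hg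
  obtain ⟨z, -, c, -, hhz⟩ := hgrad _ (fun h => ht0.ne' (hli t (1 - t) h).1) hh
  have hy0 : e y ≠ 0 := fun h => by
    have := hsphere y hy
    rw [h] at this
    exact h0.ne this
  obtain ⟨r, hr⟩ := exists_eq_smul_of_energyGrad (x := e x) (z := e z) hy0 (mul_pos ht0 ha)
    (mul_pos (sub_pos.2 ht1) hb) fun v => by
      have := hhz (e.symm v)
      simp only [_root_.add_apply, _root_.smul_apply, smul_eq_mul, hfx,
        hgy, e.apply_symm_apply] at this
      linarith
  rw [← map_smul, e.injective.eq_iff] at hr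
  have hrabs : |r| = 1 := by
    rw [hr, norm_smul, hy, mul_one, Real.norm_eq_abs] at hx
    exact hx
  rcases eq_or_eq_neg_of_abs_eq hrabs with rfl | rfl
  · refine ha.ne' (neg_eq_zero.1 (hli b (-a) ?_).2)
    ext v
    simp only [_root_.add_apply, _root_.smul_apply, smul_eq_mul, hfx,
      hgy, hr, one_smul, _root_.zero_apply]
    ring
  · refine ha.ne' (hli b a ?_).2
    ext v
    simp only [_root_.add_apply, _root_.smul_apply, smul_eq_mul, hfx,
      hgy, hr, neg_smul, one_smul, map_neg, energyGrad_neg, _root_.zero_apply]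
    ring
end

section
/- There exist a real Banach space X and a continuous linear equivalence (a linear homeomorphism) between X and c₀ such that whenever f, g ∈ NA(X,ℝ) are linearly independent and 0 < t < 1, the functional t·f + (1−t)·g is not norm-attaining. -/
open Filter Topology

/-- The vector space underlying `E`, to be normed by the seminorm `p`. -/
def Renormed {E : Type} [AddCommGroup E] [Module ℝ E] (_ : Seminorm ℝ E) : Type := E

namespace Renormed

variable {E : Type} [AddCommGroup E] [Module ℝ E] (p : Seminorm ℝ E)

instance : AddCommGroup (Renormed p) := inferInstanceAs (AddCommGroup E)

instance : Module ℝ (Renormed p) := inferInstanceAs (Module ℝ E)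

/-- The identity map from the renormed space to the original one. -/
def toOriginal : Renormed p ≃ₗ[ℝ] E := LinearEquiv.refl ℝ E

end Renormed

theorem exists_renorming_norm_eq_gauge {E : Type} [NormedAddCommGroup E] [NormedSpace ℝ E]
    [CompleteSpace E] {K : Set E} (hconv : Convex ℝ K) (hneg : ∀ x ∈ K, -x ∈ K) {r R : ℝ}
    (hr : 0 < r) (hrK : Metric.ball 0 r ⊆ K) (hR : 0 < R) (hKR : K ⊆ Metric.closedBall 0 R) :
    ∃ (X : Type) (_ : NormedAddCommGroup X) (_ : NormedSpace ℝ X) (_ : CompleteSpace X)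
      (e : X ≃L[ℝ] E), ∀ x, ‖x‖ = gauge K (e x) := by
  have habs : Absorbent ℝ K := (absorbent_ball_zero hr).mono hrK
  set p : Seminorm ℝ E := gaugeSeminorm ((balanced_iff_neg_mem hconv).2 hneg) hconv habs with hp
  have hpg (x : E) : p x = gauge K x := rfl
  have hup (x : E) : p x ≤ r⁻¹ * ‖x‖ := by
    rw [hpg, inv_mul_eq_div, le_div_iff₀' hr]
    exact mul_gauge_le_norm hrK
  have hlow (x : E) : ‖x‖ ≤ R * p x := by
    have := le_gauge_of_subset_closedBall (x := x) habs hR.le hKR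
    rwa [div_le_iff₀' hR] at this
  let N : AddGroupNorm (Renormed p) :=
    { toFun := fun x => p (Renormed.toOriginal p x)
      map_zero' := by simp
      add_le' := fun x y => by simpa using map_add_le_add p _ _
      neg' := fun x => by simp
      eq_zero_of_map_eq_zero' := fun x hx => by
        have := hlow (Renormed.toOriginal p x)
        rw [hx, mul_zero] at this
        simpa using this }
  let : NormedAddCommGroup (Renormed p) := N.toNormedAddCommGroup
  have hnorm (x : Renormed p) : ‖x‖ = p (Renormed.toOriginal p x) := rfl
  let : NormedSpace ℝ (Renormed p) :=
    { norm_smul_le := fun a x => by simp [hnorm, map_smul_eq_mul] }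
  let e : Renormed p ≃L[ℝ] E := (Renormed.toOriginal p).toContinuousLinearEquivOfBounds R r⁻¹
    (fun x => hlow _) (fun x => by simpa [hnorm] using hup x)
  exact ⟨Renormed p, inferInstance, inferInstance,
    (completeSpace_congr (e := e.toEquiv) e.isUniformEmbedding).2 inferInstance, e, fun x => rfl⟩

theorem le_one_of_gauge_le_one {E : Type*} [AddCommGroup E] [Module ℝ E] {F : E → ℝ}
    {D : E → E →ₗ[ℝ] ℝ} (hF : F 0 ≤ 1) (hgrad : ∀ x y, F x + D x (y - x) ≤ F y)
    (hK : Absorbent ℝ {x | F x ≤ 1}) (hconv : Convex ℝ {x | F x ≤ 1})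
    {x : E} (hx : gauge {x | F x ≤ 1} x ≤ 1) : F x ≤ 1 := by
  have key (s : ℝ) (hs : 1 < s) : F x ≤ 1 + (1 - s⁻¹) * D x x := by
    have h0 : 0 < s := by linarith
    have hlt : gauge {x | F x ≤ 1} (s⁻¹ • x) < 1 := by
      rw [gauge_smul_of_nonneg (by positivity), smul_eq_mul, inv_mul_lt_iff₀ h0]
      linarith
    have hmem : F (s⁻¹ • x) ≤ 1 := setOfPred_gauge_lt_one_subset_self hconv hF hK hlt
    have := hgrad x (s⁻¹ • x)
    rw [map_sub, map_smul, smul_eq_mul] at this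
    linarith
  have hlim : Tendsto (fun s : ℝ => 1 + (1 - s⁻¹) * D x x) (𝓝[>] 1)
      (𝓝 (1 + (1 - 1⁻¹) * D x x)) := by
    refine Tendsto.mono_left ?_ nhdsWithin_le_nhds
    exact tendsto_const_nhds.add
      ((tendsto_const_nhds.sub (tendsto_inv₀ one_ne_zero)).mul tendsto_const_nhds)
  have := ge_of_tendsto hlim (eventually_mem_nhdsWithin.mono key)
  simpa using this

theorem exists_pos_forall_add_smul_le {E : Type*} [AddCommGroup E] [Module ℝ E] {F : E → ℝ}
    {D : E → E →ₗ[ℝ] ℝ}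
    (hdiff : ∀ x d, ∃ C, ∀ t : ℝ, 0 ≤ t → t ≤ 1 → F (x + t • d) ≤ F x + t * D x d + C * t ^ 2)
    {x d : E} {a : ℝ} (h : F x ≤ a) (h' : F x < a ∨ D x d < 0) :
    ∃ t : ℝ, 0 < t ∧ F (x + t • d) ≤ a := by
  obtain ⟨C, hC⟩ := hdiff x d
  have hlim : Tendsto (fun t : ℝ => D x d + C * t) (𝓝[>] 0) (𝓝 (D x d + C * 0)) :=
    (tendsto_const_nhds.add (tendsto_const_nhds.mul tendsto_id)).mono_left nhdsWithin_le_nhds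
  have hlim' : Tendsto (fun t : ℝ => F x + t * D x d + C * t ^ 2) (𝓝[>] 0)
      (𝓝 (F x + 0 * D x d + C * 0 ^ 2)) :=
    ((tendsto_const_nhds.add (tendsto_id.mul tendsto_const_nhds)).add
      (tendsto_const_nhds.mul (tendsto_id.pow 2))).mono_left nhdsWithin_le_nhds
  have h01 : ∀ᶠ t : ℝ in 𝓝[>] 0, 0 < t ∧ t < 1 := Ioo_mem_nhdsGT one_pos
  rcases h' with h' | h'
  · have := hlim'.eventually_lt_const (by simpa using h')
    obtain ⟨t, ⟨h0, h1⟩, ht⟩ := (h01.and this).exists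
    exact ⟨t, h0, (hC t h0.le h1.le).trans ht.le⟩
  · have := hlim.eventually_lt_const (by simpa using h')
    obtain ⟨t, ⟨h0, h1⟩, ht⟩ := (h01.and this).exists
    refine ⟨t, h0, (hC t h0.le h1.le).trans ?_⟩
    nlinarith

theorem exists_eq_smul_gradient_of_attains {X E : Type*} [NormedAddCommGroup X] [NormedSpace ℝ X]
    [NormedAddCommGroup E] [NormedSpace ℝ E] (e : X ≃L[ℝ] E) {F : E → ℝ} {D : E → E →ₗ[ℝ] ℝ}
    (hF : F 0 = 0) (hgrad : ∀ x y, F x + D x (y - x) ≤ F y)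
    (hdiff : ∀ x d, ∃ C, ∀ t : ℝ, 0 ≤ t → t ≤ 1 → F (x + t • d) ≤ F x + t * D x d + C * t ^ 2)
    (hK : Absorbent ℝ {x | F x ≤ 1}) (hconv : Convex ℝ {x | F x ≤ 1})
    (hnorm : ∀ x, ‖x‖ = gauge {x | F x ≤ 1} (e x)) {f : X →L[ℝ] ℝ} (hf : f ≠ 0)
    (hatt : ∃ x : X, ‖x‖ = 1 ∧ |f x| = ‖f‖) :
    ∃ (x : X) (c : ℝ), ‖x‖ = 1 ∧ c ≠ 0 ∧ ∀ y, f y = c * D (e x) (e y) := by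
  obtain ⟨x, hx, hfx⟩ : ∃ x : X, ‖x‖ = 1 ∧ f x = ‖f‖ := by
    obtain ⟨x, hx, hfx⟩ := hatt
    rcases abs_choice (f x) with h | h
    · exact ⟨x, hx, h ▸ hfx⟩
    · exact ⟨-x, by simpa using hx, by rw [map_neg, ← h, hfx]⟩
  have hpos : 0 < f x := hfx ▸ norm_pos_iff.2 hf
  have hle : F (e x) ≤ 1 :=
    le_one_of_gauge_le_one (by simp [hF]) hgrad hK hconv (by rw [← hnorm, hx])
  have hball {y : X} (hy : F (e y) ≤ 1) : ‖y‖ ≤ 1 := by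
    rw [hnorm]
    exact gauge_le_one_of_mem hy
  have hD : 0 < D (e x) (e x) := by
    by_contra! hD
    have h0 := hgrad (e x) 0
    rw [zero_sub, map_neg, hF] at h0
    obtain ⟨t, ht, h⟩ := exists_pos_forall_add_smul_le hdiff (d := e x) hle
      (.inl (by linarith))
    have := hball (y := x + t • x) (by simpa using h)
    rw [show x + t • x = (1 + t) • x by rw [add_smul, one_smul], norm_smul, hx,
      Real.norm_of_nonneg (by positivity)] at this
    linarith
  have hneg {y : X} (hy : D (e x) (e y) < 0) : f y ≤ 0 := by
    obtain ⟨t, ht, h⟩ := exists_pos_forall_add_smul_le hdiff (d := e y) hle (.inr hy)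
    have h1 := hball (y := x + t • y) (by simpa using h)
    have h2 := (le_abs_self _).trans (f.le_of_opNorm_le_of_le le_rfl h1)
    rw [map_add, map_smul, smul_eq_mul, hfx] at h2
    nlinarith
  have hker {y : X} (hy : D (e x) (e y) = 0) : f y ≤ 0 := by
    refine le_of_forall_pos_le_add fun ε hε => ?_
    have := hneg (y := y - (ε / f x) • x) (by
      simp only [map_sub, map_smul, hy, smul_eq_mul]
      have := mul_pos (div_pos hε hpos) hD
      linarith)
    rw [map_sub, map_smul, smul_eq_mul, div_mul_cancel₀ _ hpos.ne'] at this
    linarith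
  refine ⟨x, f x / D (e x) (e x), hx, (div_pos hpos hD).ne', fun y => ?_⟩
  have hz : D (e x) (e (y - (D (e x) (e y) / D (e x) (e x)) • x)) = 0 := by
    simp only [map_sub, map_smul, smul_eq_mul]
    field_simp
    simp
  have h1 := hker hz
  have h2 := hker (y := -(y - (D (e x) (e y) / D (e x) (e x)) • x)) (by
    rw [map_neg, map_neg, hz, neg_zero])
  rw [map_neg] at h2
  simp only [map_sub, map_smul, smul_eq_mul] at h1 h2
  have : f y = D (e x) (e y) / D (e x) (e x) * f x := by linarith
  rw [this]
  ring
open ZeroAtInfty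

/-- A convex function that vanishes exactly on `[-1, 1]`. -/
noncomputable def bump (t : ℝ) : ℝ := max (t - 1) 0 ^ 2 + max (-t - 1) 0 ^ 2

/-- The derivative of `bump`. -/
noncomputable def bumpDeriv (t : ℝ) : ℝ := 2 * max (t - 1) 0 - 2 * max (-t - 1) 0

theorem bump_nonneg (t : ℝ) : 0 ≤ bump t := by
  unfold bump
  positivity

theorem bump_neg (t : ℝ) : bump (-t) = bump t := by
  simp [bump, add_comm]

theorem bumpDeriv_neg (t : ℝ) : bumpDeriv (-t) = -bumpDeriv t := by
  simp [bumpDeriv]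

theorem bump_eq_zero {t : ℝ} (ht : |t| ≤ 1) : bump t = 0 := by
  rw [abs_le] at ht
  rw [bump, max_eq_right (by linarith), max_eq_right (by linarith)]
  simp

theorem bumpDeriv_eq_zero {t : ℝ} (ht : |t| ≤ 1) : bumpDeriv t = 0 := by
  rw [abs_le] at ht
  rw [bumpDeriv, max_eq_right (by linarith), max_eq_right (by linarith)]
  simp

theorem abs_le_two_of_bump_le_one {t : ℝ} (ht : bump t ≤ 1) : |t| ≤ 2 := by
  have h1 : max (t - 1) 0 ^ 2 ≤ 1 := by unfold bump at ht; nlinarith [sq_nonneg (max (-t - 1) 0)]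
  have h2 : max (-t - 1) 0 ^ 2 ≤ 1 := by unfold bump at ht; nlinarith [sq_nonneg (max (t - 1) 0)]
  rw [sq_le_one_iff_abs_le_one] at h1 h2
  have h3 := (le_max_left (t - 1) 0).trans ((le_abs_self _).trans h1)
  have h4 := (le_max_left (-t - 1) 0).trans ((le_abs_self _).trans h2)
  exact abs_le.2 ⟨by linarith, by linarith⟩

theorem sq_max_zero_bounds (a b : ℝ) :
    max a 0 ^ 2 + 2 * max a 0 * (b - a) ≤ max b 0 ^ 2 ∧
      max b 0 ^ 2 ≤ max a 0 ^ 2 + 2 * max a 0 * (b - a) + (b - a) ^ 2 := by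
  rcases le_total a 0 with ha | ha <;> rcases le_total b 0 with hb | hb <;>
    simp only [max_eq_left, max_eq_right, ha, hb] <;> constructor <;>
    nlinarith [sq_nonneg (b - a)]

theorem bump_add_le (a b : ℝ) : bump a + bumpDeriv a * (b - a) ≤ bump b := by
  have h1 := (sq_max_zero_bounds (a - 1) (b - 1)).1
  have h2 := (sq_max_zero_bounds (-a - 1) (-b - 1)).1
  unfold bump bumpDeriv
  linarith

theorem bump_le_add (a b : ℝ) :
    bump b ≤ bump a + bumpDeriv a * (b - a) + 2 * (b - a) ^ 2 := by
  have h1 := (sq_max_zero_bounds (a - 1) (b - 1)).2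
  have h2 := (sq_max_zero_bounds (-a - 1) (-b - 1)).2
  unfold bump bumpDeriv
  linarith

theorem pow_four_add_le (a b : ℝ) : a ^ 4 + 4 * a ^ 3 * (b - a) ≤ b ^ 4 := by
  nlinarith [mul_nonneg (sq_nonneg (b - a)) (add_nonneg (sq_nonneg (a + b)) (sq_nonneg a)),
    mul_nonneg (sq_nonneg (b - a)) (sq_nonneg a)]

theorem pow_four_add_mul_le {a b M t : ℝ} (ha : |a| ≤ M) (hb : |b| ≤ M) (h0 : 0 ≤ t)
    (h1 : t ≤ 1) : (a + t * b) ^ 4 ≤ a ^ 4 + t * (4 * a ^ 3 * b) + t ^ 2 * (11 * M ^ 4) := by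
  have hM : 0 ≤ M := (abs_nonneg a).trans ha
  have e1 : a ^ 2 * b ^ 2 ≤ M ^ 4 := by
    have := mul_le_mul (pow_le_pow_left₀ (abs_nonneg a) ha 2)
      (pow_le_pow_left₀ (abs_nonneg b) hb 2) (by positivity) (by positivity)
    rw [sq_abs, sq_abs] at this
    linarith
  have e2 : a * b ^ 3 ≤ M ^ 4 := by
    have := mul_le_mul ha (pow_le_pow_left₀ (abs_nonneg b) hb 3) (by positivity) hM
    rw [← abs_pow, ← abs_mul] at this
    have := (le_abs_self _).trans this
    linarith
  have e3 : b ^ 4 ≤ M ^ 4 := by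
    have := pow_le_pow_left₀ (abs_nonneg b) hb 4
    rwa [← abs_pow, abs_of_nonneg (by positivity)] at this
  have f2 : t * (a * b ^ 3) ≤ M ^ 4 := by
    nlinarith [mul_le_mul_of_nonneg_left e2 h0, pow_nonneg hM 4]
  have f3 : t ^ 2 * b ^ 4 ≤ M ^ 4 := by
    nlinarith [mul_le_of_le_one_left (pow_nonneg hM 4) (pow_le_one₀ h0 h1 (n := 2)),
      mul_le_mul_of_nonneg_left e3 (sq_nonneg t)]
  have := mul_le_mul_of_nonneg_left
    (show 6 * (a ^ 2 * b ^ 2) + 4 * (t * (a * b ^ 3)) + t ^ 2 * b ^ 4 ≤ 11 * M ^ 4 by linarith)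
    (sq_nonneg t)
  linarith

namespace CZero

theorem abs_apply_le_norm (x : C₀(ℕ, ℝ)) (j : ℕ) : |x j| ≤ ‖x‖ :=
  x.toBCF.norm_coe_le_norm j

theorem finite_setOf_not_abs_le (x : C₀(ℕ, ℝ)) {ε : ℝ} (hε : 0 < ε) :
    {j | ¬|x j| ≤ ε}.Finite := by
  have h : Tendsto x cofinite (𝓝 0) := cocompact_eq_cofinite ℕ ▸ zero_at_infty x
  have h' : ∀ᶠ j in cofinite, |x j| ≤ ε :=
    (h.abs.eventually_lt_const (by simpa using hε)).mono fun _ => le_of_lt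
  exact h'

/-- The standard unit vectors of `c₀`. -/
noncomputable def unitVector (j : ℕ) : C₀(ℕ, ℝ) where
  toFun k := if k = j then 1 else 0
  continuous_toFun := continuous_of_discreteTopology
  zero_at_infty' := by
    rw [cocompact_eq_cofinite]
    refine tendsto_const_nhds.congr' ?_
    filter_upwards [(Set.finite_singleton j).compl_mem_cofinite] with k hk
    exact (if_neg hk).symm

theorem unitVector_apply (j k : ℕ) : unitVector j k = if k = j then 1 else 0 :=
  rfl

theorem summable_geometric_mul {r B : ℝ} (h0 : 0 ≤ r) (h1 : r < 1) {a : ℕ → ℝ}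
    (ha : ∀ i, |a i| ≤ B) : Summable fun i => r ^ i * a i := by
  refine Summable.of_norm_bounded ((summable_geometric_of_lt_one h0 h1).mul_right B) fun i => ?_
  rw [Real.norm_eq_abs, abs_mul, abs_of_nonneg (pow_nonneg h0 i)]
  exact mul_le_mul_of_nonneg_left (ha i) (pow_nonneg h0 i)

/-- The coordinates of the `i`-th block: those `j` with `(Nat.unpair j).1 = i`. -/
def blockIndicator (i j : ℕ) : ℝ := if j.unpair.1 = i then 1 else 0

theorem abs_blockIndicator_mul_le (i : ℕ) (x : C₀(ℕ, ℝ)) (j : ℕ) :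
    |blockIndicator i j * x j| ≤ ‖x‖ := by
  unfold blockIndicator
  split_ifs
  · simpa using abs_apply_le_norm x j
  · simp

theorem summable_block (i : ℕ) (x : C₀(ℕ, ℝ)) :
    Summable fun j => (1 / 2 : ℝ) ^ j * (blockIndicator i j * x j) :=
  summable_geometric_mul (by norm_num) (by norm_num) (abs_blockIndicator_mul_le i x)

/-- An infinitely supported functional living on the `i`-th block. -/
noncomputable def blockFunctional (i : ℕ) : C₀(ℕ, ℝ) →ₗ[ℝ] ℝ where
  toFun x := ∑' j, (1 / 2 : ℝ) ^ j * (blockIndicator i j * x j)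
  map_add' x y := by
    rw [← (summable_block i x).tsum_add (summable_block i y)]
    congr 1 with j
    simp only [ZeroAtInftyContinuousMap.coe_add, Pi.add_apply]
    ring
  map_smul' a x := by
    rw [RingHom.id_apply, smul_eq_mul, ← tsum_mul_left]
    congr 1 with j
    simp only [ZeroAtInftyContinuousMap.coe_smul, Pi.smul_apply, smul_eq_mul]
    ring

theorem abs_blockFunctional_le (i : ℕ) (x : C₀(ℕ, ℝ)) : |blockFunctional i x| ≤ 2 * ‖x‖ := by
  rw [← Real.norm_eq_abs]
  refine tsum_of_norm_bounded (hasSum_geometric_two.mul_right ‖x‖) fun j => ?_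
  rw [Real.norm_eq_abs, abs_mul, abs_of_nonneg (by positivity)]
  exact mul_le_mul_of_nonneg_left (abs_blockIndicator_mul_le i x j) (by positivity)

theorem blockFunctional_unitVector (i j : ℕ) :
    blockFunctional i (unitVector j) = (1 / 2 : ℝ) ^ j * blockIndicator i j := by
  change ∑' k, (1 / 2 : ℝ) ^ k * (blockIndicator i k * unitVector j k) = _
  rw [tsum_eq_single j fun k hk => by simp [unitVector_apply, hk]]
  simp [unitVector_apply]

/-- A coefficient in `{0, 1, -1}`. -/
def signCoeff (k : ℕ) : ℝ := if k = 0 then 0 else if k = 1 then 1 else -1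

theorem abs_signCoeff_le (k : ℕ) : |signCoeff k| ≤ 1 := by
  unfold signCoeff
  split_ifs <;> simp

/-- An enumeration, with infinite repetition, of the functionals `x ↦ x p + c * x q`, for
`c ∈ {0, 1, -1}`. -/
noncomputable def shortFunctional (i : ℕ) : C₀(ℕ, ℝ) →ₗ[ℝ] ℝ where
  toFun x := x i.unpair.1.unpair.1 + signCoeff i.unpair.2.unpair.1 * x i.unpair.1.unpair.2
  map_add' x y := by
    simp only [ZeroAtInftyContinuousMap.coe_add, Pi.add_apply]
    ring
  map_smul' a x := by
    simp only [ZeroAtInftyContinuousMap.coe_smul, Pi.smul_apply, smul_eq_mul, RingHom.id_apply]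
    ring

theorem abs_shortFunctional_le (i : ℕ) (x : C₀(ℕ, ℝ)) : |shortFunctional i x| ≤ 2 * ‖x‖ := by
  refine (abs_add_le _ _).trans ?_
  rw [abs_mul]
  have h1 := abs_apply_le_norm x i.unpair.1.unpair.1
  have h2 := abs_apply_le_norm x i.unpair.1.unpair.2
  have h3 := abs_signCoeff_le i.unpair.2.unpair.1
  nlinarith [abs_nonneg (x i.unpair.1.unpair.2)]

theorem shortFunctional_unitVector_eq_zero {i j : ℕ} (h : i < j) :
    shortFunctional i (unitVector j) = 0 := by
  have h1 := (Nat.unpair_left_le i.unpair.1).trans (Nat.unpair_left_le i)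
  have h2 := (Nat.unpair_right_le i.unpair.1).trans (Nat.unpair_left_le i)
  change unitVector j _ + _ * unitVector j _ = 0
  rw [unitVector_apply, unitVector_apply, if_neg (by omega), if_neg (by omega)]
  simp

theorem abs_shortFunctional_unitVector_le (i j : ℕ) :
    |shortFunctional i (unitVector j)| ≤ 2 := by
  have h (k : ℕ) : |unitVector j k| ≤ 1 := by
    rw [unitVector_apply]
    split_ifs <;> simp
  refine (abs_add_le _ _).trans ?_
  rw [abs_mul]
  have h1 := h i.unpair.1.unpair.1
  have h2 := h i.unpair.1.unpair.2
  have h3 := abs_signCoeff_le i.unpair.2.unpair.1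
  nlinarith [abs_nonneg (unitVector j i.unpair.1.unpair.2)]

/-- The short functionals, perturbed to become independent modulo finitely supported ones. -/
noncomputable def perturbed (i : ℕ) : C₀(ℕ, ℝ) →ₗ[ℝ] ℝ :=
  shortFunctional i + (1 / 2 : ℝ) ^ i • blockFunctional i

theorem perturbed_apply (i : ℕ) (x : C₀(ℕ, ℝ)) :
    perturbed i x = shortFunctional i x + (1 / 2 : ℝ) ^ i * blockFunctional i x := rfl

theorem abs_perturbed_le (i : ℕ) (x : C₀(ℕ, ℝ)) : |perturbed i x| ≤ 4 * ‖x‖ := by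
  rw [perturbed_apply]
  refine (abs_add_le _ _).trans ?_
  rw [abs_mul, abs_of_nonneg (by positivity : (0 : ℝ) ≤ (1 / 2) ^ i)]
  have h1 := abs_shortFunctional_le i x
  have h2 := abs_blockFunctional_le i x
  have h3 : ((1 : ℝ) / 2) ^ i ≤ 1 := pow_le_one₀ (by norm_num) (by norm_num)
  nlinarith [abs_nonneg (blockFunctional i x)]

theorem eq_zero_of_eventually_tsum_eq_zero {s : ℕ → ℝ} {B : ℝ} (hs : ∀ i, |s i| ≤ B) {J : ℕ}
    (h : ∀ j ≥ J, ∑' i, (1 / 8 : ℝ) ^ i * (s i * perturbed i (unitVector j)) = 0) (k : ℕ) :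
    s k = 0 := by
  have hB : 0 ≤ B := (abs_nonneg _).trans (hs 0)
  have key (m : ℕ) (hm : J ≤ m) : |s k| * (1 / 16) ^ k ≤ 4 * B * (1 / 2) ^ m := by
    set j := Nat.pair k m with hj
    have hmj : m ≤ j := Nat.right_le_pair k m
    have hshort (i : ℕ) : |(1 / 8 : ℝ) ^ i * (s i * shortFunctional i (unitVector j))| ≤
        (1 / 2) ^ i * (2 * B * (1 / 4) ^ j) := by
      rcases lt_or_ge i j with hij | hij
      · rw [shortFunctional_unitVector_eq_zero hij]
        simp only [mul_zero, abs_zero]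
        positivity
      · rw [abs_mul, abs_mul, abs_of_nonneg (by positivity : (0 : ℝ) ≤ (1 / 8) ^ i),
          show (1 / 8 : ℝ) = 1 / 2 * (1 / 4) by norm_num, mul_pow, mul_assoc]
        refine mul_le_mul_of_nonneg_left ?_ (by positivity)
        rw [mul_comm]
        refine mul_le_mul ?_ (pow_le_pow_of_le_one (by norm_num) (by norm_num) hij)
          (by positivity) (by positivity)
        have := mul_le_mul (hs i) (abs_shortFunctional_unitVector_le i j) (abs_nonneg _) hB
        linarith
    have hsum1 : Summable fun i => (1 / 8 : ℝ) ^ i * (s i * shortFunctional i (unitVector j)) :=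
      Summable.of_norm_bounded (summable_geometric_two.mul_right _) hshort
    have hbound : |∑' i, (1 / 8 : ℝ) ^ i * (s i * shortFunctional i (unitVector j))| ≤
        2 * (2 * B * (1 / 4) ^ j) := by
      rw [← Real.norm_eq_abs]
      exact tsum_of_norm_bounded (hasSum_geometric_two.mul_right _) hshort
    have hblock (i : ℕ) (hi : i ≠ k) : (1 / 8 : ℝ) ^ i *
        (s i * ((1 / 2 : ℝ) ^ i * blockFunctional i (unitVector j))) = 0 := by
      simp [blockFunctional_unitVector, blockIndicator, hj, Nat.unpair_pair, hi.symm]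
    have hblock' : (1 / 8 : ℝ) ^ k * (s k * ((1 / 2 : ℝ) ^ k * blockFunctional k (unitVector j))) =
        s k * (1 / 16) ^ k * (1 / 2) ^ j := by
      rw [blockFunctional_unitVector, blockIndicator, hj, Nat.unpair_pair, if_pos rfl,
        show (1 / 16 : ℝ) = 1 / 8 * (1 / 2) by norm_num, mul_pow]
      ring
    have hzero := h j (hm.trans hmj)
    simp only [perturbed_apply, mul_add] at hzero
    rw [hsum1.tsum_add (hasSum_single k hblock).summable, tsum_eq_single k hblock,
      hblock'] at hzero
    have habs : |s k| * (1 / 16) ^ k * (1 / 2) ^ j ≤ 2 * (2 * B * (1 / 4) ^ j) := by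
      rw [← abs_of_nonneg (by positivity : (0 : ℝ) ≤ (1 / 16) ^ k),
        ← abs_of_nonneg (by positivity : (0 : ℝ) ≤ (1 / 2) ^ j), ← abs_mul, ← abs_mul,
        eq_neg_of_add_eq_zero_right hzero, abs_neg]
      exact hbound
    have hpos : (0 : ℝ) < (1 / 2) ^ j := by positivity
    rw [show (1 / 4 : ℝ) = 1 / 2 * (1 / 2) by norm_num, mul_pow] at habs
    have h1 : |s k| * (1 / 16) ^ k ≤ 4 * B * (1 / 2) ^ j := by
      refine le_of_mul_le_mul_right ?_ hpos
      linarith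
    exact h1.trans (mul_le_mul_of_nonneg_left
      (pow_le_pow_of_le_one (by norm_num) (by norm_num) hmj) (by positivity))
  have hlim : Tendsto (fun m : ℕ => 4 * B * (1 / 2 : ℝ) ^ m) atTop (𝓝 (4 * B * 0)) :=
    tendsto_const_nhds.mul (tendsto_pow_atTop_nhds_zero_of_lt_one (by norm_num) (by norm_num))
  have h0 := ge_of_tendsto hlim ((eventually_ge_atTop J).mono key)
  rw [mul_zero] at h0
  have h1 : |s k| ≤ 0 := by
    refine le_of_mul_le_mul_right ?_ (by positivity : (0 : ℝ) < (1 / 16) ^ k)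
    rwa [zero_mul]
  exact abs_nonpos_iff.1 h1

theorem tendsto_perturbed (p q r : ℕ) (x : C₀(ℕ, ℝ)) :
    Tendsto (fun m => perturbed (Nat.pair (Nat.pair p q) (Nat.pair r m)) x) atTop
      (𝓝 (x p + signCoeff r * x q)) := by
  have hshort (m : ℕ) : shortFunctional (Nat.pair (Nat.pair p q) (Nat.pair r m)) x =
      x p + signCoeff r * x q := by
    simp [shortFunctional]
  have hlim : Tendsto (fun i : ℕ => (1 / 2 : ℝ) ^ i * blockFunctional i x) atTop (𝓝 0) :=
    (tendsto_pow_atTop_nhds_zero_of_lt_one (by norm_num) (by norm_num)).zero_mul_isBoundedUnder_le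
      (isBoundedUnder_of ⟨2 * ‖x‖, fun i => abs_blockFunctional_le i x⟩)
  have hidx : Tendsto (fun m => Nat.pair (Nat.pair p q) (Nat.pair r m)) atTop atTop :=
    tendsto_atTop_mono (fun m => (Nat.right_le_pair r m).trans (Nat.right_le_pair _ _)) tendsto_id
  simpa only [perturbed_apply, hshort, add_zero, Function.comp_def] using
    tendsto_const_nhds.add (hlim.comp hidx)

theorem det_eq_zero_of_cubes {A B C u₁ u₂ v₁ v₂ w₁ w₂ : ℝ} (hA : A ≠ 0) (hB : B ≠ 0)
    (h : ∀ k, A * (u₁ + signCoeff k * u₂) ^ 3 + B * (v₁ + signCoeff k * v₂) ^ 3 =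
      C * (w₁ + signCoeff k * w₂) ^ 3)
    (h' : A * u₂ ^ 3 + B * v₂ ^ 3 = C * w₂ ^ 3) : u₁ * v₂ - u₂ * v₁ = 0 := by
  have e₀ := h 0
  have e₁ := h 1
  have e₂ := h 2
  norm_num [signCoeff] at e₀ e₁ e₂
  have f₁ : A * (u₁ ^ 2 * u₂) + B * (v₁ ^ 2 * v₂) = C * (w₁ ^ 2 * w₂) := by
    linear_combination (e₁ - e₂ - 2 * h') / 6
  have f₂ : A * (u₁ * u₂ ^ 2) + B * (v₁ * v₂ ^ 2) = C * (w₁ * w₂ ^ 2) := by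
    linear_combination (e₁ + e₂ - 2 * e₀) / 6
  set d := u₁ * v₂ - u₂ * v₁ with hd
  have p₀ : A * d * u₁ ^ 2 = C * (w₁ * v₂ - w₂ * v₁) * w₁ ^ 2 := by
    linear_combination v₂ * e₀ - v₁ * f₁
  have p₁ : A * d * (u₁ * u₂) = C * (w₁ * v₂ - w₂ * v₁) * (w₁ * w₂) := by
    linear_combination v₂ * f₁ - v₁ * f₂
  have p₂ : A * d * u₂ ^ 2 = C * (w₁ * v₂ - w₂ * v₁) * w₂ ^ 2 := by
    linear_combination v₂ * f₂ - v₁ * h'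
  have q₀ : -B * d * v₁ ^ 2 = C * (w₁ * u₂ - w₂ * u₁) * w₁ ^ 2 := by
    linear_combination u₂ * e₀ - u₁ * f₁
  have q₁ : -B * d * (v₁ * v₂) = C * (w₁ * u₂ - w₂ * u₁) * (w₁ * w₂) := by
    linear_combination u₂ * f₁ - u₁ * f₂
  have q₂ : -B * d * v₂ ^ 2 = C * (w₁ * u₂ - w₂ * u₁) * w₂ ^ 2 := by
    linear_combination u₂ * f₂ - u₁ * h'
  have hprod : A * d * u₁ ^ 2 * (-B * d * v₂ ^ 2) -
      2 * (A * d * (u₁ * u₂)) * (-B * d * (v₁ * v₂)) + A * d * u₂ ^ 2 * (-B * d * v₁ ^ 2) = 0 := by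
    rw [p₀, p₁, p₂, q₀, q₁, q₂]
    ring
  have hprod' : A * B * d ^ 4 = 0 := by
    have : d ^ 4 = d ^ 2 * (u₁ * v₂ - u₂ * v₁) ^ 2 := by rw [← hd]; ring
    rw [this]
    linear_combination -hprod
  simpa [hA, hB] using hprod'

theorem exists_eq_smul_of_cubes {A B C : ℝ} (hA : A ≠ 0) (hB : B ≠ 0) {x y z : C₀(ℕ, ℝ)}
    (hx : x ≠ 0) (h : ∀ i, A * perturbed i x ^ 3 + B * perturbed i y ^ 3 = C * perturbed i z ^ 3) :
    ∃ a : ℝ, y = a • x := by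
  have hlim (p q r : ℕ) : A * (x p + signCoeff r * x q) ^ 3 + B * (y p + signCoeff r * y q) ^ 3 =
      C * (z p + signCoeff r * z q) ^ 3 := by
    refine tendsto_nhds_unique_of_eventuallyEq
      ((((tendsto_perturbed p q r x).pow 3).const_mul A).add
        (((tendsto_perturbed p q r y).pow 3).const_mul B))
      (((tendsto_perturbed p q r z).pow 3).const_mul C) (Eventually.of_forall fun m => h _)
  obtain ⟨p, hp⟩ : ∃ p, x p ≠ 0 := by
    by_contra! hp
    exact hx (ZeroAtInftyContinuousMap.ext hp)
  refine ⟨y p / x p, ZeroAtInftyContinuousMap.ext fun q => ?_⟩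
  have h0 := hlim q q 0
  simp only [signCoeff, if_true, zero_mul, add_zero] at h0
  have := det_eq_zero_of_cubes hA hB (hlim p q) h0
  rw [ZeroAtInftyContinuousMap.smul_apply, smul_eq_mul]
  field_simp
  linarith

theorem hasFiniteSupport_of_abs_le_one {x : C₀(ℕ, ℝ)} {a : ℕ → ℝ}
    (ha : ∀ j, |x j| ≤ 1 → a j = 0) : Function.HasFiniteSupport a :=
  (finite_setOf_not_abs_le x one_pos).subset fun j hj hle => hj (ha j hle)

theorem summable_of_abs_le_one {x : C₀(ℕ, ℝ)} {a : ℕ → ℝ} (ha : ∀ j, |x j| ≤ 1 → a j = 0) :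
    Summable a :=
  summable_of_hasFiniteSupport (hasFiniteSupport_of_abs_le_one ha)

theorem summable_bump (x : C₀(ℕ, ℝ)) : Summable fun j => bump (x j) :=
  summable_of_abs_le_one (x := x) fun _ hj => bump_eq_zero hj

theorem summable_bumpDeriv (x h : C₀(ℕ, ℝ)) : Summable fun j => bumpDeriv (x j) * h j :=
  summable_of_abs_le_one (x := x) fun _ hj => by rw [bumpDeriv_eq_zero hj, zero_mul]

theorem abs_perturbed_pow_le (n i : ℕ) (x : C₀(ℕ, ℝ)) : |perturbed i x ^ n| ≤ (4 * ‖x‖) ^ n := by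
  rw [abs_pow]
  exact pow_le_pow_left₀ (abs_nonneg _) (abs_perturbed_le i x) n

theorem summable_quartic (x : C₀(ℕ, ℝ)) : Summable fun i => (1 / 8 : ℝ) ^ i * perturbed i x ^ 4 :=
  summable_geometric_mul (by norm_num) (by norm_num) fun i => abs_perturbed_pow_le 4 i x

theorem summable_cubic (x h : C₀(ℕ, ℝ)) :
    Summable fun i => (1 / 8 : ℝ) ^ i * (4 * perturbed i x ^ 3 * perturbed i h) := by
  refine summable_geometric_mul (B := 4 * (4 * ‖x‖) ^ 3 * (4 * ‖h‖)) (by norm_num) (by norm_num)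
    fun i => ?_
  rw [abs_mul, abs_mul, abs_of_pos (four_pos : (0 : ℝ) < 4)]
  exact mul_le_mul (mul_le_mul_of_nonneg_left (abs_perturbed_pow_le 3 i x) (by norm_num))
    (abs_perturbed_le i h) (abs_nonneg _) (by positivity)

/-- The convex function whose unit sublevel set is the unit ball of the new norm. -/
noncomputable def potential (x : C₀(ℕ, ℝ)) : ℝ :=
  ∑' j, bump (x j) + ∑' i, (1 / 8 : ℝ) ^ i * perturbed i x ^ 4

/-- The derivative of `potential`. -/
noncomputable def gradient (x : C₀(ℕ, ℝ)) : C₀(ℕ, ℝ) →ₗ[ℝ] ℝ where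
  toFun h := ∑' j, bumpDeriv (x j) * h j +
    ∑' i, (1 / 8 : ℝ) ^ i * (4 * perturbed i x ^ 3 * perturbed i h)
  map_add' h k := by
    rw [add_add_add_comm, ← (summable_bumpDeriv x h).tsum_add (summable_bumpDeriv x k),
      ← (summable_cubic x h).tsum_add (summable_cubic x k)]
    congr 2 with j
    · simp only [ZeroAtInftyContinuousMap.coe_add, Pi.add_apply, mul_add]
    · rw [map_add]
      ring
  map_smul' a h := by
    rw [RingHom.id_apply, smul_eq_mul, mul_add, ← tsum_mul_left, ← tsum_mul_left]
    congr 2 with j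
    · simp only [ZeroAtInftyContinuousMap.coe_smul, Pi.smul_apply, smul_eq_mul]
      ring
    · rw [map_smul, smul_eq_mul]
      ring

theorem gradient_apply (x h : C₀(ℕ, ℝ)) : gradient x h = ∑' j, bumpDeriv (x j) * h j +
    ∑' i, (1 / 8 : ℝ) ^ i * (4 * perturbed i x ^ 3 * perturbed i h) := rfl

theorem gradient_neg (x h : C₀(ℕ, ℝ)) : gradient (-x) h = -gradient x h := by
  rw [gradient_apply, gradient_apply, neg_add, ← tsum_neg, ← tsum_neg]
  congr 2 with j
  · simp only [ZeroAtInftyContinuousMap.coe_neg, Pi.neg_apply, bumpDeriv_neg, neg_mul]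
  · rw [map_neg]
    ring

theorem gradient_unitVector (x : C₀(ℕ, ℝ)) {j : ℕ} (hj : |x j| ≤ 1) :
    gradient x (unitVector j) =
      ∑' i, (1 / 8 : ℝ) ^ i * (4 * perturbed i x ^ 3 * perturbed i (unitVector j)) := by
  rw [gradient_apply, tsum_eq_single j fun k hk => by simp [unitVector_apply, hk],
    bumpDeriv_eq_zero hj, zero_mul, zero_add]

theorem potential_zero : potential 0 = 0 := by
  simp [potential, bump_eq_zero]

theorem potential_neg (x : C₀(ℕ, ℝ)) : potential (-x) = potential x := by
  rw [potential, potential]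
  congr 2 with j
  · simp only [ZeroAtInftyContinuousMap.coe_neg, Pi.neg_apply, bump_neg]
  · rw [map_neg]
    ring

theorem potential_add_gradient_le (x y : C₀(ℕ, ℝ)) :
    potential x + gradient x (y - x) ≤ potential y := by
  rw [gradient_apply, potential, potential, add_add_add_comm,
    ← (summable_bump x).tsum_add (summable_bumpDeriv x (y - x)),
    ← (summable_quartic x).tsum_add (summable_cubic x (y - x))]
  refine add_le_add (Summable.tsum_le_tsum (fun j => ?_)
    ((summable_bump x).add (summable_bumpDeriv x (y - x))) (summable_bump y))
    (Summable.tsum_le_tsum (fun i => ?_)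
      ((summable_quartic x).add (summable_cubic x (y - x))) (summable_quartic y))
  · exact bump_add_le (x j) (y j)
  · rw [← mul_add, map_sub]
    exact mul_le_mul_of_nonneg_left (pow_four_add_le _ _) (by positivity)

theorem exists_potential_add_smul_le (x d : C₀(ℕ, ℝ)) : ∃ C, ∀ t : ℝ, 0 ≤ t → t ≤ 1 →
    potential (x + t • d) ≤ potential x + t * gradient x d + C * t ^ 2 := by
  set g : ℕ → ℝ := fun j => if |x j| ≤ 1 / 2 ∧ |d j| ≤ 1 / 2 then 0 else 2 * d j ^ 2 with hg
  have hgsum : Summable g := by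
    refine summable_of_hasFiniteSupport (Set.Finite.subset
      ((finite_setOf_not_abs_le x (half_pos one_pos)).union
        (finite_setOf_not_abs_le d (half_pos one_pos))) fun j hj => ?_)
    by_contra hcon
    simp only [Set.mem_union, Set.mem_ofPred_eq, not_or, not_not] at hcon
    exact hj (if_pos hcon)
  set M : ℝ := 4 * ‖x‖ + 4 * ‖d‖ with hM
  have hgeom : Summable fun i : ℕ => (1 / 8 : ℝ) ^ i * (11 * M ^ 4) :=
    (summable_geometric_of_lt_one (by norm_num) (by norm_num)).mul_right _
  refine ⟨∑' j, g j + ∑' i : ℕ, (1 / 8 : ℝ) ^ i * (11 * M ^ 4), fun t h0 h1 => ?_⟩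
  have hbump : ∑' j, bump ((x + t • d) j) ≤
      ∑' j, bump (x j) + t * ∑' j, bumpDeriv (x j) * d j + t ^ 2 * ∑' j, g j := by
    rw [← tsum_mul_left, ← tsum_mul_left,
      ← (summable_bump x).tsum_add ((summable_bumpDeriv x d).mul_left t),
      ← ((summable_bump x).add ((summable_bumpDeriv x d).mul_left t)).tsum_add
        (hgsum.mul_left (t ^ 2))]
    refine Summable.tsum_le_tsum (fun j => ?_) (summable_bump _)
      (((summable_bump x).add ((summable_bumpDeriv x d).mul_left t)).add (hgsum.mul_left (t ^ 2)))
    simp only [ZeroAtInftyContinuousMap.coe_add, ZeroAtInftyContinuousMap.coe_smul, Pi.add_apply,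
      Pi.smul_apply, smul_eq_mul, hg]
    split_ifs with hj
    · have hle : |x j + t * d j| ≤ 1 := by
        refine (abs_add_le _ _).trans ?_
        rw [abs_mul, abs_of_nonneg h0]
        nlinarith [hj.1, hj.2, abs_nonneg (d j)]
      rw [bump_eq_zero hle, bumpDeriv_eq_zero (by linarith [hj.1] : |x j| ≤ 1)]
      linarith [bump_nonneg (x j)]
    · have := bump_le_add (x j) (x j + t * d j)
      linarith
  have hquartic : ∑' i, (1 / 8 : ℝ) ^ i * perturbed i (x + t • d) ^ 4 ≤
      ∑' i, (1 / 8 : ℝ) ^ i * perturbed i x ^ 4 +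
        t * ∑' i, (1 / 8 : ℝ) ^ i * (4 * perturbed i x ^ 3 * perturbed i d) +
          t ^ 2 * ∑' i : ℕ, (1 / 8 : ℝ) ^ i * (11 * M ^ 4) := by
    rw [← tsum_mul_left, ← tsum_mul_left,
      ← (summable_quartic x).tsum_add ((summable_cubic x d).mul_left t),
      ← ((summable_quartic x).add ((summable_cubic x d).mul_left t)).tsum_add
        (hgeom.mul_left (t ^ 2))]
    refine Summable.tsum_le_tsum (fun i => ?_) (summable_quartic _)
      (((summable_quartic x).add ((summable_cubic x d).mul_left t)).add (hgeom.mul_left (t ^ 2)))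
    have hx := (abs_perturbed_le i x).trans
      (show 4 * ‖x‖ ≤ M by rw [hM]; linarith [norm_nonneg d])
    have hd := (abs_perturbed_le i d).trans
      (show 4 * ‖d‖ ≤ M by rw [hM]; linarith [norm_nonneg x])
    have := mul_le_mul_of_nonneg_left (pow_four_add_mul_le hx hd h0 h1)
      (by positivity : (0 : ℝ) ≤ (1 / 8) ^ i)
    rw [map_add, map_smul, smul_eq_mul]
    linarith
  rw [potential, potential, gradient_apply]
  linarith

theorem convex_potential_le_one : Convex ℝ {x | potential x ≤ 1} := by
  intro x hx y hy a b ha hb hab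
  have h1 := potential_add_gradient_le (a • x + b • y) x
  have h2 := potential_add_gradient_le (a • x + b • y) y
  have h3 : a * gradient (a • x + b • y) (x - (a • x + b • y)) +
      b * gradient (a • x + b • y) (y - (a • x + b • y)) = 0 := by
    simp only [map_sub, map_add, map_smul, smul_eq_mul]
    rw [eq_sub_of_add_eq' hab]
    ring
  have h4 := mul_le_mul_of_nonneg_left (h1.trans hx) ha
  have h5 := mul_le_mul_of_nonneg_left (h2.trans hy) hb
  have : (a + b) * potential (a • x + b • y) ≤ a + b := by linarith
  rwa [hab, one_mul] at this

theorem ball_subset_potential_le_one :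
    Metric.ball 0 (1 / 8) ⊆ {x | potential x ≤ 1} := by
  intro x hx
  rw [mem_ball_zero_iff] at hx
  have hbump : ∑' j, bump (x j) = 0 := by
    have (j : ℕ) : bump (x j) = 0 :=
      bump_eq_zero ((abs_apply_le_norm x j).trans (hx.le.trans (by norm_num)))
    simp [this]
  have hquartic : ∑' i, (1 / 8 : ℝ) ^ i * perturbed i x ^ 4 ≤ ∑' i : ℕ, (1 / 2) ^ i * (1 / 2) := by
    refine Summable.tsum_le_tsum (fun i => ?_) (summable_quartic x)
      (summable_geometric_two.mul_right _)
    refine mul_le_mul (pow_le_pow_left₀ (by norm_num) (by norm_num) i) ?_ (by positivity)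
      (by positivity)
    refine (le_abs_self _).trans ((abs_perturbed_pow_le 4 i x).trans ?_)
    refine (pow_le_pow_left₀ (by positivity) (show 4 * ‖x‖ ≤ 1 / 2 by linarith) 4).trans ?_
    norm_num
  rw [tsum_mul_right, tsum_geometric_two] at hquartic
  rw [Set.mem_ofPred_eq, potential, hbump]
  linarith

theorem potential_le_one_subset_closedBall :
    {x | potential x ≤ 1} ⊆ Metric.closedBall 0 2 := by
  intro x hx
  rw [mem_closedBall_zero_iff]
  refine (BoundedContinuousFunction.norm_le zero_le_two).2 fun j => ?_
  refine abs_le_two_of_bump_le_one (t := x j) (le_trans ?_ hx)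
  have h1 : bump (x j) ≤ ∑' j, bump (x j) :=
    (summable_bump x).le_tsum j fun k _ => bump_nonneg _
  have h2 : 0 ≤ ∑' i, (1 / 8 : ℝ) ^ i * perturbed i x ^ 4 :=
    tsum_nonneg fun i => mul_nonneg (by positivity) (Even.pow_nonneg (by decide) _)
  rw [potential]
  linarith

theorem exists_eq_smul_of_gradient_relation {A B C : ℝ} (hA : A ≠ 0) (hB : B ≠ 0)
    {x y z : C₀(ℕ, ℝ)} (hx : x ≠ 0)
    (h : ∀ d, A * gradient x d + B * gradient y d = C * gradient z d) :
    ∃ a : ℝ, y = a • x := by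
  refine exists_eq_smul_of_cubes (C := C) (z := z) hA hB hx fun i => sub_eq_zero.1 ?_
  obtain ⟨J, hJ⟩ : ∃ J, ∀ j ≥ J, |x j| ≤ 1 ∧ |y j| ≤ 1 ∧ |z j| ≤ 1 := by
    have hev (u : C₀(ℕ, ℝ)) : ∀ᶠ j in atTop, |u j| ≤ 1 := by
      rw [← Nat.cofinite_eq_atTop]
      exact finite_setOf_not_abs_le u one_pos
    exact eventually_atTop.1 ((hev x).and ((hev y).and (hev z)))
  refine eq_zero_of_eventually_tsum_eq_zero (J := J)
    (s := fun i => A * perturbed i x ^ 3 + B * perturbed i y ^ 3 - C * perturbed i z ^ 3)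
    (B := |A| * (4 * ‖x‖) ^ 3 + |B| * (4 * ‖y‖) ^ 3 + |C| * (4 * ‖z‖) ^ 3) (fun i => ?_)
    (fun j hj => ?_) i
  · refine (abs_sub _ _).trans (add_le_add ((abs_add_le _ _).trans (add_le_add ?_ ?_)) ?_) <;>
    · rw [abs_mul]
      exact mul_le_mul_of_nonneg_left (abs_perturbed_pow_le 3 i _) (abs_nonneg _)
  · obtain ⟨h1, h2, h3⟩ := hJ j hj
    have := h (unitVector j)
    rw [gradient_unitVector x h1, gradient_unitVector y h2, gradient_unitVector z h3,
      ← tsum_mul_left, ← tsum_mul_left, ← tsum_mul_left,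
      ← ((summable_cubic x _).mul_left A).tsum_add ((summable_cubic y _).mul_left B),
      ← sub_eq_zero, ← (((summable_cubic x _).mul_left A).add
        ((summable_cubic y _).mul_left B)).tsum_sub ((summable_cubic z _).mul_left C)] at this
    refine (mul_right_inj' (four_ne_zero (α := ℝ))).1 ?_
    rw [mul_zero, ← this, ← tsum_mul_left]
    congr 1 with i
    ring

end CZero

open CZero in
/-- There exist a real Banach space `X` and a linear homeomorphism between `X` and `c₀`
(the space of real sequences vanishing at infinity with the sup norm) such that whenever
`f, g ∈ NA(X, ℝ)` are linearly independent and `0 < t < 1`, the functional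
`t • f + (1 - t) • g` is not norm-attaining. -/
theorem statement2 :
    ∃ (X : Type) (_ : NormedAddCommGroup X) (_ : NormedSpace ℝ X) (_ : CompleteSpace X),
      Nonempty (X ≃L[ℝ] ZeroAtInftyContinuousMap ℕ ℝ) ∧
      ∀ f g : X →L[ℝ] ℝ,
        (∃ x : X, ‖x‖ = 1 ∧ |f x| = ‖f‖) →
        (∃ x : X, ‖x‖ = 1 ∧ |g x| = ‖g‖) →
        LinearIndependent ℝ ![f, g] →
        ∀ t : ℝ, 0 < t → t < 1 →
          ¬ ∃ x : X, ‖x‖ = 1 ∧ |(t • f + (1 - t) • g) x| = ‖t • f + (1 - t) • g‖ := by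
  obtain ⟨X, _, _, hcomplete, e, hnorm⟩ := exists_renorming_norm_eq_gauge convex_potential_le_one
    (fun x hx => (potential_neg x).trans_le hx) (by norm_num) ball_subset_potential_le_one
    zero_lt_two potential_le_one_subset_closedBall
  refine ⟨X, inferInstance, inferInstance, hcomplete, ⟨e⟩, fun f g hf hg hfg t h0 h1 hatt => ?_⟩
  have hrep {φ : X →L[ℝ] ℝ} (hφ : φ ≠ 0) (h : ∃ x : X, ‖x‖ = 1 ∧ |φ x| = ‖φ‖) :=
    exists_eq_smul_gradient_of_attains e potential_zero potential_add_gradient_le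
      exists_potential_add_smul_le
      ((absorbent_ball_zero (by norm_num)).mono ball_subset_potential_le_one)
      convex_potential_le_one hnorm hφ h
  rw [LinearIndependent.pair_iff] at hfg
  obtain ⟨x, a, hx, ha, hfx⟩ := hrep (fun h => one_ne_zero (hfg 1 0 (by simp [h])).1) hf
  obtain ⟨y, b, hy, hb, hgy⟩ := hrep (fun h => one_ne_zero (hfg 0 1 (by simp [h])).2) hg
  obtain ⟨z, c, -, -, hz⟩ := hrep (fun h => h0.ne' (hfg t (1 - t) h).1) hatt
  have hx0 : x ≠ 0 := by
    rintro rfl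
    simp at hx
  obtain ⟨k, hk⟩ := exists_eq_smul_of_gradient_relation (A := t * a) (B := (1 - t) * b) (C := c)
    (x := e x) (y := e y) (z := e z) (mul_ne_zero h0.ne' ha)
    (mul_ne_zero (sub_pos.2 h1).ne' hb) (by simpa using hx0) (fun d => by
      have := hz (e.symm d)
      simp only [add_apply, smul_apply, smul_eq_mul, hfx, hgy, e.apply_symm_apply] at this
      linarith)
  rw [← map_smul, e.injective.eq_iff] at hk
  have hk1 : |k| = 1 := by
    rw [hk, norm_smul, hx, mul_one] at hy
    exact hy
  obtain ⟨s, hs⟩ : ∃ s : ℝ, ∀ d, gradient (e y) d = s * gradient (e x) d := by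
    rcases eq_or_eq_neg_of_abs_eq hk1 with rfl | rfl
    · exact ⟨1, fun d => by rw [hk, one_smul, one_mul]⟩
    · exact ⟨-1, fun d => by rw [hk, neg_one_smul, map_neg, gradient_neg, neg_one_mul]⟩
  refine ha (neg_eq_zero.1 (hfg (b * s) (-a) ?_).2)
  ext d
  simp only [add_apply, smul_apply, zero_apply, smul_eq_mul, hfx, hgy, hs]
  ring
end

section
/- There exists an infinite-dimensional real Banach space X such that every convex cone contained in NA(X,ℝ) is contained in a one-dimensional linear subspace of the dual space X*. -/
open scoped ZeroAtInfty Topology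
open Filter

namespace NormAttaining

theorem abs_apply_le_norm (x : C₀(ℕ, ℝ)) (n : ℕ) : |x n| ≤ ‖x‖ :=
  x.toBCF.norm_coe_le_norm n

theorem norm_le_of_abs_apply_le {x : C₀(ℕ, ℝ)} {c : ℝ} (hc : 0 ≤ c) (h : ∀ n, |x n| ≤ c) :
    ‖x‖ ≤ c :=
  (BoundedContinuousFunction.norm_le hc).2 h

theorem finite_setOf_le_abs (x : C₀(ℕ, ℝ)) {r : ℝ} (hr : 0 < r) : {n | r ≤ |x n|}.Finite := by
  have h := x.zero_at_infty'
  rw [cocompact_eq_cofinite] at h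
  have h2 := (h.norm.eventually (gt_mem_nhds (by simpa using hr)))
  refine (eventually_cofinite.1 h2).subset fun n hn => ?_
  simpa using hn

/-- The `n`-th unit vector of `c₀`. -/
noncomputable def unitVec (n : ℕ) : C₀(ℕ, ℝ) where
  toFun := Pi.single n 1
  continuous_toFun := continuous_of_discreteTopology
  zero_at_infty' := by
    rw [cocompact_eq_cofinite]
    refine tendsto_const_nhds.congr' ?_
    filter_upwards [(Set.finite_singleton n).compl_mem_cofinite] with k hk
    exact (Pi.single_eq_of_ne (M := fun _ => ℝ) hk _).symm

theorem unitVec_apply (n k : ℕ) : unitVec n k = Pi.single (M := fun _ => ℝ) n 1 k := rfl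

theorem summable_geometric_mul {y : ℕ → ℝ} {c : ℝ} (hy : ∀ n, |y n| ≤ c) (k : ℕ) :
    Summable fun n => (1 / 2 : ℝ) ^ ((n + 1) * (k + 1)) * y n := by
  refine Summable.of_norm_bounded (g := fun n => (1 / 2 : ℝ) ^ n * c)
    (summable_geometric_two.mul_right c) fun n => ?_
  rw [norm_mul, norm_pow, Real.norm_eq_abs (y n)]
  have h1 : ‖(1 / 2 : ℝ)‖ ^ ((n + 1) * (k + 1)) ≤ (1 / 2 : ℝ) ^ n := by
    rw [Real.norm_of_nonneg (by norm_num)]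
    exact pow_le_pow_of_le_one (by norm_num) (by norm_num) (by nlinarith)
  exact mul_le_mul h1 (hy n) (abs_nonneg _) (by positivity)

theorem abs_tsum_geometric_mul_le {y : ℕ → ℝ} {c : ℝ} (hy : ∀ n, |y n| ≤ c) (m k : ℕ) :
    |∑' n, (1 / 2 : ℝ) ^ ((n + m + 1) * (k + 1)) * y n| ≤
      (1 / 2 : ℝ) ^ ((m + 1) * (k + 1)) * (2 * c) := by
  have hs : HasSum (fun n => (1 / 2 : ℝ) ^ n * ((1 / 2 : ℝ) ^ ((m + 1) * (k + 1)) * c))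
      (2 * ((1 / 2 : ℝ) ^ ((m + 1) * (k + 1)) * c)) := hasSum_geometric_two.mul_right _
  have := tsum_of_norm_bounded (f := fun n => (1 / 2 : ℝ) ^ ((n + m + 1) * (k + 1)) * y n) hs
    fun n => ?_
  · rw [Real.norm_eq_abs] at this
    linarith
  · rw [norm_mul, Real.norm_eq_abs (y n), Real.norm_of_nonneg (by positivity), ← mul_assoc,
      ← pow_add]
    refine mul_le_mul ?_ (hy n) (abs_nonneg _) (by positivity)
    exact pow_le_pow_of_le_one (by norm_num) (by norm_num) (by nlinarith)

theorem eq_zero_of_tsum_geometric_mul {y : ℕ → ℝ} {c : ℝ} (hy : ∀ n, |y n| ≤ c) (N : ℕ)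
    (h : ∀ k, N ≤ k → ∑' n, (1 / 2 : ℝ) ^ ((n + 1) * (k + 1)) * y n = 0) : y = 0 := by
  funext m
  induction m using Nat.strong_induction_on with
  | _ m ih =>
  have hb : ∀ k, N ≤ k → |y m| ≤ (1 / 2 : ℝ) ^ k * c := by
    intro k hk
    have h1 := (summable_geometric_mul hy k).sum_add_tsum_nat_add (m + 1)
    rw [h k hk, Finset.sum_range_succ, Finset.sum_eq_zero, zero_add] at h1
    · have h2 := abs_tsum_geometric_mul_le (fun n => hy (n + (m + 1))) (m + 1) k
      rw [← neg_eq_of_add_eq_zero_right h1, abs_neg, abs_mul, abs_of_nonneg (by positivity),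
        show (m + 1 + 1) * (k + 1) = (m + 1) * (k + 1) + (k + 1) by ring, pow_add, mul_assoc] at h2
      have h3 := le_of_mul_le_mul_left h2 (by positivity)
      rw [pow_succ] at h3
      linarith
    · intro n hn
      rw [ih n (Finset.mem_range.1 hn)]
      simp
  have hl : Tendsto (fun k => (1 / 2 : ℝ) ^ k * c) atTop (𝓝 0) := by
    simpa using (tendsto_pow_atTop_nhds_zero_of_lt_one (r := (1 / 2 : ℝ)) (by norm_num)
      (by norm_num)).mul_const c
  have := ge_of_tendsto hl (eventually_atTop.2 ⟨N, hb⟩)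
  exact abs_eq_zero.1 (le_antisymm this (abs_nonneg _))

/-- The Hilbert space `ℓ²`. -/
abbrev Hilb := lp (fun _ : ℕ => ℝ) 2

theorem abs_smoothing_le (x : C₀(ℕ, ℝ)) (k : ℕ) :
    |∑' n, (1 / 2 : ℝ) ^ ((n + 1) * (k + 1)) * x n| ≤ (1 / 2 : ℝ) ^ k * ‖x‖ := by
  have := abs_tsum_geometric_mul_le (abs_apply_le_norm x) 0 k
  simp only [add_zero, zero_add, one_mul, pow_succ] at this ⊢
  linarith

theorem hasSum_smoothing_bound (x : C₀(ℕ, ℝ)) :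
    HasSum (fun k : ℕ => ((1 / 2 : ℝ) ^ k * ‖x‖) ^ 2) (4 / 3 * ‖x‖ ^ 2) := by
  have := (hasSum_geometric_of_lt_one (r := (1 / 4 : ℝ)) (by norm_num) (by norm_num)).mul_right
    (‖x‖ ^ 2)
  rw [show (4 / 3 : ℝ) = (1 - 1 / 4)⁻¹ by norm_num]
  convert! this using 2 with k
  rw [mul_pow, ← pow_mul, mul_comm k, pow_mul]
  norm_num

theorem summable_smoothing (x : C₀(ℕ, ℝ)) :
    Summable fun k : ℕ => |∑' n, (1 / 2 : ℝ) ^ ((n + 1) * (k + 1)) * x n| ^ 2 :=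
  Summable.of_nonneg_of_le (fun k => by positivity)
    (fun k => pow_le_pow_left₀ (abs_nonneg _) (abs_smoothing_le x k) 2)
    (hasSum_smoothing_bound x).summable

/-- An injective operator `c₀ → ℓ²` with matrix `2 ^ (-(n + 1) (k + 1))`. -/
noncomputable def smoothing : C₀(ℕ, ℝ) →L[ℝ] Hilb :=
  LinearMap.mkContinuous
    { toFun := fun x => ⟨fun k => ∑' n, (1 / 2 : ℝ) ^ ((n + 1) * (k + 1)) * x n,
        memℓp_gen (by simpa using summable_smoothing x)⟩
      map_add' := fun x y => by
        ext k
        simp only [ZeroAtInftyContinuousMap.coe_add, Pi.add_apply, mul_add (_ ^ _), lp.coeFn_add]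
        exact (summable_geometric_mul (abs_apply_le_norm x) k).tsum_add
          (summable_geometric_mul (abs_apply_le_norm y) k)
      map_smul' := fun c x => by
        ext k
        simp only [ZeroAtInftyContinuousMap.coe_smul, Pi.smul_apply, lp.coeFn_smul, smul_eq_mul,
          RingHom.id_apply, ← tsum_mul_left, mul_left_comm] }
    2 fun x => by
      refine lp.norm_le_of_tsum_le (by simp) (by positivity) ?_
      simp only [LinearMap.coe_mk, AddHom.coe_mk, ENNReal.toReal_ofNat, Real.rpow_ofNat,
        Real.norm_eq_abs]
      refine ((summable_smoothing x).tsum_le_tsum (fun k => pow_le_pow_left₀ (abs_nonneg _)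
        (abs_smoothing_le x k) 2) (hasSum_smoothing_bound x).summable).trans ?_
      rw [(hasSum_smoothing_bound x).tsum_eq]
      nlinarith [sq_nonneg ‖x‖]

theorem smoothing_apply (x : C₀(ℕ, ℝ)) (k : ℕ) :
    smoothing x k = ∑' n, (1 / 2 : ℝ) ^ ((n + 1) * (k + 1)) * x n := rfl

theorem smoothing_injective : Function.Injective smoothing := by
  rw [injective_iff_map_eq_zero]
  intro x hx
  have := eq_zero_of_tsum_geometric_mul (abs_apply_le_norm x) 0 fun k _ => by
    rw [← smoothing_apply, hx]
    rfl
  ext n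
  exact congrFun this n

theorem smoothing_unitVec (n k : ℕ) :
    smoothing (unitVec n) k = (1 / 2 : ℝ) ^ ((n + 1) * (k + 1)) := by
  rw [smoothing_apply, tsum_eq_single n fun m hm => by simp [unitVec_apply, hm]]
  simp [unitVec_apply]

theorem eq_zero_of_inner_smoothing_unitVec {v : Hilb} (N : ℕ)
    (h : ∀ n, N ≤ n → inner ℝ v (smoothing (unitVec n)) = 0) : v = 0 := by
  have := eq_zero_of_tsum_geometric_mul
    (fun n => (lp.norm_apply_le_norm (by simp) v n : |v n| ≤ ‖v‖)) N fun k hk => by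
      rw [← h k hk, lp.inner_eq_tsum]
      refine tsum_congr fun n => ?_
      rw [smoothing_unitVec, mul_comm (k + 1)]
      simp
  ext n
  exact congrFun this n

/-- The pairing of a finitely supported sequence with `c₀`. -/
noncomputable def pairing (a : ℕ →₀ ℝ) : C₀(ℕ, ℝ) →ₗ[ℝ] ℝ where
  toFun x := ∑ n ∈ a.support, a n * x n
  map_add' x y := by simp [mul_add, Finset.sum_add_distrib]
  map_smul' c x := by simp [Finset.mul_sum, mul_left_comm]

theorem pairing_eq_sum {a : ℕ →₀ ℝ} {s : Finset ℕ} (h : ∀ n, n ∉ s → a n = 0) (x : C₀(ℕ, ℝ)) :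
    pairing a x = ∑ n ∈ s, a n * x n :=
  Finset.sum_subset (fun n hn => by_contra fun hs => Finsupp.mem_support_iff.1 hn (h n hs))
    fun n _ hn => by simp [Finsupp.notMem_support_iff.1 hn]

theorem pairing_unitVec (a : ℕ →₀ ℝ) (n : ℕ) : pairing a (unitVec n) = a n := by
  rw [pairing_eq_sum (s := insert n a.support) (by simp_all), Finset.sum_eq_single n]
  · simp [unitVec_apply]
  · intro m _ hm
    simp [unitVec_apply, hm]
  · simp

/-- The norm `‖a‖₁ + ‖a‖₂` of a finitely supported sequence. -/
noncomputable def dualNorm (a : ℕ →₀ ℝ) : ℝ :=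
  ∑ n ∈ a.support, |a n| + √(∑ n ∈ a.support, a n ^ 2)

theorem dualNorm_eq_sum {a : ℕ →₀ ℝ} {s : Finset ℕ} (h : ∀ n, n ∉ s → a n = 0) :
    dualNorm a = ∑ n ∈ s, |a n| + √(∑ n ∈ s, a n ^ 2) := by
  have hs : a.support ⊆ s := fun n hn => by_contra fun hs => Finsupp.mem_support_iff.1 hn (h n hs)
  rw [dualNorm, Finset.sum_subset hs, Finset.sum_subset hs] <;> simp

/-- The norm on `c₀` whose dual norm is `‖a‖₁ + ‖a‖₂`. -/
noncomputable def smoothSup : Seminorm ℝ C₀(ℕ, ℝ) :=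
  ⨆ a : {a : ℕ →₀ ℝ // dualNorm a ≤ 1}, (normSeminorm ℝ ℝ).comp (pairing a)

theorem abs_pairing_le_of_decomposition {a : ℕ →₀ ℝ} (ha : dualNorm a ≤ 1) {y : C₀(ℕ, ℝ)}
    {w : ℕ → ℝ} {G : Finset ℕ} {r : ℝ} (hr : 0 ≤ r) (hG : ∀ n, n ∉ G → w n = 0)
    (hy : ∀ n, |y n - w n| ≤ r) (hw : ∑ n ∈ G, w n ^ 2 ≤ r ^ 2) : |pairing a y| ≤ r := by
  have ha0 : ∀ n, n ∉ a.support ∪ G → a n = 0 := by simp_all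
  rw [dualNorm_eq_sum ha0] at ha
  rw [pairing_eq_sum ha0]
  have hsub : ∑ n ∈ a.support ∪ G, w n ^ 2 = ∑ n ∈ G, w n ^ 2 :=
    (Finset.sum_subset Finset.subset_union_right fun n _ hn => by simp [hG n hn]).symm
  have h1 : |∑ n ∈ a.support ∪ G, a n * (y n - w n)| ≤ (∑ n ∈ a.support ∪ G, |a n|) * r := by
    rw [Finset.sum_mul]
    refine (Finset.abs_sum_le_sum_abs _ _).trans (Finset.sum_le_sum fun n _ => ?_)
    rw [abs_mul]
    exact mul_le_mul_of_nonneg_left (hy n) (abs_nonneg _)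
  have h2 : |∑ n ∈ a.support ∪ G, a n * w n| ≤ √(∑ n ∈ a.support ∪ G, a n ^ 2) * r := by
    refine (Finset.abs_sum_le_sum_abs _ _).trans ?_
    simp only [abs_mul]
    refine (Real.sum_mul_le_sqrt_mul_sqrt _ _ _).trans ?_
    simp only [sq_abs, hsub]
    gcongr
    exact Real.sqrt_le_iff.2 ⟨hr, hw⟩
  have h3 : ∑ n ∈ a.support ∪ G, a n * y n =
      ∑ n ∈ a.support ∪ G, a n * (y n - w n) + ∑ n ∈ a.support ∪ G, a n * w n := by
    rw [← Finset.sum_add_distrib]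
    exact Finset.sum_congr rfl fun n _ => by ring
  rw [h3]
  refine (abs_add_le _ _).trans ?_
  nlinarith

theorem abs_pairing_le_norm {a : ℕ →₀ ℝ} (ha : dualNorm a ≤ 1) (x : C₀(ℕ, ℝ)) :
    |pairing a x| ≤ ‖x‖ :=
  abs_pairing_le_of_decomposition (w := 0) (G := ∅) ha (norm_nonneg x) (by simp)
    (by simpa using abs_apply_le_norm x) (by simp)

theorem smoothSup_apply (x : C₀(ℕ, ℝ)) :
    smoothSup x = ⨆ a : {a : ℕ →₀ ℝ // dualNorm a ≤ 1}, |pairing a x| := by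
  refine Seminorm.iSup_apply ⟨normSeminorm ℝ _, ?_⟩
  rintro _ ⟨a, rfl⟩
  exact fun x => abs_pairing_le_norm a.2 x

theorem abs_pairing_le_smoothSup {a : ℕ →₀ ℝ} (ha : dualNorm a ≤ 1) (x : C₀(ℕ, ℝ)) :
    |pairing a x| ≤ smoothSup x := by
  rw [smoothSup_apply]
  refine le_ciSup (f := fun a : {a : ℕ →₀ ℝ // dualNorm a ≤ 1} => |pairing a x|)
    ⟨‖x‖, ?_⟩ ⟨a, ha⟩
  rintro _ ⟨a, rfl⟩
  exact abs_pairing_le_norm a.2 x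

theorem smoothSup_le {x : C₀(ℕ, ℝ)} {r : ℝ}
    (h : ∀ a : ℕ →₀ ℝ, dualNorm a ≤ 1 → |pairing a x| ≤ r) : smoothSup x ≤ r := by
  rw [smoothSup_apply]
  have : Nonempty {a : ℕ →₀ ℝ // dualNorm a ≤ 1} := ⟨0, by simp [dualNorm]⟩
  exact ciSup_le fun a => h a a.2

theorem norm_le_two_mul_smoothSup (x : C₀(ℕ, ℝ)) : ‖x‖ ≤ 2 * smoothSup x := by
  refine norm_le_of_abs_apply_le (by have := apply_nonneg smoothSup x; positivity) fun n => ?_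
  have ha : ∀ m, m ∉ ({n} : Finset ℕ) → Finsupp.single n (1 / 2 : ℝ) m = 0 := by
    intro m hm
    rw [Finsupp.single_eq_of_ne (by simpa using hm)]
  have h1 : dualNorm (Finsupp.single n (1 / 2 : ℝ)) ≤ 1 := by
    rw [dualNorm_eq_sum ha]
    simp only [Finset.sum_singleton, Finsupp.single_eq_same, Real.sqrt_sq_eq_abs]
    rw [abs_of_nonneg] <;> norm_num
  have h2 := abs_pairing_le_smoothSup h1 x
  rw [pairing_eq_sum ha] at h2
  simp only [Finset.sum_singleton, Finsupp.single_eq_same, abs_mul] at h2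
  rw [abs_of_nonneg (by norm_num)] at h2
  linarith

theorem exists_truncation_radius {x : C₀(ℕ, ℝ)} (hx : x ≠ 0) :
    ∃ (r : ℝ) (G : Finset ℕ), 0 < r ∧ (∀ n, n ∈ G ↔ r ≤ |x n|) ∧
      ∑ n ∈ G, (|x n| - r) ^ 2 = r ^ 2 := by
  obtain ⟨m, hm⟩ : ∃ m, x m ≠ 0 := by
    by_contra! h
    exact hx (ZeroAtInftyContinuousMap.ext h)
  have hm0 : 0 < |x m| := abs_pos.2 hm
  have hfin := finite_setOf_le_abs x (half_pos hm0)
  have hcont : ContinuousOn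
      (fun r : ℝ => ∑ n ∈ hfin.toFinset, (max (|x n| - r) 0) ^ 2 - r ^ 2)
      (Set.Icc (|x m| / 2) ‖x‖) := by fun_prop
  have hle := abs_apply_le_norm x m
  obtain ⟨r, hr, hr0⟩ := intermediate_value_Icc' (by linarith) hcont
    (show (0 : ℝ) ∈ _ by
      constructor
      · rw [Finset.sum_eq_zero]
        · nlinarith
        · intro n _
          rw [max_eq_right (by linarith [abs_apply_le_norm x n])]
          simp
      · have := Finset.single_le_sum (f := fun n => (max (|x n| - |x m| / 2) 0) ^ 2)
          (fun n _ => sq_nonneg _) (show m ∈ hfin.toFinset by simp)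
        have h2 := le_max_left (|x m| - |x m| / 2) 0
        nlinarith)
  have hrpos : 0 < r := by linarith [hr.1]
  refine ⟨r, (finite_setOf_le_abs x hrpos).toFinset, hrpos, by simp, ?_⟩
  simp only at hr0
  rw [← sub_eq_zero.1 hr0]
  have hsub : (finite_setOf_le_abs x hrpos).toFinset ⊆ hfin.toFinset := by
    intro n
    simp only [Set.Finite.mem_toFinset, Set.mem_ofPred_eq]
    exact hr.1.trans
  rw [← Finset.sum_subset hsub]
  · refine Finset.sum_congr rfl fun n hn => ?_
    rw [max_eq_left]
    simpa using hn
  · intro n _ hn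
    rw [max_eq_right]
    · simp
    · simp only [Set.Finite.mem_toFinset, Set.mem_ofPred_eq, not_le] at hn
      linarith

theorem exists_smoothSup_subgradient {x : C₀(ℕ, ℝ)} (hx : x ≠ 0) :
    ∃ a : ℕ →₀ ℝ, dualNorm a = 1 ∧ ∀ h : C₀(ℕ, ℝ), ∃ C : ℝ, ∀ᶠ t : ℝ in 𝓝 0,
      smoothSup (x + t • h) ≤ pairing a (x + t • h) + C * t ^ 2 := by
  obtain ⟨r, G, hr, hG, hsum⟩ := exists_truncation_radius hx
  set σ : ℝ := ∑ n ∈ G, (|x n| - r) with hσ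
  have hσ0 : 0 ≤ σ := Finset.sum_nonneg fun n hn => sub_nonneg.2 ((hG n).1 hn)
  have hd : 0 < σ + r := by linarith
  set ε : ℕ → ℝ := fun n => SignType.sign (x n) with hε
  have hεabs : ∀ n, ε n * |x n| = x n := fun n => sign_mul_abs _
  have hε1 : ∀ n ∈ G, ε n ^ 2 = 1 := by
    intro n hn
    have h0 : x n ≠ 0 := abs_pos.1 (hr.trans_le ((hG n).1 hn))
    rcases h0.lt_or_gt with h | h <;> simp [hε, h]
  have hεa : ∀ n ∈ G, |ε n| = 1 := fun n hn => by
    have := hε1 n hn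
    rwa [← sq_abs, pow_eq_one_iff_of_nonneg (abs_nonneg _) two_ne_zero] at this
  classical
  set a : ℕ →₀ ℝ := Finsupp.onFinset G
    (fun n => if n ∈ G then ε n * (|x n| - r) / (σ + r) else 0) (by simp_all) with ha
  have haG : ∀ n ∈ G, a n = ε n * (|x n| - r) / (σ + r) := fun n hn => by simp [ha, hn]
  have ha0 : ∀ n, n ∉ G → a n = 0 := fun n hn => by simp [ha, hn]
  refine ⟨a, ?_, fun h => ?_⟩
  · have h1 : ∑ n ∈ G, |a n| = σ / (σ + r) := by
      rw [hσ, Finset.sum_div]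
      refine Finset.sum_congr rfl fun n hn => ?_
      rw [haG n hn, abs_div, abs_mul, hεa n hn, one_mul, abs_of_pos hd,
        abs_of_nonneg (sub_nonneg.2 ((hG n).1 hn))]
    have h2 : ∑ n ∈ G, a n ^ 2 = (r / (σ + r)) ^ 2 := by
      rw [div_pow, ← hsum, Finset.sum_div]
      refine Finset.sum_congr rfl fun n hn => ?_
      rw [haG n hn, div_pow, mul_pow, hε1 n hn, one_mul]
    rw [dualNorm_eq_sum ha0, h1, h2, Real.sqrt_sq (by positivity), ← add_div, div_self hd.ne']
  · have hax : pairing a x = r := by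
      rw [pairing_eq_sum ha0]
      have : ∀ n ∈ G, a n * x n = ((|x n| - r) ^ 2 + r * (|x n| - r)) / (σ + r) := by
        intro n hn
        rw [haG n hn]
        nth_rw 2 [← hεabs n]
        linear_combination (|x n| - r) * |x n| / (σ + r) * hε1 n hn
      rw [Finset.sum_congr rfl this, ← Finset.sum_div, Finset.sum_add_distrib, ← Finset.mul_sum,
        hsum, ← hσ]
      field_simp
      ring
    set δ := pairing a h with hδ
    have hδG : ∑ n ∈ G, ε n * (|x n| - r) * h n = δ * (σ + r) := by
      rw [hδ, pairing_eq_sum ha0, Finset.sum_mul]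
      refine Finset.sum_congr rfl fun n hn => ?_
      rw [haG n hn]
      field_simp
    set K := ∑ n ∈ G, (h n - ε n * δ) ^ 2 with hK
    have hK0 : 0 ≤ K := Finset.sum_nonneg fun n _ => sq_nonneg _
    have hlin : Tendsto (fun t : ℝ => r + t * δ) (𝓝 0) (𝓝 r) := by
      have : Continuous fun t : ℝ => r + t * δ := by fun_prop
      simpa using this.tendsto 0
    have hpt : ∀ n, Tendsto (fun t : ℝ => |x n + t * h n|) (𝓝 0) (𝓝 |x n|) := fun n => by
      have : Continuous fun t : ℝ => |x n + t * h n| := by fun_prop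
      simpa using this.tendsto 0
    have hout : Tendsto (fun t : ℝ => r / 2 + |t| * ‖h‖) (𝓝 0) (𝓝 (r / 2)) := by
      have : Continuous fun t : ℝ => r / 2 + |t| * ‖h‖ := by fun_prop
      simpa using this.tendsto 0
    have hfin := finite_setOf_le_abs x (half_pos hr)
    have hmid : ∀ᶠ t : ℝ in 𝓝 0, ∀ n ∈ hfin.toFinset, n ∉ G → |x n + t * h n| ≤ r + t * δ := by
      rw [Filter.eventually_all_finset]
      intro n _
      by_cases hn : n ∈ G
      · simp [hn]
      · have hlt : |x n| < r := not_le.1 fun h => hn ((hG n).2 h)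
        filter_upwards [(hpt n).eventually_lt hlin hlt] with t ht _ using ht.le
    refine ⟨K / r, ?_⟩
    filter_upwards [hmid, hout.eventually_lt hlin (by linarith),
      hlin.eventually (lt_mem_nhds (half_lt_self hr))] with t ht1 ht2 ht3
    have hval : pairing a (x + t • h) = r + t * δ := by
      rw [map_add, map_smul, hax, smul_eq_mul]
    rw [hval]
    have hnn : 0 ≤ K / r * t ^ 2 := by positivity
    refine smoothSup_le fun b hb => abs_pairing_le_of_decomposition hb (by linarith) (G := G)
      (w := fun n => if n ∈ G then ε n * (|x n| - r) + t * (h n - ε n * δ) else 0)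
      (by simp_all) (fun n => ?_) ?_
    · have hxn : (x + t • h) n = x n + t * h n := by simp
      rw [hxn]
      by_cases hn : n ∈ G
      · have : x n + t * h n - (ε n * (|x n| - r) + t * (h n - ε n * δ)) = ε n * (r + t * δ) := by
          linear_combination - hεabs n
        simp only [hn, if_true]
        rw [this, abs_mul, hεa n hn, one_mul, abs_of_pos (by linarith)]
        linarith
      · simp only [hn, if_false, sub_zero]
        by_cases hn2 : n ∈ hfin.toFinset
        · linarith [ht1 n hn2 hn]
        · simp only [Set.Finite.mem_toFinset, Set.mem_ofPred_eq, not_le] at hn2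
          have h1 := abs_add_le (x n) (t * h n)
          rw [abs_mul] at h1
          have h2 := mul_le_mul_of_nonneg_left (abs_apply_le_norm h n) (abs_nonneg t)
          linarith
    · have hterm : ∀ n ∈ G,
          (if n ∈ G then ε n * (|x n| - r) + t * (h n - ε n * δ) else 0) ^ 2 =
            (|x n| - r) ^ 2 + 2 * t * (ε n * (|x n| - r) * h n) - 2 * t * δ * (|x n| - r) +
              t ^ 2 * (h n - ε n * δ) ^ 2 := by
        intro n hn
        rw [if_pos hn]
        linear_combination ((|x n| - r) ^ 2 - 2 * t * δ * (|x n| - r)) * hε1 n hn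
      rw [Finset.sum_congr rfl hterm, Finset.sum_add_distrib, Finset.sum_sub_distrib,
        Finset.sum_add_distrib, ← Finset.mul_sum, ← Finset.mul_sum, ← Finset.mul_sum, hsum, hδG,
        ← hσ, ← hK]
      have hKr : K / r * t ^ 2 * r = K * t ^ 2 := by field_simp
      nlinarith [sq_nonneg (t * δ), sq_nonneg (K / r * t ^ 2), mul_nonneg hnn (by linarith :
        0 ≤ r + t * δ - r / 2)]

theorem quartic_coeff_eq_zero {c₀ c₁ c₂ c₃ c₄ : ℝ}
    (h : ∀ u : ℝ, 0 ≤ u → c₀ + c₁ * u + c₂ * u ^ 2 + c₃ * u ^ 3 + c₄ * u ^ 4 = 0) :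
    c₀ = 0 ∧ c₁ = 0 ∧ c₂ = 0 ∧ c₃ = 0 ∧ c₄ = 0 := by
  have h0 := h 0 (by norm_num)
  have h1 := h 1 (by norm_num)
  have h2 := h 2 (by norm_num)
  have h3 := h 3 (by norm_num)
  have h4 := h 4 (by norm_num)
  norm_num at h0 h1 h2 h3 h4
  refine ⟨?_, ?_, ?_, ?_, ?_⟩ <;> linarith

theorem sq_eq_mul_of_sq_linear_mul_eq_sq {p q a b c α β γ : ℝ} (hq : q ≠ 0)
    (h : ∀ u : ℝ, 0 ≤ u → 4 * (p + q * u) ^ 2 * (a * u ^ 2 + 2 * b * u + c) =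
      (α * u ^ 2 + β * u + γ) ^ 2) : b ^ 2 = a * c := by
  obtain ⟨e, rfl⟩ : ∃ e, α = q * e := ⟨α / q, by field_simp⟩
  obtain ⟨g, rfl⟩ : ∃ g, β = p * e + q * g := ⟨(β - p * e) / q, by field_simp; ring⟩
  obtain ⟨h0, h1, h2, h3, h4⟩ := quartic_coeff_eq_zero
    (c₀ := 4 * p ^ 2 * c - γ ^ 2)
    (c₁ := 8 * p * q * c + 8 * p ^ 2 * b - 2 * (p * e + q * g) * γ)
    (c₂ := 4 * q ^ 2 * c + 16 * p * q * b + 4 * p ^ 2 * a - (p * e + q * g) ^ 2 - 2 * q * e * γ)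
    (c₃ := 8 * q ^ 2 * b + 8 * p * q * a - 2 * (q * e) * (p * e + q * g))
    (c₄ := 4 * q ^ 2 * a - (q * e) ^ 2)
    fun u hu => by linear_combination h u hu
  have ha : 4 * a = e ^ 2 := mul_left_cancel₀ (pow_ne_zero 2 hq) (by linear_combination h4)
  have hb : 4 * b = e * g := mul_left_cancel₀ (pow_ne_zero 2 hq)
    (by linear_combination h3 / 2 - p * q * ha)
  have hγ : γ = p * g := by
    have h5 : (q ^ 2 * (γ - p * g)) ^ 2 = 0 := by
      linear_combination (-q ^ 4) * h0 + p * q ^ 3 * h1 - p ^ 2 * q ^ 2 * h2 + p ^ 3 * q * h3 -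
        p ^ 4 * h4
    have h6 := pow_eq_zero_iff two_ne_zero |>.1 h5
    exact sub_eq_zero.1 ((mul_eq_zero.1 h6).resolve_left (pow_ne_zero 2 hq))
  have hc : 4 * c = g ^ 2 := mul_left_cancel₀ (pow_ne_zero 2 hq)
    (by rw [hγ] at h2; linear_combination h2 - 4 * p * q * hb - p ^ 2 * ha)
  linear_combination (4 * b + e * g) / 16 * hb - c / 4 * ha - e ^ 2 / 16 * hc

theorem exists_eq_smul_of_inner_sq_eq {v w : Hilb} (hw : w ≠ 0)
    (h : inner ℝ v w ^ 2 = ‖w‖ ^ 2 * ‖v‖ ^ 2) : ∃ c : ℝ, v = c • w := by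
  have hw' : ‖w‖ ^ 2 ≠ 0 := by simpa using hw
  refine ⟨inner ℝ v w / ‖w‖ ^ 2, ?_⟩
  rw [← sub_eq_zero, ← norm_eq_zero, ← sq_eq_zero_iff, norm_sub_sq_real, norm_smul, mul_pow,
    inner_smul_right, Real.norm_eq_abs, sq_abs]
  field_simp
  linarith

theorem eventually_abs_add_mul_eq (α β : ℝ) :
    ∀ᶠ T : ℝ in atTop, ∀ u : ℝ, 0 ≤ u → |α + (T + u) * β| = |α + T * β| + u * |β| := by
  rcases eq_or_ne β 0 with rfl | hβ
  · simp
  filter_upwards [eventually_ge_atTop (|α| / |β|)] with T hT u hu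
  rw [div_le_iff₀ (abs_pos.2 hβ)] at hT
  have h1 := neg_abs_le α
  have h2 := le_abs_self α
  rcases hβ.lt_or_gt with h | h
  · rw [abs_of_neg h] at hT ⊢
    have h3 := mul_nonneg hu (neg_pos.2 h).le
    rw [abs_of_nonpos (by linarith), abs_of_nonpos (by linarith)]
    ring
  · rw [abs_of_pos h] at hT ⊢
    have h3 := mul_nonneg hu h.le
    rw [abs_of_nonneg (by linarith), abs_of_nonneg (by linarith)]
    ring

theorem exists_eq_smul_of_dualNorm_eq {a b : ℕ →₀ ℝ} {v w : Hilb} (hb : b ≠ 0) (hw : w ≠ 0)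
    (h : ∀ t : ℝ, 0 ≤ t → dualNorm (a + t • b) = ‖v + t • w‖) : ∃ c : ℝ, v = c • w := by
  obtain ⟨T, hT0, hT⟩ := ((eventually_ge_atTop (0 : ℝ)).and
    ((Filter.eventually_all_finset (a.support ∪ b.support)).2
      fun n _ => eventually_abs_add_mul_eq (a n) (b n))).exists
  set s := a.support ∪ b.support with hs
  have hsum : ∀ t : ℝ, dualNorm (a + t • b) =
      ∑ n ∈ s, |a n + t * b n| + √(∑ n ∈ s, (a n + t * b n) ^ 2) := by
    intro t
    rw [dualNorm_eq_sum (s := s)] <;> simp_all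
  have hq : ∑ n ∈ s, |b n| ≠ 0 := by
    obtain ⟨n, hn⟩ := Finsupp.ne_iff.1 hb
    refine (Finset.sum_pos' (fun _ _ => abs_nonneg _) ⟨n, ?_, abs_pos.2 hn⟩).ne'
    simp_all
  have key := sq_eq_mul_of_sq_linear_mul_eq_sq (p := ∑ n ∈ s, |a n + T * b n|)
    (a := ‖w‖ ^ 2) (b := inner ℝ (v + T • w) w) (c := ‖v + T • w‖ ^ 2)
    (α := (∑ n ∈ s, |b n|) ^ 2 + ‖w‖ ^ 2 - ∑ n ∈ s, b n ^ 2)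
    (β := 2 * (∑ n ∈ s, |a n + T * b n|) * (∑ n ∈ s, |b n|) + 2 * inner ℝ (v + T • w) w
      - 2 * ∑ n ∈ s, (a n + T * b n) * b n)
    (γ := (∑ n ∈ s, |a n + T * b n|) ^ 2 + ‖v + T • w‖ ^ 2 - ∑ n ∈ s, (a n + T * b n) ^ 2) hq
    fun u hu => by
      have h1 := h (T + u) (by linarith)
      rw [hsum, Finset.sum_congr rfl fun n hn => hT n hn u hu, Finset.sum_add_distrib,
        ← Finset.mul_sum] at h1
      have h2 : ‖v + (T + u) • w‖ ^ 2 =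
          ‖w‖ ^ 2 * u ^ 2 + 2 * inner ℝ (v + T • w) w * u + ‖v + T • w‖ ^ 2 := by
        rw [add_smul, ← add_assoc, norm_add_sq_real, inner_smul_right, norm_smul, mul_pow,
          Real.norm_eq_abs, sq_abs]
        ring
      have h3 : √(∑ n ∈ s, (a n + (T + u) * b n) ^ 2) ^ 2 = (∑ n ∈ s, b n ^ 2) * u ^ 2 +
          2 * (∑ n ∈ s, (a n + T * b n) * b n) * u + ∑ n ∈ s, (a n + T * b n) ^ 2 := by
        rw [Real.sq_sqrt (Finset.sum_nonneg fun _ _ => sq_nonneg _), Finset.sum_mul,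
          Finset.mul_sum, Finset.sum_mul, ← Finset.sum_add_distrib, ← Finset.sum_add_distrib]
        exact Finset.sum_congr rfl fun n _ => by ring
      have h4 : 2 * (∑ n ∈ s, |a n + T * b n| + (∑ n ∈ s, |b n|) * u) * ‖v + (T + u) • w‖ =
          (∑ n ∈ s, |a n + T * b n| + (∑ n ∈ s, |b n|) * u) ^ 2 + ‖v + (T + u) • w‖ ^ 2 -
            √(∑ n ∈ s, (a n + (T + u) * b n) ^ 2) ^ 2 := by
        rw [← h1]
        ring
      rw [← h2, show ∀ x y : ℝ, 4 * x ^ 2 * y ^ 2 = (2 * x * y) ^ 2 from fun x y => by ring, h4,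
        h2, h3]
      ring
  obtain ⟨c, hc⟩ := exists_eq_smul_of_inner_sq_eq hw key
  exact ⟨c - T, by rw [sub_smul, ← hc, add_sub_cancel_right]⟩

theorem eventually_norm_add_smul_le {u : Hilb} (hu : u ≠ 0) (v : Hilb) :
    ∃ C : ℝ, ∀ᶠ t : ℝ in 𝓝 0,
      ‖u + t • v‖ ≤ inner ℝ (‖u‖⁻¹ • u) (u + t • v) + C * t ^ 2 := by
  have hu0 : 0 < ‖u‖ := norm_pos_iff.2 hu
  set β := inner ℝ u v / ‖u‖ with hβ
  have hlin : Tendsto (fun t : ℝ => ‖u‖ + t * β) (𝓝 0) (𝓝 ‖u‖) := by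
    have : Continuous fun t : ℝ => ‖u‖ + t * β := by fun_prop
    simpa using this.tendsto 0
  refine ⟨‖v‖ ^ 2 / ‖u‖, ?_⟩
  filter_upwards [hlin.eventually (lt_mem_nhds (half_lt_self hu0))] with t ht
  have h1 : inner ℝ (‖u‖⁻¹ • u) (u + t • v) = ‖u‖ + t * β := by
    rw [inner_smul_left, inner_add_right, inner_smul_right, real_inner_self_eq_norm_sq, hβ]
    simp only [map_inv₀, conj_trivial]
    field_simp
  have hnn : 0 ≤ ‖v‖ ^ 2 / ‖u‖ * t ^ 2 := by positivity
  rw [h1]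
  refine le_of_sq_le_sq ?_ (by linarith)
  have h2 : ‖v‖ ^ 2 / ‖u‖ * t ^ 2 * ‖u‖ = ‖v‖ ^ 2 * t ^ 2 := by field_simp
  have h3 : β * ‖u‖ = inner ℝ u v := by rw [hβ]; field_simp
  rw [norm_add_sq_real, inner_smul_right, norm_smul, mul_pow, Real.norm_eq_abs, sq_abs, ← h3]
  nlinarith [sq_nonneg (t * β), sq_nonneg (‖v‖ ^ 2 / ‖u‖ * t ^ 2), mul_nonneg hnn (by linarith :
    0 ≤ ‖u‖ + t * β - ‖u‖ / 2)]

theorem eq_zero_of_eventually_mul_le_sq {d C : ℝ} (h : ∀ᶠ t : ℝ in 𝓝 0, t * d ≤ C * t ^ 2) :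
    d = 0 := by
  have hl : Tendsto (fun t : ℝ => C * t) (𝓝 0) (𝓝 0) := by
    have : Continuous fun t : ℝ => C * t := by fun_prop
    simpa using this.tendsto 0
  apply le_antisymm
  · refine ge_of_tendsto (hl.mono_left (nhdsWithin_le_nhds (s := Set.Ioi 0))) ?_
    filter_upwards [h.filter_mono nhdsWithin_le_nhds, self_mem_nhdsWithin] with t ht ht0
    exact le_of_mul_le_mul_left (by linarith) (Set.mem_Ioi.1 ht0)
  · refine le_of_tendsto (hl.mono_left (nhdsWithin_le_nhds (s := Set.Iio 0))) ?_
    filter_upwards [h.filter_mono nhdsWithin_le_nhds, self_mem_nhdsWithin] with t ht ht0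
    exact le_of_mul_le_mul_left (a := -t) (by linarith) (neg_pos.2 (Set.mem_Iio.1 ht0))

/-- The equivalent norm on `c₀` with few norm-attaining functionals. -/
noncomputable def newNorm : Seminorm ℝ C₀(ℕ, ℝ) :=
  smoothSup + (normSeminorm ℝ Hilb).comp smoothing.toLinearMap

theorem newNorm_apply (x : C₀(ℕ, ℝ)) : newNorm x = smoothSup x + ‖smoothing x‖ := rfl

theorem exists_gradient {x : C₀(ℕ, ℝ)} (hx : x ≠ 0) :
    ∃ a : ℕ →₀ ℝ, dualNorm a = 1 ∧ ∀ (φ : C₀(ℕ, ℝ) →ₗ[ℝ] ℝ) (c : ℝ), 0 ≤ c →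
      (∀ y, φ y ≤ c * newNorm y) → φ x = c * newNorm x → ∀ h, φ h =
        c * (pairing a h + inner ℝ (‖smoothing x‖⁻¹ • smoothing x) (smoothing h)) := by
  have hSx : smoothing x ≠ 0 := fun h => hx (smoothing_injective (by rw [h, map_zero]))
  obtain ⟨a, ha, hgrad⟩ := exists_smoothSup_subgradient hx
  refine ⟨a, ha, fun φ c hc hle heq h => ?_⟩
  obtain ⟨C₁, h₁⟩ := hgrad h
  obtain ⟨C₂, h₂⟩ := eventually_norm_add_smul_le hSx (smoothing h)
  set b := ‖smoothing x‖⁻¹ • smoothing x with hb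
  rw [← sub_eq_zero]
  refine eq_zero_of_eventually_mul_le_sq (C := c * (C₁ + C₂)) ?_
  filter_upwards [h₁, h₂] with t ht₁ ht₂
  have h3 := hle (x + t • h)
  have h4 := (le_abs_self _).trans (abs_pairing_le_smoothSup ha.le x)
  have h5 : inner ℝ b (smoothing x) = ‖smoothing x‖ := by
    rw [hb, inner_smul_left, real_inner_self_eq_norm_sq]
    simp only [map_inv₀, conj_trivial]
    have := norm_pos_iff.2 hSx
    field_simp
  rw [newNorm_apply, map_add φ, map_smul φ, heq, newNorm_apply, map_add smoothing,
    map_smul smoothing, smul_eq_mul] at h3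
  rw [map_add (pairing a), map_smul (pairing a), smul_eq_mul] at ht₁
  rw [inner_add_right, inner_smul_right, h5] at ht₂
  have h6 := mul_le_mul_of_nonneg_left (add_le_add ht₁ ht₂) hc
  have h7 := mul_le_mul_of_nonneg_left h4 hc
  linarith

theorem norm_le_two_mul_newNorm (x : C₀(ℕ, ℝ)) : ‖x‖ ≤ 2 * newNorm x := by
  have := norm_le_two_mul_smoothSup x
  rw [newNorm_apply]
  linarith [norm_nonneg (smoothing x)]

theorem newNorm_le_mul_norm (x : C₀(ℕ, ℝ)) : newNorm x ≤ (1 + ‖smoothing‖) * ‖x‖ := by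
  have h1 : smoothSup x ≤ ‖x‖ := smoothSup_le fun a ha => abs_pairing_le_norm ha x
  rw [newNorm_apply]
  linarith [smoothing.le_opNorm x]

theorem decomposition_unique {a a' : ℕ →₀ ℝ} {b b' : Hilb}
    (h : ∀ x, pairing a x + inner ℝ b (smoothing x) = pairing a' x + inner ℝ b' (smoothing x)) :
    a = a' ∧ b = b' := by
  have hb : b = b' := by
    rw [← sub_eq_zero]
    obtain ⟨N, hN⟩ := (a.support ∪ a'.support).exists_nat_subset_range
    refine eq_zero_of_inner_smoothing_unitVec N fun n hn => ?_
    have hns : n ∉ a.support ∪ a'.support := fun h => by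
      have := Finset.mem_range.1 (hN h)
      omega
    have := h (unitVec n)
    rw [pairing_unitVec, pairing_unitVec] at this
    rw [inner_sub_left]
    simp only [Finset.mem_union, Finsupp.mem_support_iff, not_or, not_not] at hns
    rw [hns.1, hns.2] at this
    linarith
  refine ⟨?_, hb⟩
  ext n
  have := h (unitVec n)
  rw [pairing_unitVec, pairing_unitVec, hb] at this
  linarith

theorem pairing_add_smul (a b : ℕ →₀ ℝ) (t : ℝ) (x : C₀(ℕ, ℝ)) :
    pairing (a + t • b) x = pairing a x + t * pairing b x := by
  rw [pairing_eq_sum (s := a.support ∪ b.support) (by simp_all),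
    pairing_eq_sum (a := a) (s := a.support ∪ b.support) (by simp_all),
    pairing_eq_sum (a := b) (s := a.support ∪ b.support) (by simp_all), Finset.mul_sum,
    ← Finset.sum_add_distrib]
  refine Finset.sum_congr rfl fun n _ => ?_
  simp only [Finsupp.add_apply, Finsupp.smul_apply, smul_eq_mul]
  ring

/-- A copy of the vector space `c₀`, to be normed by `newNorm`. -/
def RenormedSpace : Type := C₀(ℕ, ℝ)

namespace RenormedSpace

noncomputable instance : AddCommGroup RenormedSpace := inferInstanceAs (AddCommGroup C₀(ℕ, ℝ))

noncomputable instance : Module ℝ RenormedSpace := inferInstanceAs (Module ℝ C₀(ℕ, ℝ))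

/-- The identity map onto `c₀`. -/
noncomputable def toSeq : RenormedSpace ≃ₗ[ℝ] C₀(ℕ, ℝ) := LinearEquiv.refl ℝ C₀(ℕ, ℝ)

noncomputable instance : Norm RenormedSpace := ⟨fun x => newNorm (toSeq x)⟩

theorem norm_eq (x : RenormedSpace) : ‖x‖ = newNorm (toSeq x) := rfl

theorem core : NormedSpace.Core ℝ RenormedSpace where
  norm_nonneg x := apply_nonneg newNorm _
  norm_smul c x := by simp [norm_eq, map_smul_eq_mul]
  norm_triangle x y := by simpa [norm_eq] using map_add_le_add newNorm (toSeq x) (toSeq y)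
  norm_eq_zero_iff x := by
    refine ⟨fun h => ?_, fun h => by simp [norm_eq, h]⟩
    have := norm_le_two_mul_newNorm (toSeq x)
    rw [← norm_eq, h, mul_zero, norm_le_zero_iff] at this
    simpa using this

noncomputable instance : NormedAddCommGroup RenormedSpace := NormedAddCommGroup.ofCore core

noncomputable instance : NormedSpace ℝ RenormedSpace := NormedSpace.ofCore core

instance : CompleteSpace RenormedSpace := by
  have e : RenormedSpace ≃L[ℝ] C₀(ℕ, ℝ) := toSeq.toContinuousLinearEquivOfBounds 2
    (1 + ‖smoothing‖) (fun x => norm_le_two_mul_newNorm (toSeq x)) fun x => by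
      simpa [norm_eq] using newNorm_le_mul_norm x
  exact (completeSpace_congr (e := e.toEquiv) e.isUniformEmbedding).2 inferInstance

theorem not_finiteDimensional : ¬ FiniteDimensional ℝ RenormedSpace := by
  intro h
  have : FiniteDimensional ℝ C₀(ℕ, ℝ) := toSeq.finiteDimensional
  have hli : LinearIndependent ℝ unitVec := by
    refine linearIndependent_iff.2 fun l hl => ?_
    ext n
    have := congrArg (fun x : C₀(ℕ, ℝ) => x n) hl
    rw [← pairing_unitVec, pairing, LinearMap.coe_mk]
    rw [Finsupp.linearCombination_apply, Finsupp.sum] at this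
    have hsum : ∀ s : Finset ℕ, (∑ m ∈ s, l m • unitVec m) n = ∑ m ∈ s, l m * unitVec m n := by
      intro s
      induction s using Finset.induction_on with
      | empty => simp
      | insert m s hm ih => simp [Finset.sum_insert hm, ih]
    rw [hsum] at this
    simpa [unitVec_apply, Pi.single_comm, Pi.single_apply, eq_comm] using this
  exact not_finite_iff_infinite.2 inferInstance hli.finite

theorem exists_decomposition {f : RenormedSpace →L[ℝ] ℝ}
    (hf : ∃ x : RenormedSpace, ‖x‖ = 1 ∧ |f x| = ‖f‖) :
    ∃ (a : ℕ →₀ ℝ) (b : Hilb) (x : RenormedSpace), dualNorm a = ‖f‖ ∧ ‖b‖ = ‖f‖ ∧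
      (∀ y, f y = pairing a (toSeq y) + inner ℝ b (smoothing (toSeq y))) ∧
      ‖x‖ = 1 ∧ (∃ k : ℝ, 0 < k ∧ b = (‖f‖ * k) • smoothing (toSeq x)) ∧ f x = ‖f‖ ∧
      ∀ g : RenormedSpace →L[ℝ] ℝ, g x = ‖g‖ → ‖f‖ • g = ‖g‖ • f := by
  obtain ⟨x, hx, hfx⟩ : ∃ x : RenormedSpace, ‖x‖ = 1 ∧ f x = ‖f‖ := by
    obtain ⟨x, hx, hfx⟩ := hf
    rcases abs_choice (f x) with h | h
    · exact ⟨x, hx, by rw [← h, hfx]⟩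
    · exact ⟨-x, by rwa [norm_neg], by rw [map_neg, ← h, hfx]⟩
  have hx0 : toSeq x ≠ 0 := by
    intro h
    rw [norm_eq, h, map_zero] at hx
    exact zero_ne_one hx
  have hSx : 0 < ‖smoothing (toSeq x)‖ := norm_pos_iff.2 fun h =>
    hx0 (smoothing_injective (by rw [h, map_zero]))
  obtain ⟨a, ha, hgrad⟩ := exists_gradient hx0
  have hrep : ∀ g : RenormedSpace →L[ℝ] ℝ, g x = ‖g‖ → ∀ y, g y = ‖g‖ * (pairing a (toSeq y) +
      inner ℝ (‖smoothing (toSeq x)‖⁻¹ • smoothing (toSeq x)) (smoothing (toSeq y))) := by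
    intro g hg y
    refine hgrad (g.toLinearMap.comp toSeq.symm.toLinearMap) ‖g‖ (norm_nonneg g)
      (fun z => ?_) ?_ (toSeq y)
    · simpa [norm_eq] using (le_abs_self _).trans (g.le_opNorm (toSeq.symm z))
    · simpa [← norm_eq, hx] using hg
  refine ⟨‖f‖ • a, ‖f‖ • ‖smoothing (toSeq x)‖⁻¹ • smoothing (toSeq x), x, ?_, ?_, fun y => ?_, hx,
    ⟨‖smoothing (toSeq x)‖⁻¹, inv_pos.2 hSx, by rw [smul_smul]⟩, hfx, fun g hg => ?_⟩
  · rw [dualNorm_eq_sum (s := a.support) (by simp_all)]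
    simp only [Finsupp.smul_apply, smul_eq_mul, abs_mul, mul_pow, ← Finset.mul_sum, abs_norm]
    rw [Real.sqrt_mul (sq_nonneg _), Real.sqrt_sq (norm_nonneg f), ← mul_add]
    exact (congrArg _ ha).trans (mul_one _)
  · rw [norm_smul, norm_smul, norm_inv, norm_norm, norm_norm, inv_mul_cancel₀ hSx.ne', mul_one]
  · rw [hrep f hfx y, pairing_eq_sum (a := ‖f‖ • a) (s := a.support) (by simp_all),
      inner_smul_left (𝕜 := ℝ) (r := ‖f‖), mul_add]
    simp [pairing, Finset.mul_sum, mul_assoc, inner_smul_left]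
  · ext y
    simp only [smul_apply, smul_eq_mul]
    rw [hrep f hfx y, hrep g hg y]
    ring

theorem mem_span_singleton_of_ray_attaining {f g : RenormedSpace →L[ℝ] ℝ} (hf0 : f ≠ 0)
    (hg0 : g ≠ 0) (hg : ∃ x : RenormedSpace, ‖x‖ = 1 ∧ |g x| = ‖g‖)
    (h : ∀ t : ℝ, 0 ≤ t → ∃ x : RenormedSpace, ‖x‖ = 1 ∧ |(f + t • g) x| = ‖f + t • g‖) :
    f ∈ Submodule.span ℝ {g} := by
  have hf : ∃ x : RenormedSpace, ‖x‖ = 1 ∧ |f x| = ‖f‖ := by simpa using h 0 le_rfl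
  obtain ⟨a, v, x, -, -, hfrep, hx, ⟨k, hk, hvk⟩, hfx, -⟩ := exists_decomposition hf
  obtain ⟨b, w, y, hb, hw, hgrep, hy, ⟨l, hl, hwl⟩, -, hsmooth⟩ := exists_decomposition hg
  have hfpos : 0 < ‖f‖ := norm_pos_iff.2 hf0
  have hgpos : 0 < ‖g‖ := norm_pos_iff.2 hg0
  have hnorm : ∀ t : ℝ, 0 ≤ t →
      dualNorm (a + t • b) = ‖f + t • g‖ ∧ ‖v + t • w‖ = ‖f + t • g‖ := by
    intro t ht
    obtain ⟨a', v', _, ha', hv', hrep, -⟩ := exists_decomposition (h t ht)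
    obtain ⟨rfl, rfl⟩ := decomposition_unique (a := a') (a' := a + t • b) (b := v')
      (b' := v + t • w) fun z => by
        have h1 := hrep (toSeq.symm z)
        have h2 := hfrep (toSeq.symm z)
        have h3 := hgrep (toSeq.symm z)
        simp only [LinearEquiv.apply_symm_apply] at h1 h2 h3
        rw [← h1, pairing_add_smul, inner_add_left, inner_smul_left]
        simp only [add_apply, smul_apply, smul_eq_mul,
          conj_trivial]
        rw [h2, h3]
        ring
    exact ⟨ha', hv'⟩
  have hb0 : b ≠ 0 := by
    rintro rfl
    simp only [dualNorm, Finsupp.support_zero, Finset.sum_empty, Real.sqrt_zero, add_zero] at hb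
    exact hgpos.ne hb
  have hw0 : w ≠ 0 := norm_pos_iff.1 (hw ▸ hgpos)
  obtain ⟨c, hc⟩ := exists_eq_smul_of_dualNorm_eq hb0 hw0
    fun t ht => (hnorm t ht).1.trans (hnorm t ht).2.symm
  rcases le_or_gt c 0 with hc0 | hc0
  · have h1 := (hnorm (-c) (by linarith)).2
    rw [hc, neg_smul, add_neg_cancel, norm_zero, eq_comm, norm_eq_zero,
      add_eq_zero_iff_eq_neg] at h1
    rw [h1]
    exact Submodule.neg_mem _ (Submodule.smul_mem _ _ (Submodule.mem_span_singleton_self g))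
  · have h1 : x = ((‖f‖ * k)⁻¹ * (c * (‖g‖ * l))) • y := by
      apply toSeq.injective
      apply smoothing_injective
      rw [map_smul, map_smul, mul_smul, ← smul_smul c, ← hwl, ← hc, hvk, smul_smul,
        inv_mul_cancel₀ (by positivity), one_smul]
    have h2 : ((‖f‖ * k)⁻¹ * (c * (‖g‖ * l))) = 1 := by
      have := congrArg norm h1
      rwa [norm_smul, hx, hy, mul_one, Real.norm_of_nonneg (by positivity), eq_comm] at this
    rw [h2, one_smul] at h1
    have h3 := hsmooth f (h1 ▸ hfx)
    refine Submodule.mem_span_singleton.2 ⟨‖g‖⁻¹ * ‖f‖, ?_⟩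
    rw [mul_smul, ← h3, smul_smul, inv_mul_cancel₀ hgpos.ne', one_smul]

end RenormedSpace

end NormAttaining

/-- There exists an infinite-dimensional real Banach space `X` such that every convex cone
(a set closed under addition and multiplication by positive scalars) contained in the set
`NA(X, ℝ)` of norm-attaining functionals is contained in a one-dimensional subspace of `X*`. -/
theorem statement3 :
    ∃ (X : Type) (_ : NormedAddCommGroup X) (_ : NormedSpace ℝ X) (_ : CompleteSpace X),
      ¬ FiniteDimensional ℝ X ∧
      ∀ C : Set (X →L[ℝ] ℝ),
        (∀ f ∈ C, ∀ g ∈ C, f + g ∈ C) →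
        (∀ f ∈ C, ∀ c : ℝ, 0 < c → c • f ∈ C) →
        C ⊆ {h : X →L[ℝ] ℝ | ∃ x : X, ‖x‖ = 1 ∧ |h x| = ‖h‖} →
        ∃ D : Submodule ℝ (X →L[ℝ] ℝ), Module.finrank ℝ D = 1 ∧ C ⊆ (D : Set (X →L[ℝ] ℝ)) := by
  refine ⟨NormAttaining.RenormedSpace, inferInstance, inferInstance, inferInstance,
    NormAttaining.RenormedSpace.not_finiteDimensional, fun C hadd hsmul hC => ?_⟩
  by_cases h : ∃ g ∈ C, g ≠ 0
  · obtain ⟨g, hg, hg0⟩ := h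
    refine ⟨Submodule.span ℝ {g}, finrank_span_singleton hg0, fun f hf => ?_⟩
    rcases eq_or_ne f 0 with rfl | hf0
    · exact Submodule.zero_mem _
    refine NormAttaining.RenormedSpace.mem_span_singleton_of_ray_attaining hf0 hg0 (hC hg)
      fun t ht => ?_
    rcases ht.eq_or_lt with rfl | ht
    · simpa using hC hf
    · exact hC (hadd f hf _ (hsmul g hg t ht))
  · push Not at h
    have : Nontrivial NormAttaining.RenormedSpace := by
      by_contra hn
      have := not_nontrivial_iff_subsingleton.1 hn
      exact NormAttaining.RenormedSpace.not_finiteDimensional inferInstance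
    obtain ⟨x, hx⟩ := exists_ne (0 : NormAttaining.RenormedSpace)
    obtain ⟨g, -, hgx⟩ := exists_dual_vector ℝ x (norm_ne_zero_iff.2 hx)
    have hg0 : g ≠ 0 := by
      rintro rfl
      simp [eq_comm, hx] at hgx
    exact ⟨Submodule.span ℝ {g}, finrank_span_singleton hg0, fun f hf => by
      rw [h f hf]
      exact Submodule.zero_mem _⟩
end
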